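/- arXiv:1910.08204 — 6 statements merged into one kernel-verified Lean document; each statement's English description precedes it below -/
import Mathlib

section
/- Every continuously differentiable unipotent map G : ℝ² → ℝ² is bijective. -/
open Filter Topology

/-- A differentiable planar map is *unipotent* if at every point the Jacobian has
both eigenvalues equal to `1`; equivalently the trace of the Jacobian is `2` and
its determinant is `1` everywhere. -/
def Unipotent (G : ℝ × ℝ → ℝ × ℝ) : Prop :=
  ∀ z : ℝ × ℝ,
    (fderiv ℝ G z (1, 0)).1 + (fderiv ℝ G z (0, 1)).2 = 2 ∧
    (fderiv ℝ G z (1, 0)).1 * (fderiv ℝ G z (0, 1)).2 -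
      (fderiv ℝ G z (0, 1)).1 * (fderiv ℝ G z (1, 0)).2 = 1

/-- A planar map is *nonlinear* if its derivative is not constant, i.e. it is not affine. -/
def NonlinearMap (G : ℝ × ℝ → ℝ × ℝ) : Prop :=
  ¬ ∃ A : (ℝ × ℝ) →L[ℝ] ℝ × ℝ, ∀ z : ℝ × ℝ, fderiv ℝ G z = A

/-- A real function is *nonlinear* if it is not of the form `t ↦ k * t`. -/
def NonlinearFun (ψ : ℝ → ℝ) : Prop :=
  ¬ ∃ k : ℝ, ∀ t : ℝ, ψ t = k * t

/-- The linear rotation by angle `θ`. -/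
noncomputable def Rot (θ : ℝ) (p : ℝ × ℝ) : ℝ × ℝ :=
  (p.1 * Real.cos θ - p.2 * Real.sin θ, p.1 * Real.sin θ + p.2 * Real.cos θ)

/-- Nilpotency of the planar vector field `(u, v)`: its Jacobian has vanishing trace and
determinant at every point. -/
def NilpotentPair (u v : ℝ × ℝ → ℝ) : Prop :=
  ∀ z : ℝ × ℝ,
    fderiv ℝ u z (1, 0) + fderiv ℝ v z (0, 1) = 0 ∧
    fderiv ℝ u z (1, 0) * fderiv ℝ v z (0, 1) -
      fderiv ℝ u z (0, 1) * fderiv ℝ v z (1, 0) = 0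

theorem clm_prod_apply (A : ℝ × ℝ →L[ℝ] ℝ) (h k : ℝ) :
    A (h, k) = h * A (1, 0) + k * A (0, 1) := by
  have : ((h, k) : ℝ × ℝ) = h • (1, 0) + k • (0, 1) := by simp
  rw [this, map_add, map_smul, map_smul, smul_eq_mul, smul_eq_mul]

/-- Where `∂u/∂y ≠ 0`, the coordinates `(x, w) = (x, u (x, y))` are available; `Y x w` is the
ordinate of the point with these coordinates. For a nilpotent pair, `v` depends on `w` only and
its derivative is the slope of the level curve of `u`. -/
theorem NilpotentPair.exists_level_coordinates {u v : ℝ × ℝ → ℝ} (hN : NilpotentPair u v)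
    (hu : ContDiff ℝ 1 u) (hv : ContDiff ℝ 1 v) {x₀ y₀ : ℝ}
    (hux : fderiv ℝ u (x₀, y₀) (1, 0) = 0) (huy : fderiv ℝ u (x₀, y₀) (0, 1) ≠ 0) :
    ∃ w₀ : ℝ, ∃ ε > 0, ∃ Y m D : ℝ → ℝ → ℝ, Y x₀ w₀ = y₀ ∧
      ∀ x ∈ Metric.ball x₀ ε, ∀ w ∈ Metric.ball w₀ ε,
        HasDerivAt (fun s ↦ Y s w) (m x w) x ∧ HasDerivAt (fun s ↦ Y x s) (D x w) w ∧
        fderiv ℝ u (x, Y x w) (1, 0) + fderiv ℝ u (x, Y x w) (0, 1) * m x w = 0 ∧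
        fderiv ℝ u (x, Y x w) (0, 1) * D x w = 1 ∧
        HasDerivAt (fun s ↦ v (s, Y s w)) 0 x ∧ HasDerivAt (fun s ↦ v (x, Y x s)) (m x w) w := by
  set p : ℝ × ℝ := (x₀, y₀) with hp
  have hdu : Differentiable ℝ u := hu.differentiable one_ne_zero
  have hdv : Differentiable ℝ v := hv.differentiable one_ne_zero
  let Φ : ℝ × ℝ → ℝ × ℝ := fun z ↦ (z.1, u z)
  have hΦ : ContDiff ℝ 1 Φ := contDiff_fst.prodMk hu
  let L : (ℝ × ℝ) ≃L[ℝ] ℝ × ℝ := (ContinuousLinearEquiv.refl ℝ ℝ).prodCongr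
    (ContinuousLinearEquiv.unitsEquivAut ℝ (Units.mk0 _ huy))
  have hL : HasFDerivAt Φ (L : ℝ × ℝ →L[ℝ] ℝ × ℝ) p := by
    have h : HasFDerivAt Φ ((ContinuousLinearMap.fst ℝ ℝ ℝ).prod (fderiv ℝ u p)) p :=
      hasFDerivAt_fst.prodMk (hdu p).hasFDerivAt
    refine h.congr_fderiv ?_
    ext <;> simp [L, hux]
  let Ψ : ℝ × ℝ → ℝ × ℝ := hΦ.contDiffAt.localInverse hL one_ne_zero
  have hΨp : Ψ (x₀, u p) = p := hΦ.contDiffAt.localInverse_apply_image hL one_ne_zero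
  have hΨ : ContDiffAt ℝ 1 Ψ (x₀, u p) := hΦ.contDiffAt.to_localInverse hL one_ne_zero
  have hinv : ∀ᶠ z in 𝓝 (x₀, u p), Φ (Ψ z) = z :=
    (hΦ.contDiffAt.hasStrictFDerivAt' hL one_ne_zero).eventually_right_inverse
  have hdiff : ∀ᶠ z in 𝓝 (x₀, u p), DifferentiableAt ℝ Ψ z :=
    (hΨ.eventually (by simp)).mono fun z hz ↦ hz.differentiableAt one_ne_zero
  obtain ⟨ε, hε, hbox⟩ := Metric.eventually_nhds_iff_ball.1 (hinv.and hdiff)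
  refine ⟨u p, ε, hε, fun x w ↦ (Ψ (x, w)).2, fun x w ↦ (fderiv ℝ Ψ (x, w) (1, 0)).2,
    fun x w ↦ (fderiv ℝ Ψ (x, w) (0, 1)).2, congrArg Prod.snd hΨp, ?_⟩
  have hmem : ∀ x ∈ Metric.ball x₀ ε, ∀ w ∈ Metric.ball (u p) ε,
      ((x, w) : ℝ × ℝ) ∈ Metric.ball (x₀, u p) ε := fun x hx w hw ↦ by
    rw [← ball_prod_same]; exact ⟨hx, hw⟩
  have hgraph : ∀ x ∈ Metric.ball x₀ ε, ∀ w ∈ Metric.ball (u p) ε,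
      Ψ (x, w) = (x, (Ψ (x, w)).2) := fun x hx w hw ↦
    Prod.ext (by simpa [Φ] using congrArg Prod.fst (hbox _ (hmem x hx w hw)).1) rfl
  intro x hx w hw
  have hz := hmem x hx w hw
  set P := fderiv ℝ Ψ (x, w) with hP
  have hPd : HasFDerivAt Ψ P (x, w) := (hbox _ hz).2.hasFDerivAt
  have hcomp : HasFDerivAt (Φ ∘ Ψ) (((ContinuousLinearMap.fst ℝ ℝ ℝ).prod
      (fderiv ℝ u (Ψ (x, w)))).comp P) (x, w) :=
    (hasFDerivAt_fst.prodMk (hdu _).hasFDerivAt).comp _ hPd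
  have hid : HasFDerivAt (Φ ∘ Ψ) (ContinuousLinearMap.id ℝ (ℝ × ℝ)) (x, w) :=
    (hasFDerivAt_id _).congr_of_eventuallyEq <|
      (Metric.isOpen_ball.eventually_mem hz).mono fun z hz ↦ (hbox z hz).1
  have hPeq := fun h ↦ DFunLike.congr_fun (hcomp.unique hid) h
  have hP1 : ∀ h, (P h).1 = h.1 := fun h ↦ by simpa using congrArg Prod.fst (hPeq h)
  have hP2 : ∀ h, fderiv ℝ u (Ψ (x, w)) (P h) = h.2 := fun h ↦ by
    simpa using congrArg Prod.snd (hPeq h)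
  have hPsplit : ∀ (A : ℝ × ℝ →L[ℝ] ℝ) h, A (P h) = h.1 * A (1, 0) + (P h).2 * A (0, 1) :=
    fun A h ↦ by rw [← hP1 h, ← clm_prod_apply]
  have hline1 : HasDerivAt (fun s ↦ Ψ (s, w)) (P (1, 0)) x :=
    hPd.comp_hasDerivAt x ((hasDerivAt_id x).prodMk (hasDerivAt_const x w))
  have hline2 : HasDerivAt (fun s ↦ Ψ (x, s)) (P (0, 1)) w :=
    hPd.comp_hasDerivAt w ((hasDerivAt_const w x).prodMk (hasDerivAt_id w))
  have hv1 : HasDerivAt (fun s ↦ v (s, (Ψ (s, w)).2)) (fderiv ℝ v (Ψ (x, w)) (P (1, 0))) x :=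
    ((hdv _).hasFDerivAt.comp_hasDerivAt x hline1).congr_of_eventuallyEq <|
      (Metric.isOpen_ball.eventually_mem hx).mono fun s hs ↦ congrArg v (hgraph s hs w hw).symm
  have hv2 : HasDerivAt (fun s ↦ v (x, (Ψ (x, s)).2)) (fderiv ℝ v (Ψ (x, w)) (P (0, 1))) w :=
    ((hdv _).hasFDerivAt.comp_hasDerivAt w hline2).congr_of_eventuallyEq <|
      (Metric.isOpen_ball.eventually_mem hw).mono fun s hs ↦ congrArg v (hgraph x hx s hs).symm
  have e1 := hP2 (1, 0)
  have e2 := hP2 (0, 1)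
  rw [hPsplit] at hv1 hv2 e1 e2
  obtain ⟨htr, hdet⟩ := hN (Ψ (x, w))
  rw [← hgraph x hx w hw]
  have hne : fderiv ℝ u (Ψ (x, w)) (0, 1) ≠ 0 := by
    rintro h
    simp [h] at e2
  refine ⟨hline1.snd, hline2.snd, by linear_combination e1, by linear_combination e2,
    hv1.congr_deriv ?_, hv2.congr_deriv ?_⟩
  · refine (mul_eq_zero_iff_left hne).1 ?_
    linear_combination -hdet + fderiv ℝ v (Ψ (x, w)) (0, 1) * e1
  · linear_combination (P (0, 1)).2 * htr - (P (0, 1)).2 * e1 + (P (1, 0)).2 * e2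

/-- Near a point where `∂u/∂x = 0 ≠ ∂u/∂y`, the horizontal line is a level curve of a nilpotent
pair, and along it `∂u/∂y` is the inverse of an affine function. -/
theorem NilpotentPair.eventually_horizontal {u v : ℝ × ℝ → ℝ} (hN : NilpotentPair u v)
    (hu : ContDiff ℝ 1 u) (hv : ContDiff ℝ 1 v) {x₀ y₀ : ℝ}
    (hux : fderiv ℝ u (x₀, y₀) (1, 0) = 0) (huy : fderiv ℝ u (x₀, y₀) (0, 1) ≠ 0) :
    ∃ a b : ℝ, ∀ᶠ x in 𝓝 x₀, fderiv ℝ u (x, y₀) (1, 0) = 0 ∧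
      fderiv ℝ u (x, y₀) (0, 1) * (a + b * x) = 1 := by
  obtain ⟨w₀, ε, hε, Y, m, D, hY₀, hbox⟩ := hN.exists_level_coordinates hu hv hux huy
  have hx₀ : x₀ ∈ Metric.ball x₀ ε := Metric.mem_ball_self hε
  have hw₀ : w₀ ∈ Metric.ball w₀ ε := Metric.mem_ball_self hε
  have hconst : ∀ {f : ℝ → ℝ}, (∀ x ∈ Metric.ball x₀ ε, HasDerivAt f 0 x) →
      ∀ x ∈ Metric.ball x₀ ε, f x = f x₀ := fun {f} hf x hx ↦
    Metric.isOpen_ball.is_const_of_deriv_eq_zero (convex_ball x₀ ε).isPreconnected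
      (fun y hy ↦ (hf y hy).differentiableAt.differentiableWithinAt)
      (fun y hy ↦ (hf y hy).deriv) hx hx₀
  have hslope : ∀ x ∈ Metric.ball x₀ ε, ∀ w ∈ Metric.ball w₀ ε, m x w = m x₀ w := by
    intro x hx w hw
    have h0 := (hbox x₀ hx₀ w hw).2.2.2.2.2
    refine (hbox x hx w hw).2.2.2.2.2.unique (h0.congr_of_eventuallyEq ?_)
    exact (Metric.isOpen_ball.eventually_mem hw).mono fun s hs ↦
      hconst (fun y hy ↦ (hbox y hy s hs).2.2.2.2.1) x hx
  have hline : ∀ x ∈ Metric.ball x₀ ε, ∀ w ∈ Metric.ball w₀ ε,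
      Y x w = Y x₀ w + m x₀ w * (x - x₀) := by
    intro x hx w hw
    have := hconst (f := fun s ↦ Y s w - m x₀ w * s) (fun y hy ↦
      ((hbox y hy w hw).1.sub ((hasDerivAt_id y).const_mul (m x₀ w))).congr_deriv
        (by rw [hslope y hy w hw, mul_one, sub_self])) x hx
    linear_combination this
  have hm₀ : m x₀ w₀ = 0 := by
    have h := (hbox x₀ hx₀ w₀ hw₀).2.2.1
    rw [hY₀, hux, zero_add] at h
    exact (mul_eq_zero_iff_left huy).1 h
  have hYw₀ : ∀ x ∈ Metric.ball x₀ ε, Y x w₀ = y₀ := fun x hx ↦ by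
    rw [hline x hx w₀ hw₀, hY₀, hm₀, zero_mul, add_zero]
  set x₁ := x₀ + ε / 2 with hx₁
  have hx₁m : x₁ ∈ Metric.ball x₀ ε := by
    rw [Metric.mem_ball, Real.dist_eq, hx₁, add_sub_cancel_left, abs_of_pos] <;> linarith
  have hD : ∀ x ∈ Metric.ball x₀ ε,
      D x w₀ = D x₀ w₀ + (D x₁ w₀ - D x₀ w₀) * ((x - x₀) / (ε / 2)) := by
    intro x hx
    refine (hbox x hx w₀ hw₀).2.1.unique (HasDerivAt.congr_of_eventuallyEq
      ((hbox x₀ hx₀ w₀ hw₀).2.1.add (((hbox x₁ hx₁m w₀ hw₀).2.1.sub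
        (hbox x₀ hx₀ w₀ hw₀).2.1).mul_const ((x - x₀) / (ε / 2)))) ?_)
    refine (Metric.isOpen_ball.eventually_mem hw₀).mono fun s hs ↦ ?_
    have e1 := hline x hx s hs
    have e2 := hline x₁ hx₁m s hs
    simp only [Pi.add_apply, Pi.sub_apply]
    rw [e1, e2, hx₁]
    field_simp
    ring
  refine ⟨D x₀ w₀ - (D x₁ w₀ - D x₀ w₀) * (x₀ / (ε / 2)), (D x₁ w₀ - D x₀ w₀) / (ε / 2),
    (Metric.isOpen_ball.eventually_mem hx₀).mono fun x hx ↦ ?_⟩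
  obtain ⟨-, -, h1, h2, -⟩ := hbox x hx w₀ hw₀
  rw [hYw₀ x hx] at h1 h2
  rw [hslope x hx w₀ hw₀, hm₀, mul_zero, add_zero] at h1
  refine ⟨h1, ?_⟩
  rw [hD x hx] at h2
  linear_combination h2

/-- If `∂u/∂x = 0 ≠ ∂u/∂y` at one point, then the same holds along the whole horizontal line through
it: the set where `1 / (∂u/∂y)` is locally a given affine function is open and closed. -/
theorem NilpotentPair.horizontal {u v : ℝ × ℝ → ℝ} (hN : NilpotentPair u v)
    (hu : ContDiff ℝ 1 u) (hv : ContDiff ℝ 1 v) {x₀ y₀ : ℝ}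
    (hux : fderiv ℝ u (x₀, y₀) (1, 0) = 0) (huy : fderiv ℝ u (x₀, y₀) (0, 1) ≠ 0) (x : ℝ) :
    fderiv ℝ u (x, y₀) (1, 0) = 0 ∧ fderiv ℝ u (x, y₀) (0, 1) ≠ 0 := by
  obtain ⟨a, b, hab⟩ := hN.eventually_horizontal hu hv hux huy
  let Q : ℝ → Prop := fun x ↦ fderiv ℝ u (x, y₀) (1, 0) = 0 ∧
      fderiv ℝ u (x, y₀) (0, 1) * (a + b * x) = 1
  have hcont : ∀ h, Continuous fun x ↦ fderiv ℝ u (x, y₀) h := fun h ↦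
    ((hu.continuous_fderiv one_ne_zero).comp
      (by fun_prop : Continuous fun x : ℝ ↦ (x, y₀))).clm_apply continuous_const
  have hQclosed : IsClosed {x | Q x} :=
    (isClosed_eq (hcont _) continuous_const).inter
      (isClosed_eq ((hcont _).mul (by fun_prop)) continuous_const)
  have hTsub : closure {x | ∀ᶠ y in 𝓝 x, Q y} ⊆ {x | Q x} :=
    closure_minimal (fun x hx ↦ hx.self_of_nhds) hQclosed
  have hne : ∀ {x}, Q x → fderiv ℝ u (x, y₀) (0, 1) ≠ 0 := fun {x} hx h ↦ by
    simpa [h] using hx.2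
  have hclopen : IsClopen {x | ∀ᶠ y in 𝓝 x, Q y} := by
    refine ⟨isClosed_of_closure_subset fun x hx ↦ ?_, isOpen_setOfPred_eventually_nhds⟩
    have hQx := hTsub hx
    obtain ⟨a', b', hab'⟩ := hN.eventually_horizontal hu hv hQx.1 (hne hQx)
    obtain ⟨y, hy', hy⟩ := (mem_closure_iff_frequently.1 hx).and_eventually
      hab'.eventually_nhds |>.exists
    have hagree : ∀ᶠ s in 𝓝 y, a + b * s = a' + b' * s := by
      filter_upwards [hy', hy] with s h h'
      exact mul_left_cancel₀ (hne h) (h.2.trans h'.2.symm)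
    have hb : b = b' := by
      have h1 : HasDerivAt (fun s ↦ a + b * s) b y := by
        simpa using ((hasDerivAt_id y).const_mul b).const_add a
      have h2 : HasDerivAt (fun s ↦ a' + b' * s) b' y := by
        simpa using ((hasDerivAt_id y).const_mul b').const_add a'
      exact h1.unique (h2.congr_of_eventuallyEq hagree)
    have ha : a = a' := by
      have := hagree.self_of_nhds
      rw [hb] at this
      linarith
    simpa [Q, ha, hb] using hab'
  have huniv : {x | ∀ᶠ y in 𝓝 x, Q y} = Set.univ := hclopen.eq_univ ⟨x₀, hab⟩
  have hx : Q x := (huniv ▸ Set.mem_univ x : x ∈ {x | ∀ᶠ y in 𝓝 x, Q y}).self_of_nhds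
  exact ⟨hx.1, hne hx⟩

/-- At a point where the Jacobian of a nilpotent pair is nonzero, the whole line through that point
in the direction of the kernel consists of such points, with the same kernel. -/
theorem NilpotentPair.kernel_line {u v : ℝ × ℝ → ℝ} (hN : NilpotentPair u v)
    (hu : ContDiff ℝ 1 u) (hv : ContDiff ℝ 1 v) {p : ℝ × ℝ} {c d : ℝ} (hcd : c ^ 2 + d ^ 2 ≠ 0)
    (hcu : fderiv ℝ u p (c, d) = 0) (hcv : fderiv ℝ v p (c, d) = 0)
    (hp : ¬(fderiv ℝ u p = 0 ∧ fderiv ℝ v p = 0)) (s : ℝ) :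
    fderiv ℝ u (p + s • (c, d)) (c, d) = 0 ∧ fderiv ℝ v (p + s • (c, d)) (c, d) = 0 ∧
      ¬(fderiv ℝ u (p + s • (c, d)) = 0 ∧ fderiv ℝ v (p + s • (c, d)) = 0) := by
  have hdu : Differentiable ℝ u := hu.differentiable one_ne_zero
  have hdv : Differentiable ℝ v := hv.differentiable one_ne_zero
  let A : ℝ × ℝ →L[ℝ] ℝ × ℝ :=
    (c • ContinuousLinearMap.fst ℝ ℝ ℝ - d • ContinuousLinearMap.snd ℝ ℝ ℝ).prod
      (d • ContinuousLinearMap.fst ℝ ℝ ℝ + c • ContinuousLinearMap.snd ℝ ℝ ℝ)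
  have hA : ∀ h k, A (h, k) = (c * h - d * k, d * h + c * k) := fun h k ↦ by simp [A]
  have hcomb : ∀ (a b : ℝ) z h, fderiv ℝ (fun z ↦ a * u (p + A z) + b * v (p + A z)) z h =
      a * fderiv ℝ u (p + A z) (A h) + b * fderiv ℝ v (p + A z) (A h) := fun a b z h ↦ by
    have hpA : HasFDerivAt (fun z ↦ p + A z) A z := A.hasFDerivAt.const_add p
    have hUz := (((hdu (p + A z)).hasFDerivAt.comp z hpA).const_mul a).add
      (((hdv (p + A z)).hasFDerivAt.comp z hpA).const_mul b)
    exact DFunLike.congr_fun hUz.fderiv h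
  have hA1 : A (1, 0) = (c, d) := by simp [hA]
  have hA2 : A (0, 1) = (-d, c) := by simp [hA]
  have hAs : A (s, 0) = s • (c, d) := by simp [hA, mul_comm]
  have hAc : ContDiff ℝ 1 fun z ↦ p + A z := contDiff_const.add A.contDiff
  have hcd2 : ∀ a b : ℝ, ContDiff ℝ 1 fun z ↦ a * u (p + A z) + b * v (p + A z) := fun a b ↦
    (contDiff_const.mul (hu.comp hAc)).add (contDiff_const.mul (hv.comp hAc))
  have hN' : NilpotentPair (fun z ↦ c * u (p + A z) + d * v (p + A z))
      (fun z ↦ -d * u (p + A z) + c * v (p + A z)) := fun z ↦ by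
    obtain ⟨htr, hdet⟩ := hN (p + A z)
    simp only [hcomb, hA1, hA2, clm_prod_apply _ c d, clm_prod_apply _ (-d) c]
    constructor
    · linear_combination (c ^ 2 + d ^ 2) * htr
    · linear_combination (c ^ 2 + d ^ 2) ^ 2 * hdet
  have hker : ∀ q, fderiv ℝ u q (-d, c) = 0 → fderiv ℝ v q (-d, c) = 0 →
      fderiv ℝ u q (c, d) = 0 → fderiv ℝ v q (c, d) = 0 →
      fderiv ℝ u q = 0 ∧ fderiv ℝ v q = 0 := by
    have key : ∀ B : ℝ × ℝ →L[ℝ] ℝ, B (-d, c) = 0 → B (c, d) = 0 → B = 0 := fun B h1 h2 ↦ by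
      rw [clm_prod_apply] at h1 h2
      have e1 : B (1, 0) = 0 := (mul_eq_zero_iff_left hcd).1 (by
        linear_combination c * h2 - d * h1)
      have e2 : B (0, 1) = 0 := (mul_eq_zero_iff_left hcd).1 (by
        linear_combination d * h2 + c * h1)
      ext <;> simp [e1, e2]
    exact fun q h1 h2 h3 h4 ↦ ⟨key _ h1 h3, key _ h2 h4⟩
  have hA0 : p + A ((0 : ℝ), (0 : ℝ)) = p := by simp [hA]
  have hmain := hN'.horizontal (hcd2 _ _) (hcd2 _ _) (x₀ := 0) (y₀ := 0)
    (by rw [hcomb, hA1, hA0, hcu, hcv]; ring)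
    (by
      rw [hcomb, hA2, hA0]
      intro h
      have htr := (hN p).1
      rw [clm_prod_apply] at hcu hcv
      have h' : -d * fderiv ℝ u p (-d, c) + c * fderiv ℝ v p (-d, c) = 0 := by
        rw [clm_prod_apply _ (-d), clm_prod_apply _ (-d)]
        linear_combination (c ^ 2 + d ^ 2) * htr - c * hcu - d * hcv
      refine hp (hker p ?_ ?_ (by rwa [clm_prod_apply]) (by rwa [clm_prod_apply])) <;>
        refine (mul_eq_zero_iff_left hcd).1 ?_
      · linear_combination c * h - d * h'
      · linear_combination d * h + c * h') s
  obtain ⟨htr, hdet⟩ := hN' (s, 0)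
  simp only [hcomb, hA1, hA2, hAs] at hmain htr hdet
  obtain ⟨h1, h2⟩ := hmain
  have h3 : -d * fderiv ℝ u (p + s • (c, d)) (c, d) + c * fderiv ℝ v (p + s • (c, d)) (c, d) = 0 :=
    (mul_eq_zero_iff_left h2).1 (by
    linear_combination -hdet + (-d * fderiv ℝ u (p + s • (c, d)) (-d, c) +
      c * fderiv ℝ v (p + s • (c, d)) (-d, c)) * h1)
  refine ⟨(mul_eq_zero_iff_left hcd).1 ?_, (mul_eq_zero_iff_left hcd).1 ?_, fun h ↦ h2 ?_⟩
  · linear_combination c * h1 - d * h3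
  · linear_combination d * h1 + c * h3
  · rw [h.1, h.2]; simp

theorem NilpotentPair.exists_kernel {u v : ℝ × ℝ → ℝ} (hN : NilpotentPair u v) (p : ℝ × ℝ) :
    ∃ c d : ℝ, c ^ 2 + d ^ 2 ≠ 0 ∧ fderiv ℝ u p (c, d) = 0 ∧ fderiv ℝ v p (c, d) = 0 := by
  obtain ⟨htr, hdet⟩ := hN p
  by_cases h : fderiv ℝ u p (0, 1) ^ 2 + (-fderiv ℝ u p (1, 0)) ^ 2 = 0
  · have h1 : fderiv ℝ u p (1, 0) = 0 := by nlinarith [sq_nonneg (fderiv ℝ u p (0, 1))]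
    have h2 : fderiv ℝ u p (0, 1) = 0 := by nlinarith [sq_nonneg (fderiv ℝ u p (1, 0))]
    exact ⟨0, 1, by norm_num, h2, by linarith⟩
  · refine ⟨_, _, h, ?_, ?_⟩ <;> rw [clm_prod_apply]
    · ring
    · linear_combination -hdet

/-- The Jacobians of a nilpotent pair have a common kernel vector. -/
theorem NilpotentPair.exists_common_kernel {u v : ℝ × ℝ → ℝ} (hN : NilpotentPair u v)
    (hu : ContDiff ℝ 1 u) (hv : ContDiff ℝ 1 v) :
    ∃ c d : ℝ, c ^ 2 + d ^ 2 ≠ 0 ∧ ∀ z, fderiv ℝ u z (c, d) = 0 ∧ fderiv ℝ v z (c, d) = 0 := by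
  by_cases hD : ∃ p, ¬(fderiv ℝ u p = 0 ∧ fderiv ℝ v p = 0)
  swap
  · push Not at hD
    exact ⟨1, 0, by norm_num, fun z ↦ by simp [hD z]⟩
  obtain ⟨p, hp⟩ := hD
  obtain ⟨c, d, hcd, hcu, hcv⟩ := hN.exists_kernel p
  refine ⟨c, d, hcd, fun q ↦ ?_⟩
  by_cases hq : fderiv ℝ u q = 0 ∧ fderiv ℝ v q = 0
  · simp [hq.1, hq.2]
  obtain ⟨c', d', hcd', hcu', hcv'⟩ := hN.exists_kernel q
  by_cases hdet : c * d' - d * c' = 0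
  · have key : ∀ B : ℝ × ℝ →L[ℝ] ℝ, B (c', d') = 0 → B (c, d) = 0 := fun B hB ↦ by
      refine (mul_eq_zero_iff_left hcd').1 ?_
      rw [clm_prod_apply] at hB ⊢
      linear_combination (c * c' + d * d') * hB + (d' * B (1, 0) - c' * B (0, 1)) * hdet
    exact ⟨key _ hcu', key _ hcv'⟩
  · exfalso
    obtain ⟨s, hs⟩ : ∃ s, s * (c * d' - d * c') = (q.1 - p.1) * d' - (q.2 - p.2) * c' :=
      ⟨_, div_mul_cancel₀ _ hdet⟩
    obtain ⟨t, ht⟩ : ∃ t, t * (c * d' - d * c') = (q.1 - p.1) * d - (q.2 - p.2) * c :=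
      ⟨_, div_mul_cancel₀ _ hdet⟩
    have hmeet : p + s • (c, d) = q + t • (c', d') := by
      ext <;> simp only [Prod.fst_add, Prod.snd_add, Prod.smul_mk, smul_eq_mul] <;>
        apply mul_left_cancel₀ hdet
      · linear_combination c * hs - c' * ht
      · linear_combination d * hs - d' * ht
    obtain ⟨h1, h2, h3⟩ := hN.kernel_line hu hv hcd hcu hcv hp s
    obtain ⟨h1', h2', -⟩ := hN.kernel_line hu hv hcd' hcu' hcv' hq t
    rw [← hmeet] at h1' h2'
    have key : ∀ B : ℝ × ℝ →L[ℝ] ℝ, B (c, d) = 0 → B (c', d') = 0 → B = 0 := fun B h h' ↦ by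
      rw [clm_prod_apply] at h h'
      have e1 : B (1, 0) = 0 := (mul_eq_zero_iff_left hdet).1 (by
        linear_combination d' * h - d * h')
      have e2 : B (0, 1) = 0 := (mul_eq_zero_iff_left hdet).1 (by
        linear_combination c * h' - c' * h)
      ext <;> simp [e1, e2]
    exact h3 ⟨key _ h1 h1', key _ h2 h2'⟩

/-- A nilpotent pair takes values on a line, and is constant on every parallel to it. -/
theorem NilpotentPair.exists_direction {u v : ℝ × ℝ → ℝ} (hN : NilpotentPair u v)
    (hu : ContDiff ℝ 1 u) (hv : ContDiff ℝ 1 v) :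
    ∃ e : ℝ × ℝ, (∀ z (t : ℝ), u (z + t • e) = u z ∧ v (z + t • e) = v z) ∧
      ∀ z w, ∃ t : ℝ, ((u z, v z) : ℝ × ℝ) = (u w, v w) + t • e := by
  have hdu : Differentiable ℝ u := hu.differentiable one_ne_zero
  have hdv : Differentiable ℝ v := hv.differentiable one_ne_zero
  obtain ⟨c, d, hcd, hker⟩ := hN.exists_common_kernel hu hv
  have hline : ∀ f : ℝ × ℝ → ℝ, Differentiable ℝ f → (∀ z, fderiv ℝ f z (c, d) = 0) →
      ∀ z (t : ℝ), f (z + t • (c, d)) = f z := fun f hf h z t ↦ by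
    have hd : ∀ s : ℝ, HasDerivAt (fun s : ℝ ↦ f (z + s • (c, d))) 0 s := fun s ↦ by
      have h1 : HasDerivAt (fun s : ℝ ↦ z + s • (c, d)) ((1 : ℝ) • (c, d)) s :=
        ((hasDerivAt_id s).smul_const (c, d)).const_add z
      have h2 := (hf (z + s • (c, d))).hasFDerivAt.comp_hasDerivAt s h1
      rw [one_smul, h] at h2
      exact h2
    simpa using is_const_of_deriv_eq_zero (fun s ↦ (hd s).differentiableAt)
      (fun s ↦ (hd s).deriv) t 0
  have hval : ∀ z w, d * u z - c * v z = d * u w - c * v w := fun z w ↦ by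
    have hd : ∀ z, HasFDerivAt (fun z ↦ d * u z - c * v z) (0 : ℝ × ℝ →L[ℝ] ℝ) z := fun z ↦ by
      refine (((hdu z).hasFDerivAt.const_mul d).sub
        ((hdv z).hasFDerivAt.const_mul c)).congr_fderiv ?_
      obtain ⟨h1, h2⟩ := hker z
      obtain ⟨htr, -⟩ := hN z
      rw [clm_prod_apply] at h1 h2
      ext
      · simp
        linear_combination d * htr - h2
      · simp
        linear_combination h1 - c * htr
    exact is_const_of_fderiv_eq_zero (fun z ↦ (hd z).differentiableAt) (fun z ↦ (hd z).fderiv) z w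
  refine ⟨(c, d), fun z t ↦ ⟨hline u hdu (fun z ↦ (hker z).1) z t,
    hline v hdv (fun z ↦ (hker z).2) z t⟩, fun z w ↦
    ⟨((u z - u w) * c + (v z - v w) * d) / (c ^ 2 + d ^ 2), ?_⟩⟩
  have h := hval z w
  ext <;> simp only [Prod.fst_add, Prod.snd_add, Prod.smul_mk, smul_eq_mul] <;> field_simp
  · linear_combination d * h
  · linear_combination -c * h

/-- every `C¹` unipotent planar map is bijective. -/
theorem statement2 (G : ℝ × ℝ → ℝ × ℝ) (hG : ContDiff ℝ 1 G) (hU : Unipotent G) :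
    Function.Bijective G := by
  set H : ℝ × ℝ → ℝ × ℝ := fun z ↦ G z - z with hH
  have hHc : ContDiff ℝ 1 H := hG.sub contDiff_id
  have hd : ∀ z, HasFDerivAt H (fderiv ℝ G z - ContinuousLinearMap.id ℝ (ℝ × ℝ)) z := fun z ↦
    (hG.differentiable one_ne_zero z).hasFDerivAt.sub (hasFDerivAt_id z)
  have hN : NilpotentPair (fun z ↦ (H z).1) (fun z ↦ (H z).2) := fun z ↦ by
    obtain ⟨htr, hdet⟩ := hU z
    rw [(hd z).fst.fderiv, (hd z).snd.fderiv]
    simp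
    constructor
    · linear_combination htr
    · linear_combination hdet - htr
  obtain ⟨e, hconst, hval⟩ := hN.exists_direction hHc.fst hHc.snd
  have hconst' : ∀ z (t : ℝ), H (z + t • e) = H z := fun z t ↦
    Prod.ext (hconst z t).1 (hconst z t).2
  have hval' : ∀ z w, ∃ t : ℝ, H z = H w + t • e := hval
  have hGH : ∀ z, G z = z + H z := fun z ↦ by simp [hH]
  constructor
  · intro p q hpq
    rw [hGH, hGH] at hpq
    obtain ⟨t, ht⟩ := hval' q p
    have hp : p = q + t • e := by
      rw [ht, ← add_assoc, add_right_comm] at hpq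
      exact add_right_cancel hpq
    have hHp : H p = H q := by rw [hp, hconst']
    rw [hHp] at hpq
    exact add_right_cancel hpq
  · intro w
    obtain ⟨t, ht⟩ := hval' 0 (w - H 0)
    refine ⟨w - H (w - H 0), ?_⟩
    have hz : w - H (w - H 0) = w - H 0 + t • e := by
      rw [sub_add, ← eq_sub_of_add_eq ht.symm]
    rw [hGH]
    nth_rewrite 2 [hz]
    rw [hconst', sub_add_cancel]
end

section
/- Let G : ℝ² → ℝ² be a continuously differentiable map. Then the following are equivalent: (1) G is unipotent, G is nonlinear, and G(0,0) = (0,0); (2) there exist a nonlinear continuously differentiable function ψ : ℝ → ℝ with ψ(0) = 0 and real numbers α, β with α² + β² = 1 such that G(x,y) = (x + β·ψ(α·x + β·y), y − α·ψ(α·x + β·y)) for all (x,y) ∈ ℝ². -/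
open Filter Topology

theorem fderiv_prod_apply {A : ℝ × ℝ → ℝ} (z v : ℝ × ℝ) :
    fderiv ℝ A z v = v.1 * fderiv ℝ A z (1, 0) + v.2 * fderiv ℝ A z (0, 1) := by
  have h : v = v.1 • ((1, 0) : ℝ × ℝ) + v.2 • ((0, 1) : ℝ × ℝ) := by ext <;> simp
  conv_lhs => rw [h]
  simp only [map_add, map_smul, smul_eq_mul]

/-- The linear automorphism `(x, y) ↦ (a x + b y, y)` of the plane, for `a ≠ 0`. -/
noncomputable def shearEquiv (a b : ℝ) (ha : a ≠ 0) : (ℝ × ℝ) ≃L[ℝ] ℝ × ℝ :=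
  ContinuousLinearEquiv.equivOfInverse
    ((a • ContinuousLinearMap.fst ℝ ℝ ℝ + b • ContinuousLinearMap.snd ℝ ℝ ℝ).prod
      (ContinuousLinearMap.snd ℝ ℝ ℝ))
    ((a⁻¹ • (ContinuousLinearMap.fst ℝ ℝ ℝ - b • ContinuousLinearMap.snd ℝ ℝ ℝ)).prod
      (ContinuousLinearMap.snd ℝ ℝ ℝ))
    (fun z => by ext <;> simp; field_simp)
    (fun z => by ext <;> simp; field_simp; ring)

theorem hasStrictFDerivAt_prodMk_snd {A : ℝ × ℝ → ℝ} (hA : ContDiff ℝ 1 A) {z : ℝ × ℝ}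
    (hz : fderiv ℝ A z (1, 0) ≠ 0) :
    HasStrictFDerivAt (fun w : ℝ × ℝ => (A w, w.2))
      (shearEquiv (fderiv ℝ A z (1, 0)) (fderiv ℝ A z (0, 1)) hz : (ℝ × ℝ) →L[ℝ] ℝ × ℝ) z := by
  have h1 : HasStrictFDerivAt A (fderiv ℝ A z) z :=
    hA.contDiffAt.hasStrictFDerivAt (by norm_num)
  refine (h1.prodMk hasStrictFDerivAt_snd).congr_fderiv (ContinuousLinearMap.ext fun v => ?_)
  ext
  · simp [shearEquiv, fderiv_prod_apply z v, mul_comm]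
  · simp [shearEquiv]

/-- Where `∂A/∂x ≠ 0`, the equation `A (x, y) = s` can be solved for `x = X (s, y)`. -/
theorem exists_local_inverse {A : ℝ × ℝ → ℝ} (hA : ContDiff ℝ 1 A) {q : ℝ × ℝ}
    (hq : fderiv ℝ A q (1, 0) ≠ 0) :
    ∃ (X : ℝ × ℝ → ℝ) (r : ℝ), 0 < r ∧ X (A q, q.2) = q.1 ∧
      ∀ w ∈ Metric.ball (A q, q.2) r, fderiv ℝ A (X w, w.2) (1, 0) ≠ 0 ∧
        HasFDerivAt X ((fderiv ℝ A (X w, w.2) (1, 0))⁻¹ • (ContinuousLinearMap.fst ℝ ℝ ℝ -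
          fderiv ℝ A (X w, w.2) (0, 1) • ContinuousLinearMap.snd ℝ ℝ ℝ)) w := by
  have hs := hasStrictFDerivAt_prodMk_snd hA hq
  set e := hs.toOpenPartialHomeomorph (fun w : ℝ × ℝ => (A w, w.2))
  have hqs : q ∈ e.source := hs.mem_toOpenPartialHomeomorph_source
  have hqt : (A q, q.2) ∈ e.target := e.map_source hqs
  have hsymm : e.symm (A q, q.2) = q := e.left_inv hqs
  have hcont : Continuous fun z => fderiv ℝ A z (1, 0) :=
    (hA.continuous_fderiv (by norm_num)).clm_apply continuous_const
  have hev : ∀ᶠ w in 𝓝 (A q, q.2), w ∈ e.target ∧ fderiv ℝ A (e.symm w) (1, 0) ≠ 0 := by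
    refine Filter.Eventually.and (e.open_target.mem_nhds hqt) ?_
    have h1 : ContinuousAt (fun w => fderiv ℝ A (e.symm w) (1, 0)) (A q, q.2) :=
      hcont.continuousAt.comp (e.symm.continuousAt hqt)
    exact h1.eventually_ne (by rwa [hsymm])
  obtain ⟨r, hr, hball⟩ := Metric.eventually_nhds_iff_ball.1 hev
  refine ⟨fun w => (e.symm w).1, r, hr, congrArg Prod.fst hsymm, fun w hw => ?_⟩
  obtain ⟨hwt, hne⟩ := hball w hw
  have h2 : (e.symm w).2 = w.2 :=
    congrArg Prod.snd (a₁ := (A (e.symm w), (e.symm w).2)) (e.right_inv hwt)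
  have h3 : ((e.symm w).1, w.2) = e.symm w := by rw [← h2]
  simp only [h3]
  refine ⟨hne, ?_⟩
  exact (e.hasFDerivAt_symm hwt (hasStrictFDerivAt_prodMk_snd hA hne).hasFDerivAt).fst

/-- Local structure of a closed field `(A, B)` with singular Jacobian: its level curves are
straight segments, along which the reciprocal of `∂A/∂x` is affine. -/
theorem exists_local_ruling {A B : ℝ × ℝ → ℝ} (hA : ContDiff ℝ 1 A) (hB : ContDiff ℝ 1 B)
    (hsym : ∀ z, fderiv ℝ A z (0, 1) = fderiv ℝ B z (1, 0))
    (hdet : ∀ z, fderiv ℝ A z (1, 0) * fderiv ℝ B z (0, 1) =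
      fderiv ℝ A z (0, 1) * fderiv ℝ B z (1, 0))
    {q : ℝ × ℝ} {m : ℝ} (hq : fderiv ℝ A q (1, 0) ≠ 0)
    (hm : fderiv ℝ A q (0, 1) = m * fderiv ℝ A q (1, 0)) :
    ∃ c d : ℝ, ∀ᶠ t in 𝓝 (0 : ℝ),
      fderiv ℝ A (q.1 - m * t, q.2 + t) (1, 0) * (c + d * t) = 1 ∧
      fderiv ℝ A (q.1 - m * t, q.2 + t) (0, 1) =
        m * fderiv ℝ A (q.1 - m * t, q.2 + t) (1, 0) := by
  obtain ⟨X, r, hr, hXq, hX⟩ := exists_local_inverse hA hq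
  set s₀ := A q
  have hmem : ∀ {s y : ℝ}, s ∈ Metric.ball s₀ r → y ∈ Metric.ball q.2 r →
      (s, y) ∈ Metric.ball (s₀, q.2) r := by
    intro s y hs hy
    rw [← ball_prod_same]
    exact ⟨hs, hy⟩
  have hXs : ∀ {s y : ℝ}, s ∈ Metric.ball s₀ r → y ∈ Metric.ball q.2 r →
      HasDerivAt (fun s' => X (s', y)) (fderiv ℝ A (X (s, y), y) (1, 0))⁻¹ s := by
    intro s y hs hy
    have h := (hX _ (hmem hs hy)).2.comp_hasDerivAt s
      ((hasDerivAt_id' s).prodMk (hasDerivAt_const s y))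
    exact h.congr_deriv (by simp)
  have hXy : ∀ {s y : ℝ}, s ∈ Metric.ball s₀ r → y ∈ Metric.ball q.2 r →
      HasDerivAt (fun y' => X (s, y'))
        (-((fderiv ℝ A (X (s, y), y) (1, 0))⁻¹ * fderiv ℝ A (X (s, y), y) (0, 1))) y := by
    intro s y hs hy
    have h := (hX _ (hmem hs hy)).2.comp_hasDerivAt y
      ((hasDerivAt_const y s).prodMk (hasDerivAt_id' y))
    exact h.congr_deriv (by simp)
  have hBd : ∀ z, HasFDerivAt B (fderiv ℝ B z) z := fun z =>
    (hB.differentiable (by norm_num) z).hasFDerivAt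
  have hBy : ∀ {s y : ℝ}, s ∈ Metric.ball s₀ r → y ∈ Metric.ball q.2 r →
      HasDerivAt (fun y' => B (X (s, y'), y')) 0 y := by
    intro s y hs hy
    have h := (hBd (X (s, y), y)).comp_hasDerivAt (f := fun y' => (X (s, y'), y')) y
      ((hXy hs hy).prodMk (hasDerivAt_id' y))
    refine h.congr_deriv ?_
    rw [fderiv_prod_apply]
    have h1 := (hX _ (hmem hs hy)).1
    have h2 := hdet (X (s, y), y)
    simp only at h1 ⊢
    field_simp
    linarith
  have hBs : ∀ {s y : ℝ}, s ∈ Metric.ball s₀ r → y ∈ Metric.ball q.2 r →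
      HasDerivAt (fun s' => B (X (s', y), y))
        ((fderiv ℝ A (X (s, y), y) (1, 0))⁻¹ * fderiv ℝ A (X (s, y), y) (0, 1)) s := by
    intro s y hs hy
    have h := (hBd (X (s, y), y)).comp_hasDerivAt s ((hXs hs hy).prodMk (hasDerivAt_const s y))
    refine h.congr_deriv ?_
    rw [fderiv_prod_apply, hsym]
    simp
  have hq2 : q.2 ∈ Metric.ball q.2 r := Metric.mem_ball_self hr
  have hs₀r : s₀ ∈ Metric.ball s₀ r := Metric.mem_ball_self hr
  have hBconst : ∀ {s y : ℝ}, s ∈ Metric.ball s₀ r → y ∈ Metric.ball q.2 r →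
      B (X (s, y), y) = B (X (s, q.2), q.2) := by
    intro s y hs hy
    exact Metric.isOpen_ball.is_const_of_deriv_eq_zero (convex_ball q.2 r).isPreconnected
      (fun y' hy' => (hBy hs hy').differentiableAt.differentiableWithinAt)
      (fun y' hy' => (hBy hs hy').deriv) hy hq2
  have hslope : ∀ {s y : ℝ}, s ∈ Metric.ball s₀ r → y ∈ Metric.ball q.2 r →
      (fderiv ℝ A (X (s, y), y) (1, 0))⁻¹ * fderiv ℝ A (X (s, y), y) (0, 1) =
      (fderiv ℝ A (X (s, q.2), q.2) (1, 0))⁻¹ * fderiv ℝ A (X (s, q.2), q.2) (0, 1) := by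
    intro s y hs hy
    refine (hBs hs hy).unique ((hBs hs hq2).congr_of_eventuallyEq ?_)
    filter_upwards [Metric.isOpen_ball.mem_nhds hs] with s' hs'
    exact hBconst hs' hy
  have hline : ∀ {s y : ℝ}, s ∈ Metric.ball s₀ r → y ∈ Metric.ball q.2 r →
      X (s, y) = X (s, q.2) - (fderiv ℝ A (X (s, q.2), q.2) (1, 0))⁻¹ *
        fderiv ℝ A (X (s, q.2), q.2) (0, 1) * (y - q.2) := by
    intro s y hs hy
    set κ := (fderiv ℝ A (X (s, q.2), q.2) (1, 0))⁻¹ *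
        fderiv ℝ A (X (s, q.2), q.2) (0, 1) with hκ
    have hd : ∀ y' ∈ Metric.ball q.2 r,
        HasDerivAt (fun y' => X (s, y') + κ * (y' - q.2)) 0 y' := by
      intro y' hy'
      have h := (hXy hs hy').add (((hasDerivAt_id' y').sub_const q.2).const_mul κ)
      rw [hslope hs hy'] at h
      exact h.congr_deriv (by rw [hκ]; ring)
    have h := Metric.isOpen_ball.is_const_of_deriv_eq_zero (convex_ball q.2 r).isPreconnected
      (fun y' hy' => (hd y' hy').differentiableAt.differentiableWithinAt)
      (fun y' hy' => (hd y' hy').deriv) hy hq2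
    simp only [sub_self, mul_zero, add_zero] at h
    linarith
  have hXq' : X (s₀, q.2) = q.1 := hXq
  have hκ : (fderiv ℝ A q (1, 0))⁻¹ * fderiv ℝ A q (0, 1) = m := by
    rw [hm]; field_simp
  set y₁ := q.2 + r / 2 with hy₁
  have hy₁r : y₁ ∈ Metric.ball q.2 r := by
    rw [Metric.mem_ball, Real.dist_eq, hy₁, add_sub_cancel_left, abs_of_pos (by linarith)]
    linarith
  set c := (fderiv ℝ A (X (s₀, q.2), q.2) (1, 0))⁻¹
  set c₁ := (fderiv ℝ A (X (s₀, y₁), y₁) (1, 0))⁻¹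
  refine ⟨c, (c₁ - c) / (r / 2), ?_⟩
  filter_upwards [Metric.ball_mem_nhds (0 : ℝ) hr] with t ht
  have hy : q.2 + t ∈ Metric.ball q.2 r := by
    simpa [Real.dist_eq] using ht
  have hpt : X (s₀, q.2 + t) = q.1 - m * t := by
    rw [hline hs₀r hy, hXq', Prod.mk.eta, hκ]; ring
  have hne := (hX _ (hmem hs₀r hy)).1
  have hsl := hslope hs₀r hy
  have hXst := hXs hs₀r hy
  simp only [hpt] at hne hsl hXst
  rw [hXq', Prod.mk.eta, hκ] at hsl
  refine ⟨?_, ?_⟩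
  · have hd : HasDerivAt (fun s => X (s, q.2) + t / (r / 2) * (X (s, y₁) - X (s, q.2)))
        (c + t / (r / 2) * (c₁ - c)) s₀ :=
      (hXs hs₀r hq2).add (((hXs hs₀r hy₁r).sub (hXs hs₀r hq2)).const_mul _)
    have hu := hXst.unique (hd.congr_of_eventuallyEq (by
      filter_upwards [Metric.isOpen_ball.mem_nhds hs₀r] with s hs
      rw [hline hs hy, hline hs hy₁r, hy₁]
      field_simp
      ring))
    have : c + (c₁ - c) / (r / 2) * t = c + t / (r / 2) * (c₁ - c) := by ring
    rw [this, ← hu]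
    exact mul_inv_cancel₀ hne
  · exact ((inv_mul_eq_iff_eq_mul₀ hne).1 hsl).trans (mul_comm _ _)

/-- The level segments of `exists_local_ruling` extend to full lines. -/
theorem exists_ruling_of_fderiv_fst_ne_zero {A B : ℝ × ℝ → ℝ} (hA : ContDiff ℝ 1 A)
    (hB : ContDiff ℝ 1 B)
    (hsym : ∀ z, fderiv ℝ A z (0, 1) = fderiv ℝ B z (1, 0))
    (hdet : ∀ z, fderiv ℝ A z (1, 0) * fderiv ℝ B z (0, 1) =
      fderiv ℝ A z (0, 1) * fderiv ℝ B z (1, 0))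
    {p : ℝ × ℝ} (hp : fderiv ℝ A p (1, 0) ≠ 0) :
    ∃ m : ℝ, ∀ t : ℝ, fderiv ℝ A (p.1 - m * t, p.2 + t) (1, 0) ≠ 0 ∧
      fderiv ℝ A (p.1 - m * t, p.2 + t) (0, 1) =
        m * fderiv ℝ A (p.1 - m * t, p.2 + t) (1, 0) := by
  obtain ⟨m, hm⟩ : ∃ m, fderiv ℝ A p (0, 1) = m * fderiv ℝ A p (1, 0) :=
    ⟨fderiv ℝ A p (0, 1) / fderiv ℝ A p (1, 0), by field_simp⟩
  obtain ⟨c, d, hcd⟩ := exists_local_ruling hA hB hsym hdet hp hm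
  have hcont : ∀ v, Continuous fun t : ℝ => fderiv ℝ A (p.1 - m * t, p.2 + t) v := fun v =>
    ((hA.continuous_fderiv (by norm_num)).comp (by fun_prop)).clm_apply continuous_const
  set P : ℝ → Prop := fun t => fderiv ℝ A (p.1 - m * t, p.2 + t) (1, 0) * (c + d * t) = 1 ∧
      fderiv ℝ A (p.1 - m * t, p.2 + t) (0, 1) =
        m * fderiv ℝ A (p.1 - m * t, p.2 + t) (1, 0)
  have hPclosed : IsClosed {t | P t} :=
    (isClosed_eq ((hcont _).mul (by fun_prop)) continuous_const).inter
      (isClosed_eq (hcont _) (continuous_const.mul (hcont _)))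
  have hclopen : IsClopen (interior {t | P t}) := by
    refine ⟨?_, isOpen_interior⟩
    rw [← closure_subset_iff_isClosed]
    intro t₀ ht₀
    have hPt₀ : P t₀ := closure_minimal interior_subset hPclosed ht₀
    obtain ⟨c', d', hcd'⟩ := exists_local_ruling hA hB hsym hdet
      (q := (p.1 - m * t₀, p.2 + t₀)) (left_ne_zero_of_mul_eq_one hPt₀.1) hPt₀.2
    have hev : ∀ᶠ t in 𝓝 t₀,
        fderiv ℝ A (p.1 - m * t, p.2 + t) (1, 0) * (c' + d' * (t - t₀)) = 1 ∧
        fderiv ℝ A (p.1 - m * t, p.2 + t) (0, 1) =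
          m * fderiv ℝ A (p.1 - m * t, p.2 + t) (1, 0) := by
      have ht : Tendsto (fun t => t - t₀) (𝓝 t₀) (𝓝 0) := by
        have h : Continuous fun t : ℝ => t - t₀ := by fun_prop
        simpa using h.tendsto t₀
      filter_upwards [ht.eventually hcd'] with t h
      have e1 : p.1 - m * t₀ - m * (t - t₀) = p.1 - m * t := by ring
      have e2 : p.2 + t₀ + (t - t₀) = p.2 + t := by ring
      simpa only [e1, e2] using h
    obtain ⟨U, hU, hUo, ht₀U⟩ := eventually_nhds_iff.1 hev
    obtain ⟨t₁, ht₁U, ht₁⟩ := mem_closure_iff.1 ht₀ U hUo ht₀U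
    have hW : U ∩ interior {t | P t} ∈ 𝓝 t₁ :=
      (hUo.inter isOpen_interior).mem_nhds ⟨ht₁U, ht₁⟩
    have haff : ∀ t ∈ U ∩ interior {t | P t}, c + d * t = c' + d' * (t - t₀) := by
      rintro t ⟨htU, htP⟩
      have h1 : P t := interior_subset (s := {t | P t}) htP
      exact mul_left_cancel₀ (left_ne_zero_of_mul_eq_one h1.1) (h1.1.trans (hU t htU).1.symm)
    obtain ⟨ε, hε, hεW⟩ := Metric.mem_nhds_iff.1 hW
    have h1 := haff t₁ (hεW (Metric.mem_ball_self hε))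
    have h2 := haff (t₁ + ε / 2) (hεW (by
      rw [Metric.mem_ball, Real.dist_eq, add_sub_cancel_left, abs_of_pos (by linarith)]
      linarith))
    have hdd : d = d' := by
      have : (d - d') * (ε / 2) = 0 := by linarith
      rcases mul_eq_zero.1 this with h | h <;> linarith
    subst hdd
    refine mem_interior_iff_mem_nhds.2 ?_
    filter_upwards [hev] with t ht
    have hct : c + d * t = c' + d * (t - t₀) := by linarith
    exact ⟨hct ▸ ht.1, ht.2⟩
  have huniv := hclopen.eq_univ ⟨0, mem_interior_iff_mem_nhds.2 hcd⟩
  refine ⟨m, fun t => ?_⟩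
  have ht : P t := interior_subset (s := {t | P t}) (huniv ▸ Set.mem_univ t)
  exact ⟨left_ne_zero_of_mul_eq_one ht.1, ht.2⟩

theorem fderiv_comp_swap {A : ℝ × ℝ → ℝ} (hA : ContDiff ℝ 1 A) (z v : ℝ × ℝ) :
    fderiv ℝ (fun w => A w.swap) z v = fderiv ℝ A z.swap v.swap := by
  have h1 : HasFDerivAt (fun w : ℝ × ℝ => w.swap)
      ((ContinuousLinearMap.snd ℝ ℝ ℝ).prod (ContinuousLinearMap.fst ℝ ℝ ℝ)) z :=
    hasFDerivAt_snd.prodMk hasFDerivAt_fst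
  have h2 : HasFDerivAt (fun w => A w.swap) _ z :=
    (hA.differentiable (by norm_num) z.swap).hasFDerivAt.comp z h1
  rw [h2.fderiv]
  rfl

/-- Through every point where the Jacobian of `(A, B)` does not vanish passes a full line along
which the Jacobian does not vanish and annihilates the direction of the line. -/
theorem exists_ruling {A B : ℝ × ℝ → ℝ} (hA : ContDiff ℝ 1 A) (hB : ContDiff ℝ 1 B)
    (hsym : ∀ z, fderiv ℝ A z (0, 1) = fderiv ℝ B z (1, 0))
    (hdet : ∀ z, fderiv ℝ A z (1, 0) * fderiv ℝ B z (0, 1) =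
      fderiv ℝ A z (0, 1) * fderiv ℝ B z (1, 0))
    {p : ℝ × ℝ} (hp : fderiv ℝ A p (1, 0) ≠ 0 ∨ fderiv ℝ B p (0, 1) ≠ 0) :
    ∃ k : ℝ × ℝ, k ≠ 0 ∧ ∀ t : ℝ,
      (fderiv ℝ A (p + t • k) (1, 0) ≠ 0 ∨ fderiv ℝ B (p + t • k) (0, 1) ≠ 0) ∧
      fderiv ℝ A (p + t • k) k = 0 ∧ fderiv ℝ B (p + t • k) k = 0 := by
  rcases hp with hp | hp
  · obtain ⟨m, hm⟩ := exists_ruling_of_fderiv_fst_ne_zero hA hB hsym hdet hp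
    refine ⟨(-m, 1), by simp [Prod.ext_iff], fun t => ?_⟩
    have hz : p + t • ((-m, 1) : ℝ × ℝ) = (p.1 - m * t, p.2 + t) := by
      ext <;> simp; ring
    rw [hz, fderiv_prod_apply _ (-m, 1), fderiv_prod_apply (A := B) _ (-m, 1)]
    obtain ⟨h1, h2⟩ := hm t
    refine ⟨Or.inl h1, by rw [h2]; ring, mul_left_cancel₀ h1 ?_⟩
    linear_combination hdet (p.1 - m * t, p.2 + t) +
      fderiv ℝ B (p.1 - m * t, p.2 + t) (1, 0) * h2
  · have hsw : ContDiff ℝ 1 (Prod.swap : ℝ × ℝ → ℝ × ℝ) := contDiff_snd.prodMk contDiff_fst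
    obtain ⟨m, hm⟩ := exists_ruling_of_fderiv_fst_ne_zero (hB.comp hsw) (hA.comp hsw)
      (fun z => by
        simpa only [Function.comp_def, fderiv_comp_swap hA, fderiv_comp_swap hB, Prod.swap_prod_mk]
          using (hsym z.swap).symm)
      (fun z => by
        have := hdet z.swap
        simp only [Function.comp_def, fderiv_comp_swap hA, fderiv_comp_swap hB, Prod.swap_prod_mk]
        linarith)
      (p := p.swap) (by
        simpa only [Function.comp_def, fderiv_comp_swap hB, Prod.swap_prod_mk, Prod.swap_swap]
          using hp)
    refine ⟨(1, -m), by simp [Prod.ext_iff], fun t => ?_⟩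
    have hz : p + t • ((1, -m) : ℝ × ℝ) = (p.1 + t, p.2 - m * t) := by
      ext <;> simp; ring
    rw [hz, fderiv_prod_apply _ (1, -m), fderiv_prod_apply (A := B) _ (1, -m)]
    obtain ⟨h1, h2⟩ := hm t
    simp only [Function.comp_def, fderiv_comp_swap hB, Prod.swap_prod_mk, Prod.fst_swap,
      Prod.snd_swap] at h1 h2
    have h3 := hsym (p.1 + t, p.2 - m * t)
    refine ⟨Or.inr h1, mul_left_cancel₀ h1 ?_, by rw [h2]; ring⟩
    linear_combination hdet (p.1 + t, p.2 - m * t) +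
      fderiv ℝ A (p.1 + t, p.2 - m * t) (0, 1) * h2

/-- The Jacobian of a closed field with singular Jacobian has a constant kernel direction. -/
theorem exists_common_kernel {A B : ℝ × ℝ → ℝ} (hA : ContDiff ℝ 1 A) (hB : ContDiff ℝ 1 B)
    (hsym : ∀ z, fderiv ℝ A z (0, 1) = fderiv ℝ B z (1, 0))
    (hdet : ∀ z, fderiv ℝ A z (1, 0) * fderiv ℝ B z (0, 1) =
      fderiv ℝ A z (0, 1) * fderiv ℝ B z (1, 0)) :
    ∃ k : ℝ × ℝ, k ≠ 0 ∧ ∀ z, fderiv ℝ A z k = 0 ∧ fderiv ℝ B z k = 0 := by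
  have hzero : ∀ q, ¬ (fderiv ℝ A q (1, 0) ≠ 0 ∨ fderiv ℝ B q (0, 1) ≠ 0) →
      ∀ k, fderiv ℝ A q k = 0 ∧ fderiv ℝ B q k = 0 := by
    intro q hq k
    push Not at hq
    have h1 : fderiv ℝ A q (0, 1) = 0 := by
      have := hdet q
      rw [← hsym, hq.1, zero_mul] at this
      exact mul_self_eq_zero.1 this.symm
    rw [fderiv_prod_apply q k, fderiv_prod_apply (A := B) q k, ← hsym, hq.1, hq.2, h1]
    simp
  by_cases hp : ∃ p, fderiv ℝ A p (1, 0) ≠ 0 ∨ fderiv ℝ B p (0, 1) ≠ 0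
  swap
  · exact ⟨(1, 0), by simp [Prod.ext_iff], fun z => hzero z (fun h => hp ⟨z, h⟩) _⟩
  obtain ⟨p, hp⟩ := hp
  obtain ⟨k, hk, hkp⟩ := exists_ruling hA hB hsym hdet hp
  refine ⟨k, hk, fun q => ?_⟩
  by_cases hq : fderiv ℝ A q (1, 0) ≠ 0 ∨ fderiv ℝ B q (0, 1) ≠ 0
  swap
  · exact hzero q hq k
  obtain ⟨l, hl, hlq⟩ := exists_ruling hA hB hsym hdet hq
  have hpar : k.1 * l.2 - k.2 * l.1 = 0 := by
    by_contra hD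
    set t := ((q.1 - p.1) * l.2 - (q.2 - p.2) * l.1) / (k.1 * l.2 - k.2 * l.1) with ht
    set u := ((q.1 - p.1) * k.2 - (q.2 - p.2) * k.1) / (k.1 * l.2 - k.2 * l.1) with hu
    have hr : q + u • l = p + t • k := by
      ext
      · simp only [Prod.fst_add, Prod.smul_fst, smul_eq_mul, ht, hu]
        field_simp
        ring
      · simp only [Prod.snd_add, Prod.smul_snd, smul_eq_mul, ht, hu]
        field_simp
        ring
    obtain ⟨hne, hAk, hBk⟩ := hkp t
    obtain ⟨-, hAl, hBl⟩ := hlq u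
    rw [hr, fderiv_prod_apply] at hAl hBl
    rw [fderiv_prod_apply] at hAk hBk
    rcases hne with h | h
    · refine h (mul_left_cancel₀ hD ?_)
      linear_combination l.2 * hAk - k.2 * hAl
    · refine h (mul_left_cancel₀ hD ?_)
      linear_combination k.1 * hBl - l.1 * hBk
  have h0 := (hlq 0).2
  rw [zero_smul, add_zero, fderiv_prod_apply, fderiv_prod_apply (A := B)] at h0
  rw [fderiv_prod_apply q k, fderiv_prod_apply (A := B) q k]
  by_cases hl1 : l.1 = 0
  · have hl2 : l.2 ≠ 0 := fun h => hl (Prod.ext hl1 h)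
    refine ⟨mul_left_cancel₀ hl2 ?_, mul_left_cancel₀ hl2 ?_⟩
    · linear_combination k.2 * h0.1 + fderiv ℝ A q (1, 0) * hpar
    · linear_combination k.2 * h0.2 + fderiv ℝ B q (1, 0) * hpar
  · refine ⟨mul_left_cancel₀ hl1 ?_, mul_left_cancel₀ hl1 ?_⟩
    · linear_combination k.1 * h0.1 - fderiv ℝ A q (0, 1) * hpar
    · linear_combination k.1 * h0.2 - fderiv ℝ B q (0, 1) * hpar

/-- A function whose derivative annihilates `k` is constant along the direction `k`. -/
theorem apply_add_smul_of_fderiv_eq_zero {A : ℝ × ℝ → ℝ} (hA : ContDiff ℝ 1 A) {k : ℝ × ℝ}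
    (hk : ∀ z, fderiv ℝ A z k = 0) (z : ℝ × ℝ) (t : ℝ) : A (z + t • k) = A z := by
  have hd : ∀ t : ℝ, HasDerivAt (fun t : ℝ => A (z + t • k)) 0 t := by
    intro t
    have h1 : HasDerivAt (fun t : ℝ => z + t • k) k t := by
      simpa using ((hasDerivAt_id' t).smul_const k).const_add z
    have h2 := (hA.differentiable (by norm_num) (z + t • k)).hasFDerivAt.comp_hasDerivAt t h1
    exact h2.congr_deriv (hk _)
  simpa using is_const_of_deriv_eq_zero (fun t => (hd t).differentiableAt)
    (fun t => (hd t).deriv) t 0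

/-- The gradient of a developable function is a function of a single linear coordinate. -/
theorem exists_normal_form {A B : ℝ × ℝ → ℝ} (hA : ContDiff ℝ 1 A) (hB : ContDiff ℝ 1 B)
    (hsym : ∀ z, fderiv ℝ A z (0, 1) = fderiv ℝ B z (1, 0))
    (hdet : ∀ z, fderiv ℝ A z (1, 0) * fderiv ℝ B z (0, 1) =
      fderiv ℝ A z (0, 1) * fderiv ℝ B z (1, 0))
    (hA0 : A 0 = 0) (hB0 : B 0 = 0) :
    ∃ (ψ : ℝ → ℝ) (α β : ℝ), ContDiff ℝ 1 ψ ∧ ψ 0 = 0 ∧ α ^ 2 + β ^ 2 = 1 ∧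
      ∀ x y : ℝ, A (x, y) = α * ψ (α * x + β * y) ∧ B (x, y) = β * ψ (α * x + β * y) := by
  obtain ⟨k, hk, hker⟩ := exists_common_kernel hA hB hsym hdet
  have hpos : 0 < k.1 ^ 2 + k.2 ^ 2 := by
    by_contra h
    refine hk (Prod.ext ?_ ?_) <;> simp only [Prod.fst_zero, Prod.snd_zero] <;>
      nlinarith [sq_nonneg k.1, sq_nonneg k.2]
  set N := √(k.1 ^ 2 + k.2 ^ 2)
  have hN0 : N ≠ 0 := (Real.sqrt_pos.2 hpos).ne'
  have hN2 : N ^ 2 = k.1 ^ 2 + k.2 ^ 2 := Real.sq_sqrt hpos.le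
  obtain ⟨α, β, hαβ, hAk, hBk⟩ : ∃ α β : ℝ, α ^ 2 + β ^ 2 = 1 ∧
      (∀ z, fderiv ℝ A z (β, -α) = 0) ∧ ∀ z, fderiv ℝ B z (β, -α) = 0 := by
    have hv : ((k.1 / N, -(-k.2 / N)) : ℝ × ℝ) = N⁻¹ • k := by
      ext <;> simp <;> ring
    refine ⟨-k.2 / N, k.1 / N, ?_, fun z => ?_, fun z => ?_⟩
    · field_simp
      linarith
    · rw [hv, map_smul, (hker z).1, smul_zero]
    · rw [hv, map_smul, (hker z).2, smul_zero]
  have hline : ∀ x y : ℝ, ((x, y) : ℝ × ℝ) = ((α * x + β * y) * α, (α * x + β * y) * β) +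
      (β * x - α * y) • ((β, -α) : ℝ × ℝ) := by
    intro x y
    ext
    · simp only [Prod.fst_add, Prod.smul_fst, smul_eq_mul]
      linear_combination -x * hαβ
    · simp only [Prod.snd_add, Prod.smul_snd, smul_eq_mul]
      linear_combination -y * hαβ
  have hAB : ∀ z, β * A z = α * B z := by
    have hd : ∀ z, HasFDerivAt (fun z => β * A z - α * B z)
        (β • fderiv ℝ A z - α • fderiv ℝ B z) z := fun z =>
      ((hA.differentiable (by norm_num) z).hasFDerivAt.const_mul β).sub
        ((hB.differentiable (by norm_num) z).hasFDerivAt.const_mul α)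
    have hd0 : ∀ z, fderiv ℝ (fun z => β * A z - α * B z) z = 0 := by
      intro z
      have h1 := hAk z
      have h2 := hBk z
      rw [fderiv_prod_apply] at h1 h2
      rw [(hd z).fderiv]
      ext
      · simp only [ContinuousLinearMap.comp_apply, ContinuousLinearMap.inl_apply,
          sub_apply, smul_apply, smul_eq_mul,
          zero_apply]
        linear_combination h1 + α * hsym z
      · simp only [ContinuousLinearMap.comp_apply, ContinuousLinearMap.inr_apply,
          sub_apply, smul_apply, smul_eq_mul,
          zero_apply]
        linear_combination h2 + β * hsym z
    intro z
    have h := is_const_of_fderiv_eq_zero (fun z => (hd z).differentiableAt) hd0 z 0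
    simp only [hA0, hB0, mul_zero, sub_zero] at h
    linarith
  refine ⟨fun s => α * A (s * α, s * β) + β * B (s * α, s * β), α, β, by fun_prop, ?_, hαβ,
    fun x y => ?_⟩
  · have h0 : ((0 * α, 0 * β) : ℝ × ℝ) = 0 := by ext <;> simp
    simp only [h0, hA0, hB0, mul_zero, add_zero]
  · have h1 := apply_add_smul_of_fderiv_eq_zero hA hAk
      ((α * x + β * y) * α, (α * x + β * y) * β) (β * x - α * y)
    have h2 := apply_add_smul_of_fderiv_eq_zero hB hBk
      ((α * x + β * y) * α, (α * x + β * y) * β) (β * x - α * y)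
    rw [← hline] at h1 h2
    simp only [← h1, ← h2]
    constructor
    · linear_combination -A (x, y) * hαβ + β * hAB (x, y)
    · linear_combination -B (x, y) * hαβ - α * hAB (x, y)

/-- The derivative of a map in normal form. -/
theorem fderiv_normal_form {G : ℝ × ℝ → ℝ × ℝ} {ψ : ℝ → ℝ} {α β : ℝ}
    (hψ : ContDiff ℝ 1 ψ)
    (hG : ∀ x y : ℝ,
      G (x, y) = (x + β * ψ (α * x + β * y), y - α * ψ (α * x + β * y))) (z v : ℝ × ℝ) :
    fderiv ℝ G z v = (v.1 + β * (deriv ψ (α * z.1 + β * z.2) * (α * v.1 + β * v.2)),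
      v.2 - α * (deriv ψ (α * z.1 + β * z.2) * (α * v.1 + β * v.2))) := by
  have hG' : G = fun z : ℝ × ℝ =>
      (z.1 + β * ψ (α * z.1 + β * z.2), z.2 - α * ψ (α * z.1 + β * z.2)) :=
    funext fun z => hG z.1 z.2
  have hl : HasFDerivAt (fun z : ℝ × ℝ => α * z.1 + β * z.2)
      (α • ContinuousLinearMap.fst ℝ ℝ ℝ + β • ContinuousLinearMap.snd ℝ ℝ ℝ) z :=
    (hasFDerivAt_fst.const_mul α).add (hasFDerivAt_snd.const_mul β)
  have hp := (hψ.differentiable (by norm_num) (α * z.1 + β * z.2)).hasDerivAt.comp_hasFDerivAt z hl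
  have h := (hasFDerivAt_fst.add (hp.const_mul β)).prodMk (hasFDerivAt_snd.sub (hp.const_mul α))
  rw [hG']
  refine (congrArg (fun L : (ℝ × ℝ) →L[ℝ] ℝ × ℝ => L v) (HasFDerivAt.fderiv h)).trans ?_
  ext <;> simp <;> ring

/-- normal form of nonlinear unipotent maps fixing the origin,
with a unitary vector `(β, -α)`. -/
theorem statement3 (G : ℝ × ℝ → ℝ × ℝ) (hG : ContDiff ℝ 1 G) :
    (Unipotent G ∧ NonlinearMap G ∧ G (0, 0) = (0, 0)) ↔
      ∃ (ψ : ℝ → ℝ) (α β : ℝ), ContDiff ℝ 1 ψ ∧ NonlinearFun ψ ∧ ψ 0 = 0 ∧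
        α ^ 2 + β ^ 2 = 1 ∧
        ∀ x y : ℝ,
          G (x, y) = (x + β * ψ (α * x + β * y), y - α * ψ (α * x + β * y)) := by
  constructor
  · rintro ⟨hU, hN, h0⟩
    have hDG : ∀ z, HasFDerivAt G (fderiv ℝ G z) z := fun z =>
      (hG.differentiable (by norm_num) z).hasFDerivAt
    have hdA : ∀ z v, fderiv ℝ (fun z => z.2 - (G z).2) z v = v.2 - (fderiv ℝ G z v).2 := by
      intro z v
      have h : HasFDerivAt (fun z => z.2 - (G z).2) _ z := hasFDerivAt_snd.sub (hDG z).snd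
      rw [h.fderiv]
      rfl
    have hdB : ∀ z v, fderiv ℝ (fun z => (G z).1 - z.1) z v = (fderiv ℝ G z v).1 - v.1 := by
      intro z v
      have h : HasFDerivAt (fun z => (G z).1 - z.1) _ z := (hDG z).fst.sub hasFDerivAt_fst
      rw [h.fderiv]
      rfl
    obtain ⟨ψ, α, β, hψ, hψ0, hαβ, hform⟩ := exists_normal_form
      (contDiff_snd.sub hG.snd) (hG.fst.sub contDiff_fst)
      (fun z => by
        rw [hdA, hdB]
        linear_combination -(hU z).1)
      (fun z => by
        rw [hdA, hdA, hdB, hdB]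
        linear_combination (hU z).2 - (hU z).1)
      (by simp [show G 0 = 0 from h0]) (by simp [show G 0 = 0 from h0])
    have hGform : ∀ x y : ℝ,
        G (x, y) = (x + β * ψ (α * x + β * y), y - α * ψ (α * x + β * y)) := by
      intro x y
      obtain ⟨h1, h2⟩ := hform x y
      ext
      · simp only at h2 ⊢
        linarith
      · simp only at h1 ⊢
        linarith
    refine ⟨ψ, α, β, hψ, ?_, hψ0, hαβ, hGform⟩
    rintro ⟨k, hk⟩
    have hdψ : ∀ s, deriv ψ s = k := by
      intro s
      rw [show ψ = fun t => k * t from funext hk]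
      simp
    refine hN ⟨fderiv ℝ G 0, fun z => ContinuousLinearMap.ext fun v => ?_⟩
    rw [fderiv_normal_form hψ hGform, fderiv_normal_form hψ hGform, hdψ, hdψ]
  · rintro ⟨ψ, α, β, hψ, hN, hψ0, hαβ, hform⟩
    have hd := fderiv_normal_form hψ hform
    refine ⟨fun z => ?_, ?_, by simp [hform, hψ0]⟩
    · rw [hd, hd]
      constructor <;> ring
    · rintro ⟨L, hL⟩
      have hdψ : ∀ s, deriv ψ s = (L (0, 1)).1 - (L (1, 0)).2 := by
        intro s
        have hs : α * (s * α) + β * (s * β) = s := by linear_combination s * hαβ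
        rw [← hL (s * α, s * β), hd, hd, hs]
        linear_combination -deriv ψ s * hαβ
      refine hN ⟨(L (0, 1)).1 - (L (1, 0)).2, fun t => ?_⟩
      set k := (L (0, 1)).1 - (L (1, 0)).2
      have hdiff : ∀ s, HasDerivAt (fun s => ψ s - k * s) 0 s := fun s =>
        ((hψ.differentiable (by norm_num) s).hasDerivAt.sub
          ((hasDerivAt_id' s).const_mul k)).congr_deriv (by rw [hdψ]; ring)
      have h := is_const_of_deriv_eq_zero (fun s => (hdiff s).differentiableAt)
        (fun s => (hdiff s).deriv) t 0
      simp only [hψ0, mul_zero, sub_zero] at h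
      linarith
end

section
/- Let G : ℝ² → ℝ² be a continuously differentiable map. Then the following are equivalent: (1) G is unipotent, G is nonlinear, and G(0,0) = (0,0); (2) there exist θ ∈ ℝ and a nonlinear continuously differentiable function ψ : ℝ → ℝ with ψ(0) = 0 such that (R_θ ∘ G ∘ R_{−θ})(x,y) = (x + ψ(y), y) for all (x,y) ∈ ℝ². -/
open Filter Topology

/-- The partial derivative of a function on the plane in the first variable. -/
noncomputable def partialFst (f : ℝ × ℝ → ℝ) (z : ℝ × ℝ) : ℝ := fderiv ℝ f z (1, 0)

/-- The partial derivative of a function on the plane in the second variable. -/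
noncomputable def partialSnd (f : ℝ × ℝ → ℝ) (z : ℝ × ℝ) : ℝ := fderiv ℝ f z (0, 1)

theorem fderiv_apply_eq_partial (f : ℝ × ℝ → ℝ) (z a : ℝ × ℝ) :
    fderiv ℝ f z a = a.1 * partialFst f z + a.2 * partialSnd f z := by
  have h : a = a.1 • ((1 : ℝ), (0 : ℝ)) + a.2 • ((0 : ℝ), (1 : ℝ)) := by
    ext <;> simp
  conv_lhs => rw [h]
  rw [map_add, map_smul, map_smul]
  rfl

theorem continuous_partialFst {f : ℝ × ℝ → ℝ} (hf : ContDiff ℝ 1 f) :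
    Continuous (partialFst f) :=
  (hf.continuous_fderiv one_ne_zero).clm_apply continuous_const

theorem hasDerivAt_comp_partial {f : ℝ × ℝ → ℝ} (hf : ContDiff ℝ 1 f) {γ : ℝ → ℝ × ℝ}
    {a : ℝ × ℝ} {t : ℝ} (hγ : HasDerivAt γ a t) :
    HasDerivAt (fun s => f (γ s)) (a.1 * partialFst f (γ t) + a.2 * partialSnd f (γ t)) t := by
  have h := ((hf.differentiable one_ne_zero) (γ t)).hasFDerivAt.comp_hasDerivAt t hγ
  rwa [fderiv_apply_eq_partial] at h

theorem hasDerivAt_fst {γ : ℝ → ℝ × ℝ} {a : ℝ × ℝ} {t : ℝ} (h : HasDerivAt γ a t) :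
    HasDerivAt (fun s => (γ s).1) a.1 t :=
  (hasFDerivAt_fst (𝕜 := ℝ) (p := γ t)).comp_hasDerivAt t h

theorem eq_add_mul_of_hasDerivAt_ball {f : ℝ → ℝ} {K y₀ δ : ℝ}
    (hf : ∀ y ∈ Metric.ball y₀ δ, HasDerivAt f K y) {y : ℝ} (hy : y ∈ Metric.ball y₀ δ) :
    f y = f y₀ + K * (y - y₀) := by
  have hy₀ : y₀ ∈ Metric.ball y₀ δ := Metric.mem_ball_self (Metric.pos_of_mem_ball hy)
  have hd : ∀ x ∈ Metric.ball y₀ δ, HasDerivAt (fun x => f x - K * x) 0 x := fun x hx => by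
    have := (hf x hx).fun_sub ((hasDerivAt_id x).const_mul K)
    simpa using this
  have := Metric.isOpen_ball.is_const_of_deriv_eq_zero
    (convex_ball y₀ δ).isPreconnected
    (fun x hx => (hd x hx).differentiableAt.differentiableWithinAt)
    (fun x hx => (hd x hx).deriv) hy hy₀
  linarith

/-- Where `∂₁v ≠ 0`, the pair `(v, y)` is a local coordinate system on the plane. -/
theorem exists_local_coordinates {v : ℝ × ℝ → ℝ} (hv : ContDiff ℝ 1 v) {p : ℝ × ℝ}
    (hp : partialFst v p ≠ 0) :
    ∃ (g : ℝ × ℝ → ℝ × ℝ) (δ : ℝ), 0 < δ ∧ g (v p, p.2) = p ∧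
      ∀ w ∈ Metric.ball (v p, p.2) δ, partialFst v (g w) ≠ 0 ∧ (g w).2 = w.2 ∧
        HasFDerivAt g (fderiv ℝ g w) w ∧
        fderiv ℝ g w (1, 0) = (1 / partialFst v (g w), 0) ∧
        fderiv ℝ g w (0, 1) = (-partialSnd v (g w) / partialFst v (g w), 1) := by
  set Φ : ℝ × ℝ → ℝ × ℝ := fun z => (v z, z.2)
  have hΦc : ContDiff ℝ 1 Φ := hv.prodMk contDiff_snd
  have hvd := hv.differentiable one_ne_zero
  have hΦd (z : ℝ × ℝ) :
      HasFDerivAt Φ ((fderiv ℝ v z).prod (ContinuousLinearMap.snd ℝ ℝ ℝ)) z :=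
    (hvd z).hasFDerivAt.prodMk hasFDerivAt_snd
  set L : (ℝ × ℝ) →L[ℝ] ℝ × ℝ := (fderiv ℝ v p).prod (ContinuousLinearMap.snd ℝ ℝ ℝ) with hL
  have hLinj : Function.Injective L.toLinearMap := by
    rw [injective_iff_map_eq_zero]
    rintro ⟨a, b⟩ h
    have h' : L (a, b) = 0 := h
    simp only [hL, ContinuousLinearMap.prod_apply, fderiv_apply_eq_partial,
      ContinuousLinearMap.coe_snd', Prod.mk_eq_zero] at h'
    obtain ⟨h1, rfl⟩ := h'
    have : a = 0 := by simpa [hp] using h1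
    simp [this]
  set e : (ℝ × ℝ) ≃L[ℝ] ℝ × ℝ :=
    (LinearEquiv.ofInjectiveEndo L.toLinearMap hLinj).toContinuousLinearEquiv
  have hed : HasFDerivAt Φ (e : (ℝ × ℝ) →L[ℝ] ℝ × ℝ) p := by
    have : (e : (ℝ × ℝ) →L[ℝ] ℝ × ℝ) = L := by ext <;> rfl
    rw [this]; exact hΦd p
  have hs := hΦc.contDiffAt.hasStrictFDerivAt' hed one_ne_zero
  set g := hs.localInverse Φ e p
  have hgp : g (v p, p.2) = p := hs.localInverse_apply_image
  have hgc : ContDiffAt ℝ 1 g (v p, p.2) :=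
    (hΦc.contDiffAt (x := p)).to_localInverse hed one_ne_zero
  have hgd : ∀ᶠ w in 𝓝 (v p, p.2), ContDiffAt ℝ 1 g w := hgc.eventually (by simp)
  have hinv : ∀ᶠ w in 𝓝 (v p, p.2), Φ (g w) = w := hs.eventually_right_inverse
  have hne : ∀ᶠ w in 𝓝 (v p, p.2), partialFst v (g w) ≠ 0 := by
    have : ContinuousAt (fun w => partialFst v (g w)) (v p, p.2) :=
      (continuous_partialFst hv).continuousAt.comp hgc.continuousAt
    refine this.eventually_ne ?_
    rwa [hgp]
  obtain ⟨δ, hδ, hball⟩ := Metric.eventually_nhds_iff_ball.1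
    (hgd.and (hinv.eventually_nhds.and hne))
  refine ⟨g, δ, hδ, hgp, fun w hw => ?_⟩
  obtain ⟨h1, h2, h3⟩ := hball w hw
  have hgw : HasFDerivAt g (fderiv ℝ g w) w :=
    (h1.differentiableAt one_ne_zero).hasFDerivAt
  have hid := ((hΦd (g w)).comp w hgw).congr_of_eventuallyEq
    (f₁ := id) (h2.mono fun x hx => hx.symm)
  have hcomp := hid.unique (hasFDerivAt_id w)
  have happ (a : ℝ × ℝ) := DFunLike.congr_fun hcomp a
  simp only [ContinuousLinearMap.comp_apply, ContinuousLinearMap.prod_apply,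
    fderiv_apply_eq_partial, ContinuousLinearMap.coe_snd', ContinuousLinearMap.id_apply] at happ
  refine ⟨h3, (Prod.ext_iff.1 h2.self_of_nhds).2, hgw, ?_, ?_⟩
  · have h := happ (1, 0)
    rw [Prod.mk.injEq] at h
    ext
    · have := h.1
      rw [h.2] at this
      rw [eq_div_iff h3]; linarith
    · exact h.2
  · have h := happ (0, 1)
    rw [Prod.mk.injEq] at h
    ext
    · have := h.1
      rw [h.2] at this
      rw [eq_div_iff h3]; linarith
    · exact h.2

/-- If `(u, v)` is `C¹` with nilpotent Jacobian and `∂₁v p ≠ 0`, then along a short segment through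
`p` in the kernel direction the kernel direction is unchanged, and `1 / ∂₁v` is affine. -/
theorem exists_affine_near {u v : ℝ × ℝ → ℝ} (hu : ContDiff ℝ 1 u) (hv : ContDiff ℝ 1 v)
    (htr : ∀ z, partialFst u z + partialSnd v z = 0)
    (hdet : ∀ z, partialFst u z * partialSnd v z = partialSnd u z * partialFst v z)
    {p : ℝ × ℝ} {k : ℝ} (hp : partialFst v p ≠ 0) (hk : partialFst u p = k * partialFst v p) :
    ∃ b : ℝ, ∀ᶠ s in 𝓝 (0 : ℝ),
      partialFst v (p.1 + s * k, p.2 + s) * (1 / partialFst v p + b * s) = 1 ∧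
      partialFst u (p.1 + s * k, p.2 + s) = k * partialFst v (p.1 + s * k, p.2 + s) := by
  obtain ⟨g, δ, hδ, hgp, hg⟩ := exists_local_coordinates hv hp
  set c₀ := v p
  set y₀ := p.2
  have hmem {c y : ℝ} (hc : c ∈ Metric.ball c₀ δ) (hy : y ∈ Metric.ball y₀ δ) :
      (c, y) ∈ Metric.ball (c₀, y₀) δ := by
    rw [← ball_prod_same]; exact ⟨hc, hy⟩
  have hc₀m : c₀ ∈ Metric.ball c₀ δ := Metric.mem_ball_self hδ
  have hy₀m : y₀ ∈ Metric.ball y₀ δ := Metric.mem_ball_self hδ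
  set K : ℝ × ℝ → ℝ := fun w => partialFst u (g w) / partialFst v (g w) with hK
  have hgfst {c y : ℝ} (hc : c ∈ Metric.ball c₀ δ) (hy : y ∈ Metric.ball y₀ δ) :
      HasDerivAt (fun c => g (c, y)) (1 / partialFst v (g (c, y)), 0) c := by
    obtain ⟨-, -, hd, h1, -⟩ := hg _ (hmem hc hy)
    rw [← h1]
    exact hd.comp_hasDerivAt c ((hasDerivAt_id c).prodMk (hasDerivAt_const c y))
  have hgsnd {c y : ℝ} (hc : c ∈ Metric.ball c₀ δ) (hy : y ∈ Metric.ball y₀ δ) :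
      HasDerivAt (fun y => g (c, y)) (K (c, y), 1) y := by
    obtain ⟨-, -, hd, -, h1⟩ := hg _ (hmem hc hy)
    have : K (c, y) = -partialSnd v (g (c, y)) / partialFst v (g (c, y)) := by
      rw [hK]; simp only; congr 1; linarith [htr (g (c, y))]
    rw [this, ← h1]
    exact hd.comp_hasDerivAt y ((hasDerivAt_const y c).prodMk (hasDerivAt_id y))
  have hU {c y : ℝ} (hc : c ∈ Metric.ball c₀ δ) (hy : y ∈ Metric.ball y₀ δ) :
      u (g (c, y)) = u (g (c, y₀)) := by
    have := eq_add_mul_of_hasDerivAt_ball (f := fun y => u (g (c, y))) (K := 0)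
      (fun y hy => by
        have h := hasDerivAt_comp_partial hu (hgsnd hc hy)
        convert h using 1
        have hne := (hg _ (hmem hc hy)).1
        simp only [hK]
        field_simp
        have h1 := htr (g (c, y))
        have h2 := hdet (g (c, y))
        rw [show partialSnd v (g (c, y)) = -partialFst u (g (c, y)) by linarith] at h2
        linarith) hy
    simpa using this
  have hKc {c y : ℝ} (hc : c ∈ Metric.ball c₀ δ) (hy : y ∈ Metric.ball y₀ δ) :
      K (c, y) = K (c, y₀) := by
    have h1 := hasDerivAt_comp_partial hu (hgfst hc hy)
    have h2 := hasDerivAt_comp_partial hu (hgfst hc hy₀m)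
    have h3 := h1.congr_of_eventuallyEq (f₁ := fun c => u (g (c, y₀)))
      (by filter_upwards [Metric.isOpen_ball.mem_nhds hc] with c hc using (hU hc hy).symm)
    have := h3.unique h2
    simp only [zero_mul, add_zero] at this
    simp only [hK]
    rw [div_eq_mul_inv, div_eq_mul_inv]
    simpa [mul_comm] using this
  have hξ {c y : ℝ} (hc : c ∈ Metric.ball c₀ δ) (hy : y ∈ Metric.ball y₀ δ) :
      (g (c, y)).1 = (g (c, y₀)).1 + K (c, y₀) * (y - y₀) :=
    eq_add_mul_of_hasDerivAt_ball (f := fun y => (g (c, y)).1) (fun y hy => by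
      rw [← hKc hc hy]; exact hasDerivAt_fst (hgsnd hc hy)) hy
  have hKd : DifferentiableAt ℝ (fun c => K (c, y₀)) c₀ := by
    have hy₁ : y₀ + δ / 2 ∈ Metric.ball y₀ δ := by
      rw [Metric.mem_ball, Real.dist_eq, add_sub_cancel_left, abs_of_pos] <;> linarith
    have hd : DifferentiableAt ℝ
        (fun c => ((g (c, y₀ + δ / 2)).1 - (g (c, y₀)).1) / (δ / 2)) c₀ :=
      (((hasDerivAt_fst (hgfst hc₀m hy₁)).sub
        (hasDerivAt_fst (hgfst hc₀m hy₀m))).div_const _).differentiableAt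
    refine hd.congr_of_eventuallyEq ?_
    filter_upwards [Metric.isOpen_ball.mem_nhds hc₀m] with c hc
    rw [hξ hc hy₁]
    field_simp
    ring
  have hKp : K (c₀, y₀) = k := by
    simp only [hK, hgp, hk]; field_simp
  refine ⟨deriv (fun c => K (c, y₀)) c₀, ?_⟩
  filter_upwards [Metric.ball_mem_nhds (0 : ℝ) hδ] with s hs
  have hys : y₀ + s ∈ Metric.ball y₀ δ := by
    simpa [Metric.mem_ball, Real.dist_eq] using hs
  have hq : g (c₀, y₀ + s) = (p.1 + s * k, y₀ + s) := by
    ext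
    · rw [hξ hc₀m hys, hgp, hKp]; simp only; ring
    · exact (hg _ (hmem hc₀m hys)).2.1
  have hne := (hg _ (hmem hc₀m hys)).1
  have hder : 1 / partialFst v (g (c₀, y₀ + s)) =
      1 / partialFst v p + deriv (fun c => K (c, y₀)) c₀ * s := by
    have h1 := hasDerivAt_fst (hgfst hc₀m hys)
    have h2 := (hasDerivAt_fst (hgfst hc₀m hy₀m)).add (hKd.hasDerivAt.mul_const s)
    have h3 := h2.congr_of_eventuallyEq (f₁ := fun c => (g (c, y₀ + s)).1) (by
      filter_upwards [Metric.isOpen_ball.mem_nhds hc₀m] with c hc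
      rw [hξ hc hys]; simp)
    have := h1.unique h3
    simpa only [hgp] using this
  have hKs := hKc hc₀m hys
  rw [hKp] at hKs
  simp only [hK] at hKs
  rw [← hq]
  refine ⟨?_, ?_⟩
  · rw [← hder]; field_simp
  · rwa [div_eq_iff hne] at hKs

/-- The kernel direction persists along the whole line. -/
theorem partialFst_ne_zero_along_line {u v : ℝ × ℝ → ℝ} (hu : ContDiff ℝ 1 u)
    (hv : ContDiff ℝ 1 v)
    (htr : ∀ z, partialFst u z + partialSnd v z = 0)
    (hdet : ∀ z, partialFst u z * partialSnd v z = partialSnd u z * partialFst v z)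
    {p : ℝ × ℝ} {k : ℝ} (hp : partialFst v p ≠ 0) (hk : partialFst u p = k * partialFst v p)
    (s : ℝ) :
    partialFst v (p.1 + s * k, p.2 + s) ≠ 0 ∧
      partialFst u (p.1 + s * k, p.2 + s) = k * partialFst v (p.1 + s * k, p.2 + s) := by
  obtain ⟨d, hd⟩ := exists_affine_near hu hv htr hdet hp hk
  set C : Set ℝ := {s | partialFst v (p.1 + s * k, p.2 + s) * (1 / partialFst v p + d * s) = 1 ∧
      partialFst u (p.1 + s * k, p.2 + s) = k * partialFst v (p.1 + s * k, p.2 + s)}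
  have hcu := continuous_partialFst hu
  have hcv := continuous_partialFst hv
  have hCclosed : IsClosed C :=
    (isClosed_eq (by fun_prop) (by fun_prop)).inter (isClosed_eq (by fun_prop) (by fun_prop))
  have hclosed : IsClosed (interior C) := by
    refine isClosed_of_closure_subset fun t ht => ?_
    have htC : t ∈ C := hCclosed.closure_subset_iff.2 interior_subset ht
    have htne : partialFst v (p.1 + t * k, p.2 + t) ≠ 0 := left_ne_zero_of_mul_eq_one htC.1
    obtain ⟨b, hb⟩ := exists_affine_near hu hv htr hdet htne htC.2
    have hb' : ∀ᶠ r in 𝓝 t, partialFst v (p.1 + r * k, p.2 + r) *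
          (1 / partialFst v (p.1 + t * k, p.2 + t) + b * (r - t)) = 1 ∧
        partialFst u (p.1 + r * k, p.2 + r) = k * partialFst v (p.1 + r * k, p.2 + r) := by
      have ht0 : Tendsto (fun r => r - t) (𝓝 t) (𝓝 0) := by
        have : Continuous fun r : ℝ => r - t := by fun_prop
        simpa using this.tendsto t
      filter_upwards [ht0.eventually hb] with r hr
      have e1 : p.1 + t * k + (r - t) * k = p.1 + r * k := by ring
      have e2 : p.2 + t + (r - t) = p.2 + r := by ring
      simpa only [e1, e2] using hr
    have h1t : 1 / partialFst v (p.1 + t * k, p.2 + t) = 1 / partialFst v p + d * t := by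
      rw [div_eq_iff htne]; linarith [htC.1]
    have hbd : b = d := by
      obtain ⟨W, hW, hWo, htW⟩ := eventually_nhds_iff.1 hb'
      have hopen : IsOpen (W ∩ interior C) := hWo.inter isOpen_interior
      obtain ⟨r, hrW, hrC⟩ := mem_closure_iff.1 ht W hWo htW
      have hnear : ∀ᶠ r' in 𝓝[≠] r, r' ∈ W ∩ interior C :=
        nhdsWithin_le_nhds (hopen.mem_nhds ⟨hrW, hrC⟩)
      have key : ∀ r' ∈ W ∩ interior C, (b - d) * (r' - t) = 0 := by
        rintro r' ⟨h1, h2⟩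
        have h3 := (hW r' h1).1
        have h4 := (interior_subset h2 : r' ∈ C).1
        have hne := left_ne_zero_of_mul_eq_one h4
        have h5 := mul_left_cancel₀ hne (h3.trans h4.symm)
        rw [h1t] at h5
        linarith
      obtain ⟨r', hr', hne⟩ := (hnear.and self_mem_nhdsWithin).exists
      have k1 := key r ⟨hrW, hrC⟩
      have k2 := key r' hr'
      have : (b - d) * (r' - r) = 0 := by linarith
      rcases mul_eq_zero.1 this with h | h
      · linarith
      · exact absurd (sub_eq_zero.1 h) hne
    rw [mem_interior_iff_mem_nhds]
    filter_upwards [hb'] with r hr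
    refine ⟨?_, hr.2⟩
    have h := hr.1
    rw [h1t, hbd] at h
    linarith
  have huniv : interior C = Set.univ :=
    IsClopen.eq_univ ⟨hclosed, isOpen_interior⟩ ⟨0, mem_interior_iff_mem_nhds.2 hd⟩
  have hs : s ∈ C := interior_subset (huniv ▸ Set.mem_univ s)
  exact ⟨left_ne_zero_of_mul_eq_one hs.1, hs.2⟩

theorem partialSnd_ne_zero_along_line {u v : ℝ × ℝ → ℝ} (hu : ContDiff ℝ 1 u)
    (hv : ContDiff ℝ 1 v)
    (htr : ∀ z, partialFst u z + partialSnd v z = 0)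
    (hdet : ∀ z, partialFst u z * partialSnd v z = partialSnd u z * partialFst v z)
    {p : ℝ × ℝ} {k : ℝ} (hp : partialSnd u p ≠ 0) (hk : partialSnd v p = k * partialSnd u p)
    (s : ℝ) :
    partialSnd u (p.1 + s, p.2 + s * k) ≠ 0 ∧
      partialSnd v (p.1 + s, p.2 + s * k) = k * partialSnd u (p.1 + s, p.2 + s * k) := by
  have hswap {f : ℝ × ℝ → ℝ} (hf : ContDiff ℝ 1 f) (z : ℝ × ℝ) :
      HasFDerivAt (fun z : ℝ × ℝ => f z.swap)
        ((fderiv ℝ f z.swap).comp (ContinuousLinearEquiv.prodComm ℝ ℝ ℝ : ℝ × ℝ →L[ℝ] ℝ × ℝ)) z :=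
    ((hf.differentiable one_ne_zero) z.swap).hasFDerivAt.comp z
      (ContinuousLinearEquiv.prodComm ℝ ℝ ℝ).hasFDerivAt
  have hfst {f : ℝ × ℝ → ℝ} (hf : ContDiff ℝ 1 f) (z : ℝ × ℝ) :
      partialFst (fun z => f z.swap) z = partialSnd f z.swap := by
    simp [partialFst, partialSnd, (hswap hf z).fderiv]
  have hsnd {f : ℝ × ℝ → ℝ} (hf : ContDiff ℝ 1 f) (z : ℝ × ℝ) :
      partialSnd (fun z => f z.swap) z = partialFst f z.swap := by
    simp [partialFst, partialSnd, (hswap hf z).fderiv]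
  have hc {f : ℝ × ℝ → ℝ} (hf : ContDiff ℝ 1 f) : ContDiff ℝ 1 (fun z : ℝ × ℝ => f z.swap) :=
    hf.comp (contDiff_snd.prodMk contDiff_fst)
  have h := partialFst_ne_zero_along_line (hc hv) (hc hu)
    (fun z => by rw [hfst hv, hsnd hu]; linarith [htr z.swap])
    (fun z => by rw [hfst hv, hsnd hu, hsnd hv, hfst hu]; linarith [hdet z.swap])
    (p := p.swap) (k := k) (by rw [hfst hu]; simpa using hp)
    (by rw [hfst hu, hfst hv]; simpa using hk) s
  simpa only [hfst hu, hfst hv, Prod.swap_prod_mk, Prod.fst_swap, Prod.snd_swap] using h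

/-- A planar `C¹` field with nilpotent Jacobian has a constant kernel direction. -/
theorem exists_kernel_direction {u v : ℝ × ℝ → ℝ} (hu : ContDiff ℝ 1 u)
    (hv : ContDiff ℝ 1 v)
    (htr : ∀ z, partialFst u z + partialSnd v z = 0)
    (hdet : ∀ z, partialFst u z * partialSnd v z = partialSnd u z * partialFst v z) :
    (∀ z, partialFst v z = 0) ∨
      ∃ k : ℝ, ∀ z, partialFst u z = k * partialFst v z ∧
        partialSnd u z = k * partialSnd v z ∧ partialSnd v z = -(k * partialFst v z) := by
  by_cases h0 : ∀ z, partialFst v z = 0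
  · exact Or.inl h0
  right
  push Not at h0
  obtain ⟨p, hp⟩ := h0
  obtain ⟨k, hk⟩ : ∃ k, partialFst u p = k * partialFst v p :=
    ⟨partialFst u p / partialFst v p, by field_simp⟩
  have hline := partialFst_ne_zero_along_line hu hv htr hdet hp hk
  refine ⟨k, fun z => ?_⟩
  have ht := htr z
  have hd := hdet z
  by_cases hz : partialFst v z = 0
  · rw [hz, mul_zero] at hd
    have hu1 : partialFst u z = 0 := by
      have : partialSnd v z = -partialFst u z := by linarith
      rw [this] at hd
      have : partialFst u z ^ 2 = 0 := by linarith
      exact pow_eq_zero_iff two_ne_zero |>.1 this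
    have hv2 : partialSnd v z = 0 := by linarith
    have hu2 : partialSnd u z = 0 := by
      by_contra hne
      have h1 := partialSnd_ne_zero_along_line hu hv htr hdet hne (k := 0) (by simp [hv2])
        (p.1 + (z.2 - p.2) * k - z.1)
      have h2 := (hline (z.2 - p.2)).1
      have e1 : z.1 + (p.1 + (z.2 - p.2) * k - z.1) = p.1 + (z.2 - p.2) * k := by ring
      rw [mul_zero, add_zero, e1, zero_mul] at h1
      rw [add_sub_cancel] at h2
      have h3 := hdet (p.1 + (z.2 - p.2) * k, z.2)
      rw [h1.2, mul_zero] at h3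
      exact mul_ne_zero h1.1 h2 h3.symm
    simp [hz, hu1, hu2, hv2]
  · obtain ⟨l, hl⟩ : ∃ l, partialFst u z = l * partialFst v z :=
      ⟨partialFst u z / partialFst v z, by field_simp⟩
    have hlk : l = k := by
      by_contra hne
      have hkl : k - l ≠ 0 := sub_ne_zero.2 (Ne.symm hne)
      have hline' := partialFst_ne_zero_along_line hu hv htr hdet hz hl
      set s := (z.1 - p.1 - (z.2 - p.2) * l) / (k - l) with hs
      have hs' : s * (k - l) = z.1 - p.1 - (z.2 - p.2) * l := by
        rw [hs]; field_simp
      have h1 := hline s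
      have h2 := hline' (p.2 + s - z.2)
      have e1 : z.1 + (p.2 + s - z.2) * l = p.1 + s * k := by linarith
      rw [add_sub_cancel, e1] at h2
      exact hne (mul_right_cancel₀ h1.1 (h2.2.symm.trans h1.2))
    rw [hlk] at hl
    refine ⟨hl, ?_, by linarith⟩
    rw [hl] at hd
    apply mul_right_cancel₀ hz
    linarith

theorem eq_const_of_partial_eq_zero {f : ℝ × ℝ → ℝ} (hf : ContDiff ℝ 1 f) {a : ℝ × ℝ}
    (h : ∀ z, a.1 * partialFst f z + a.2 * partialSnd f z = 0) (z : ℝ × ℝ) (t : ℝ) :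
    f (z + t • a) = f z := by
  have hd (s : ℝ) : HasDerivAt (fun s : ℝ => f (z + s • a)) 0 s := by
    rw [← h (z + s • a)]
    refine hasDerivAt_comp_partial hf ?_
    simpa using ((hasDerivAt_id s).smul_const a).const_add z
  have := is_const_of_deriv_eq_zero (fun s => (hd s).differentiableAt) (fun s => (hd s).deriv) t 0
  simpa using this

/-- A planar `C¹` field with nilpotent Jacobian that vanishes at the origin is a plane wave
`z ↦ ψ (s z₁ + c z₂) • (c, -s)` with `(c, s)` a unit vector. -/
theorem exists_plane_wave {u v : ℝ × ℝ → ℝ} (hu : ContDiff ℝ 1 u)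
    (hv : ContDiff ℝ 1 v)
    (htr : ∀ z, partialFst u z + partialSnd v z = 0)
    (hdet : ∀ z, partialFst u z * partialSnd v z = partialSnd u z * partialFst v z)
    (hu0 : u 0 = 0) (hv0 : v 0 = 0) :
    ∃ (θ : ℝ) (ψ : ℝ → ℝ), ContDiff ℝ 1 ψ ∧ ψ 0 = 0 ∧
      ∀ z : ℝ × ℝ, u z = Real.cos θ * ψ (Real.sin θ * z.1 + Real.cos θ * z.2) ∧
        v z = -(Real.sin θ * ψ (Real.sin θ * z.1 + Real.cos θ * z.2)) := by
  rcases exists_kernel_direction hu hv htr hdet with h | ⟨k, hk⟩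
  · have hu1 (z : ℝ × ℝ) : partialFst u z = 0 := by
      have h1 := hdet z
      rw [h z, show partialSnd v z = -partialFst u z by linarith [htr z]] at h1
      have : partialFst u z ^ 2 = 0 := by linarith
      exact pow_eq_zero_iff two_ne_zero |>.1 this
    have hv2 (z : ℝ × ℝ) : partialSnd v z = 0 := by linarith [htr z, hu1 z]
    refine ⟨0, fun t => u (0, t), hu.comp (contDiff_const.prodMk contDiff_id), hu0, fun z => ?_⟩
    have h1 := eq_const_of_partial_eq_zero hu (a := (1, 0)) (fun z => by simp [hu1 z]) (0, z.2) z.1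
    have h2 := eq_const_of_partial_eq_zero hv (a := z) (fun w => by simp [h w, hv2 w]) 0 1
    simp only [zero_add, one_smul, hv0] at h2
    simpa [h2] using h1
  · set r := √(1 + k ^ 2)
    have hr0 : 0 < r := by positivity
    have hcos : Real.cos (Real.arctan k - Real.pi / 2) = k / r := by
      rw [Real.cos_sub_pi_div_two, Real.sin_arctan]
    have hsin : Real.sin (Real.arctan k - Real.pi / 2) = -(1 / r) := by
      rw [Real.sin_sub_pi_div_two, Real.cos_arctan]
    refine ⟨Real.arctan k - Real.pi / 2, fun t => r * v (-(r * t), 0), ?_, ?_, fun z => ?_⟩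
    · exact contDiff_const.mul
        (hv.comp ((contDiff_const.mul contDiff_id).neg.prodMk contDiff_const))
    · simpa [hr0.ne', ← Prod.mk_zero_zero] using hv0
    have hvz : v z = v (z.1 - k * z.2, 0) := by
      have := eq_const_of_partial_eq_zero hv (a := (k, 1))
        (fun z => by simp only; linarith [(hk z).2.2]) (z.1 - k * z.2, 0) z.2
      rw [← this]
      congr 1
      ext <;> simp [mul_comm]
    have huv : u z = k * v z := by
      have hg : ContDiff ℝ 1 (fun z => u z - k * v z) := hu.sub (contDiff_const.mul hv)
      have hfd (w : ℝ × ℝ) : HasFDerivAt (fun z => u z - k * v z)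
          (fderiv ℝ u w - k • fderiv ℝ v w) w :=
        ((hu.differentiable one_ne_zero) w).hasFDerivAt.sub
          (((hv.differentiable one_ne_zero) w).hasFDerivAt.const_mul k)
      have := eq_const_of_partial_eq_zero hg (a := z) (fun w => by
        have h1 : partialFst (fun z => u z - k * v z) w = 0 := by
          have := (hk w).1
          simp only [partialFst] at this ⊢
          simp [(hfd w).fderiv, this]
        have h2 : partialSnd (fun z => u z - k * v z) w = 0 := by
          have := (hk w).2.1
          simp only [partialSnd] at this ⊢
          simp [(hfd w).fderiv, this]
        rw [h1, h2]; simp) 0 1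
      simp only [zero_add, one_smul, hu0, hv0] at this
      linarith
    have harg : -(r * (-(1 / r) * z.1 + k / r * z.2)) = z.1 - k * z.2 := by
      field_simp
      ring
    rw [hcos, hsin]
    simp only [harg]
    rw [huv, hvz]
    constructor <;> field_simp

theorem rot_conj_shear_iff (G : ℝ × ℝ → ℝ × ℝ) (θ : ℝ) (ψ : ℝ → ℝ) :
    (∀ x y : ℝ, Rot θ (G (Rot (-θ) (x, y))) = (x + ψ y, y)) ↔
      ∀ z : ℝ × ℝ, G z = (z.1 + Real.cos θ * ψ (Real.sin θ * z.1 + Real.cos θ * z.2),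
        z.2 - Real.sin θ * ψ (Real.sin θ * z.1 + Real.cos θ * z.2)) := by
  have hcs := Real.sin_sq_add_cos_sq θ
  have hinv (z : ℝ × ℝ) : Rot (-θ) (Rot θ z) = z := by
    ext
    · simp only [Rot, Real.cos_neg, Real.sin_neg]; linear_combination z.1 * hcs
    · simp only [Rot, Real.cos_neg, Real.sin_neg]; linear_combination z.2 * hcs
  constructor
  · intro h z
    have h1 := h (Rot θ z).1 (Rot θ z).2
    rw [Prod.mk.eta, hinv] at h1
    have h2 := congrArg (Rot (-θ)) h1
    rw [hinv] at h2
    have harg : Real.sin θ * z.1 + Real.cos θ * z.2 = (Rot θ z).2 := by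
      simp only [Rot]; ring
    rw [h2, harg]
    ext
    · simp only [Rot, Real.cos_neg, Real.sin_neg]; linear_combination z.1 * hcs
    · simp only [Rot, Real.cos_neg, Real.sin_neg]; linear_combination z.2 * hcs
  · intro h x y
    have harg : Real.sin θ * (Rot (-θ) (x, y)).1 + Real.cos θ * (Rot (-θ) (x, y)).2 = y := by
      simp only [Rot, Real.cos_neg, Real.sin_neg]; linear_combination y * hcs
    rw [h, harg]
    ext
    · simp only [Rot, Real.cos_neg, Real.sin_neg]; linear_combination (x + ψ y) * hcs
    · simp only [Rot, Real.cos_neg, Real.sin_neg]; linear_combination y * hcs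

theorem fderiv_plane_wave_apply {G : ℝ × ℝ → ℝ × ℝ} {c s : ℝ} {ψ : ℝ → ℝ}
    (hψ : Differentiable ℝ ψ)
    (hG : ∀ z : ℝ × ℝ, G z = (z.1 + c * ψ (s * z.1 + c * z.2), z.2 - s * ψ (s * z.1 + c * z.2)))
    (z a : ℝ × ℝ) :
    fderiv ℝ G z a = (a.1 + c * (deriv ψ (s * z.1 + c * z.2) * (s * a.1 + c * a.2)),
      a.2 - s * (deriv ψ (s * z.1 + c * z.2) * (s * a.1 + c * a.2))) := by
  have hw : HasFDerivAt (fun z : ℝ × ℝ => s * z.1 + c * z.2)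
      (s • ContinuousLinearMap.fst ℝ ℝ ℝ + c • ContinuousLinearMap.snd ℝ ℝ ℝ) z :=
    (hasFDerivAt_fst.const_mul s).add (hasFDerivAt_snd.const_mul c)
  have hψw := (hψ (s * z.1 + c * z.2)).hasDerivAt.comp_hasFDerivAt z hw
  have h := (hasFDerivAt_fst.add (hψw.const_mul c)).prodMk
    (hasFDerivAt_snd.sub (hψw.const_mul s))
  have h' := h.congr_of_eventuallyEq (f₁ := G) (Eventually.of_forall hG)
  rw [h'.fderiv]
  simp [mul_add]

theorem nonlinearMap_plane_wave_iff {G : ℝ × ℝ → ℝ × ℝ} {θ : ℝ} {ψ : ℝ → ℝ}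
    (hψ : Differentiable ℝ ψ) (hψ0 : ψ 0 = 0)
    (hG : ∀ z : ℝ × ℝ, G z = (z.1 + Real.cos θ * ψ (Real.sin θ * z.1 + Real.cos θ * z.2),
        z.2 - Real.sin θ * ψ (Real.sin θ * z.1 + Real.cos θ * z.2))) :
    NonlinearMap G ↔ NonlinearFun ψ := by
  have hd := fderiv_plane_wave_apply hψ hG
  refine not_congr ⟨?_, ?_⟩
  · rintro ⟨A, hA⟩
    have hder (t : ℝ) : deriv ψ t = (A (0, 1)).1 - (A (1, 0)).2 := by
      have hcs := Real.sin_sq_add_cos_sq θ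
      have harg : Real.sin θ * (Real.sin θ * t) + Real.cos θ * (Real.cos θ * t) = t := by
        linear_combination t * hcs
      rw [← hA (Real.sin θ * t, Real.cos θ * t), hd, hd]
      simp only [harg]
      linear_combination -(deriv ψ t) * hcs
    refine ⟨(A (0, 1)).1 - (A (1, 0)).2, fun t => ?_⟩
    have := eq_add_mul_of_hasDerivAt_ball (f := ψ)
      (K := (A (0, 1)).1 - (A (1, 0)).2) (y₀ := 0) (δ := |t| + 1) (y := t)
      (fun y _ => by rw [← hder y]; exact (hψ y).hasDerivAt) (by simp)
    simpa [hψ0] using this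
  · rintro ⟨k, hk⟩
    have hder (t : ℝ) : deriv ψ t = k := by
      rw [funext hk]
      simp
    refine ⟨fderiv ℝ G 0, fun z => ?_⟩
    refine ContinuousLinearMap.ext fun a => ?_
    simp only [hd, hder]

/-- a map is nonlinear, unipotent and fixes the origin iff some rotation
conjugates it to a shear `(x, y) ↦ (x + ψ y, y)` with `ψ` nonlinear, `C¹`, `ψ 0 = 0`. -/
theorem statement4 (G : ℝ × ℝ → ℝ × ℝ) (hG : ContDiff ℝ 1 G) :
    (Unipotent G ∧ NonlinearMap G ∧ G (0, 0) = (0, 0)) ↔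
      ∃ (θ : ℝ) (ψ : ℝ → ℝ), ContDiff ℝ 1 ψ ∧ NonlinearFun ψ ∧ ψ 0 = 0 ∧
        ∀ x y : ℝ, Rot θ (G (Rot (-θ) (x, y))) = (x + ψ y, y) := by
  constructor
  · rintro ⟨hU, hN, h0⟩
    have hid : ContDiff ℝ 1 (fun z : ℝ × ℝ => z) := contDiff_id
    have hdiff (z : ℝ × ℝ) := ((hG.differentiable one_ne_zero) z).hasFDerivAt
    have hu : ContDiff ℝ 1 (fun z => (G z).1 - z.1) := hG.fst.sub hid.fst
    have hv : ContDiff ℝ 1 (fun z => (G z).2 - z.2) := hG.snd.sub hid.snd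
    have hdu (z a : ℝ × ℝ) : fderiv ℝ (fun z => (G z).1 - z.1) z a = (fderiv ℝ G z a).1 - a.1 := by
      rw [((hdiff z).fst.fun_sub hasFDerivAt_fst).fderiv]
      rfl
    have hdv (z a : ℝ × ℝ) : fderiv ℝ (fun z => (G z).2 - z.2) z a = (fderiv ℝ G z a).2 - a.2 := by
      rw [((hdiff z).snd.fun_sub hasFDerivAt_snd).fderiv]
      rfl
    obtain ⟨θ, ψ, hψ, hψ0, hψG⟩ := exists_plane_wave hu hv
      (fun z => by simp only [partialFst, partialSnd, hdu, hdv]; linarith [(hU z).1])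
      (fun z => by
        simp only [partialFst, partialSnd, hdu, hdv]
        linear_combination (hU z).2 - (hU z).1)
      (by simp [← Prod.mk_zero_zero, h0]) (by simp [← Prod.mk_zero_zero, h0])
    have hwave (z : ℝ × ℝ) :
        G z = (z.1 + Real.cos θ * ψ (Real.sin θ * z.1 + Real.cos θ * z.2),
          z.2 - Real.sin θ * ψ (Real.sin θ * z.1 + Real.cos θ * z.2)) := by
      ext
      · linear_combination (hψG z).1
      · linear_combination (hψG z).2
    exact ⟨θ, ψ, hψ, (nonlinearMap_plane_wave_iff (hψ.differentiable one_ne_zero) hψ0 hwave).1 hN,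
      hψ0, (rot_conj_shear_iff G θ ψ).2 hwave⟩
  · rintro ⟨θ, ψ, hψ, hN, hψ0, h⟩
    have hwave := (rot_conj_shear_iff G θ ψ).1 h
    have hψd := hψ.differentiable one_ne_zero
    refine ⟨fun z => ?_, (nonlinearMap_plane_wave_iff hψd hψ0 hwave).2 hN, by simp [hwave, hψ0]⟩
    simp only [fderiv_plane_wave_apply hψd hwave]
    constructor <;> ring
end

section
/- Let G : ℝ² → ℝ² be a continuously differentiable map which is unipotent, nonlinear, and satisfies G(0,0) = (0,0). Then for every z ∈ ℝ², either G(z) = z, or the forward orbit of z diverges to infinity: the norms ‖G^n(z)‖ of the iterates tend to +∞ as n → +∞. -/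
open Filter Topology

/-- The chain rule along a planar curve, in coordinates. -/
lemma hasDerivAt_comp_prodMk {F : ℝ × ℝ → ℝ} {a b : ℝ → ℝ} {a' b' t : ℝ}
    (hF : DifferentiableAt ℝ F (a t, b t)) (ha : HasDerivAt a a' t) (hb : HasDerivAt b b' t) :
    HasDerivAt (fun s => F (a s, b s))
      (a' * fderiv ℝ F (a t, b t) (1, 0) + b' * fderiv ℝ F (a t, b t) (0, 1)) t := by
  have h := hF.hasFDerivAt.comp_hasDerivAt t (ha.prodMk hb)
  have e : ((a', b') : ℝ × ℝ) = a' • (1, 0) + b' • (0, 1) := by simp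
  rw [e, map_add, map_smul, map_smul] at h
  simpa [Function.comp_def] using h

/-- A `C¹` function with nonvanishing second partial derivative can be used as a local coordinate:
`Y (x, u)` is the height over `x` of the level curve of `P` at level `u`. -/
lemma exists_levelCurve {P : ℝ × ℝ → ℝ} (hP : ContDiff ℝ 1 P) (p : ℝ × ℝ)
    (hk : fderiv ℝ P p (0, 1) ≠ 0) :
    ∃ Y : ℝ × ℝ → ℝ, Y (p.1, P p) = p.2 ∧
      ∀ᶠ w in 𝓝 (p.1, P p), DifferentiableAt ℝ Y w ∧ P (w.1, Y w) = w.2 := by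
  let f : (ℝ × ℝ) × ℝ → ℝ := fun v => P (v.1.1, v.2) - v.1.2
  let c : (ℝ × ℝ) × ℝ := ((p.1, P p), p.2)
  have hf : ContDiff ℝ 1 f := by fun_prop
  have h1 : fderiv ℝ f c (0, 1) = fderiv ℝ P p (0, 1) := by
    have hl : HasDerivAt (fun t : ℝ => ((p.1, P p), t)) ((0 : ℝ × ℝ), (1 : ℝ)) p.2 :=
      (hasDerivAt_const p.2 (p.1, P p)).prodMk (hasDerivAt_id p.2)
    have a1 := (hf.differentiable one_ne_zero c).hasFDerivAt.comp_hasDerivAt p.2 hl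
    have a2 := (hasDerivAt_comp_prodMk (hP.differentiable one_ne_zero (p.1, p.2))
      (hasDerivAt_const p.2 p.1) (hasDerivAt_id p.2)).sub_const (P p)
    simpa using a1.unique a2
  have hinv : (fderiv ℝ f c ∘L .inr ℝ (ℝ × ℝ) ℝ).IsInvertible := by
    refine ⟨ContinuousLinearEquiv.smulLeft (Units.mk0 _ hk), ?_⟩
    ext
    simp [h1, Units.smul_def]
  have hc := hf.contDiffAt (x := c)
  refine ⟨hc.implicitFunction one_ne_zero hinv, hc.implicitFunction_apply_self one_ne_zero hinv, ?_⟩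
  filter_upwards [(hc.contDiffAt_implicitFunction one_ne_zero hinv).eventually (by simp),
    hc.eventually_apply_implicitFunction one_ne_zero hinv] with w h2 h3
  refine ⟨h2.differentiableAt one_ne_zero, ?_⟩
  simpa [f, c, sub_eq_zero] using h3

/-- Near a point where `∂₁P = 0` and `∂₂P ≠ 0`, the derivative of a map `(P, Q)` with nilpotent
Jacobian evolves along the horizontal line so that `1 / ∂₂P` is affine. -/
lemma nilpotent_local_line {P Q : ℝ × ℝ → ℝ} (hP : ContDiff ℝ 1 P) (hQ : ContDiff ℝ 1 Q)
    (htr : ∀ z, fderiv ℝ P z (1, 0) + fderiv ℝ Q z (0, 1) = 0)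
    (hdet : ∀ z, fderiv ℝ P z (1, 0) * fderiv ℝ Q z (0, 1) -
      fderiv ℝ P z (0, 1) * fderiv ℝ Q z (1, 0) = 0)
    (p : ℝ × ℝ) (h0 : fderiv ℝ P p (1, 0) = 0) (hk : fderiv ℝ P p (0, 1) ≠ 0) :
    ∃ γ : ℝ, ∀ᶠ x in 𝓝 p.1, fderiv ℝ P (x, p.2) (1, 0) = 0 ∧
      (1 + γ * (x - p.1)) * fderiv ℝ P (x, p.2) (0, 1) = fderiv ℝ P p (0, 1) := by
  obtain ⟨Y, hY0, hY⟩ := exists_levelCurve hP p hk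
  obtain ⟨ε, hε, hbox⟩ := Metric.eventually_nhds_iff_ball.1 hY
  obtain ⟨x₀, y₀⟩ := p
  set u₀ := P (x₀, y₀)
  simp only at hY0 hbox ⊢
  rw [← ball_prod_same] at hbox
  set I := Metric.ball x₀ ε
  set J := Metric.ball u₀ ε
  have hx₀ : x₀ ∈ I := Metric.mem_ball_self hε
  have hu₀ : u₀ ∈ J := Metric.mem_ball_self hε
  have hI : ∀ {x}, x ∈ I → I ∈ 𝓝 x := fun h => Metric.isOpen_ball.mem_nhds h
  have hJ : ∀ {u}, u ∈ J → J ∈ 𝓝 u := fun h => Metric.isOpen_ball.mem_nhds h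
  have hdY : ∀ {x u}, x ∈ I → u ∈ J → DifferentiableAt ℝ Y (x, u) := fun hx hu =>
    (hbox _ ⟨hx, hu⟩).1
  have hPY : ∀ {x u}, x ∈ I → u ∈ J → P (x, Y (x, u)) = u := fun hx hu =>
    (hbox (_, _) ⟨hx, hu⟩).2
  let Yx : ℝ → ℝ → ℝ := fun x u => fderiv ℝ Y (x, u) (1, 0)
  let Yu : ℝ → ℝ → ℝ := fun x u => fderiv ℝ Y (x, u) (0, 1)
  have dYx : ∀ {x u}, x ∈ I → u ∈ J → HasDerivAt (fun x => Y (x, u)) (Yx x u) x := fun hx hu => by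
    simpa using hasDerivAt_comp_prodMk (hdY hx hu) (hasDerivAt_id _) (hasDerivAt_const _ _)
  have dYu : ∀ {x u}, x ∈ I → u ∈ J → HasDerivAt (fun u => Y (x, u)) (Yu x u) u := fun hx hu => by
    simpa using hasDerivAt_comp_prodMk (hdY hx hu) (hasDerivAt_const _ _) (hasDerivAt_id _)
  have dP := hP.differentiable one_ne_zero
  have dQ := hQ.differentiable one_ne_zero
  have ePx : ∀ {x u}, x ∈ I → u ∈ J →
      fderiv ℝ P (x, Y (x, u)) (1, 0) + Yx x u * fderiv ℝ P (x, Y (x, u)) (0, 1) = 0 := by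
    intro x u hx hu
    have a1 := hasDerivAt_comp_prodMk (dP (x, Y (x, u))) (hasDerivAt_id x) (dYx hx hu)
    have a2 : HasDerivAt (fun s => P (s, Y (s, u))) 0 x :=
      (hasDerivAt_const x u).congr_of_eventuallyEq
        (by filter_upwards [hI hx] with s hs using hPY hs hu)
    simpa using a1.unique a2
  have ePu : ∀ {x u}, x ∈ I → u ∈ J →
      Yu x u * fderiv ℝ P (x, Y (x, u)) (0, 1) = 1 := by
    intro x u hx hu
    have a1 := hasDerivAt_comp_prodMk (dP (x, Y (x, u))) (hasDerivAt_const u x) (dYu hx hu)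
    have a2 : HasDerivAt (fun s => P (x, Y (x, s))) 1 u :=
      (hasDerivAt_id u).congr_of_eventuallyEq
        (by filter_upwards [hJ hu] with s hs using hPY hx hs)
    simpa using a1.unique a2
  -- `Q` is constant along the level curves of `P`
  have dqx : ∀ {x u}, x ∈ I → u ∈ J → HasDerivAt (fun s => Q (s, Y (s, u))) 0 x := by
    intro x u hx hu
    have a1 := hasDerivAt_comp_prodMk (dQ (x, Y (x, u))) (hasDerivAt_id x) (dYx hx hu)
    convert! a1 using 1
    have e1 := ePx hx hu
    have e2 := ePu hx hu
    have e3 := hdet (x, Y (x, u))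
    simp only [id]
    linear_combination -(Yu x u * fderiv ℝ Q (x, Y (x, u)) (0, 1)) * e1 +
      (fderiv ℝ Q (x, Y (x, u)) (1, 0) + Yx x u * fderiv ℝ Q (x, Y (x, u)) (0, 1)) * e2 +
      Yu x u * e3
  have dqu : ∀ {x u}, x ∈ I → u ∈ J → HasDerivAt (fun s => Q (x, Y (x, s))) (Yx x u) u := by
    intro x u hx hu
    have a1 := hasDerivAt_comp_prodMk (dQ (x, Y (x, u))) (hasDerivAt_const u x) (dYu hx hu)
    convert! a1 using 1
    linear_combination Yu x u * ePx hx hu - Yu x u * htr (x, Y (x, u)) - Yx x u * ePu hx hu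
  have hq : ∀ {x u}, x ∈ I → u ∈ J → Q (x, Y (x, u)) = Q (x₀, Y (x₀, u)) := by
    intro x u hx hu
    exact Metric.isOpen_ball.is_const_of_deriv_eq_zero (convex_ball x₀ ε).isPreconnected
      (fun s hs => (dqx hs hu).differentiableAt.differentiableWithinAt)
      (fun s hs => (dqx hs hu).deriv) hx hx₀
  have hYx : ∀ {x u}, x ∈ I → u ∈ J → Yx x u = Yx x₀ u := by
    intro x u hx hu
    refine (dqu hx hu).unique ((dqu hx₀ hu).congr_of_eventuallyEq ?_)
    filter_upwards [hJ hu] with s hs using hq hx hs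
  -- hence the level curves are straight
  have hYaff : ∀ {x u}, x ∈ I → u ∈ J → Y (x, u) = Y (x₀, u) + Yx x₀ u * (x - x₀) := by
    intro x u hx hu
    have hd : ∀ {s}, s ∈ I → HasDerivAt (fun s => Y (s, u) - Yx x₀ u * (s - x₀)) 0 s := by
      intro s hs
      have := (dYx hs hu).fun_sub (((hasDerivAt_id s).sub_const x₀).const_mul (Yx x₀ u))
      simpa [hYx hs hu] using this
    have := Metric.isOpen_ball.is_const_of_deriv_eq_zero (convex_ball x₀ ε).isPreconnected
      (fun s hs => (hd hs).differentiableAt.differentiableWithinAt)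
      (fun s hs => (hd hs).deriv) hx hx₀
    simp only [sub_self, mul_zero, sub_zero] at this
    linarith
  have hYx₀ : Yx x₀ u₀ = 0 := by
    have := ePx hx₀ hu₀
    rw [hY0, h0, zero_add] at this
    exact (mul_eq_zero.1 this).resolve_right hk
  have hYc : ∀ {x}, x ∈ I → Y (x, u₀) = y₀ := fun hx => by rw [hYaff hx hu₀, hY0, hYx₀]; ring
  obtain ⟨β, hβ⟩ : ∃ β, HasDerivAt (Yx x₀) β u₀ := by
    have hx₁ : x₀ + ε / 2 ∈ I := by
      simp [I, abs_of_pos hε, hε]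
    refine ⟨_, (((dYu hx₁ hu₀).sub (dYu hx₀ hu₀)).div_const (ε / 2)).congr_of_eventuallyEq ?_⟩
    filter_upwards [hJ hu₀] with u hu
    simp only [Pi.sub_apply]
    rw [hYaff hx₁ hu]
    field_simp
    ring
  have hYu : ∀ {x}, x ∈ I → Yu x u₀ = Yu x₀ u₀ + β * (x - x₀) := by
    intro x hx
    refine (dYu hx hu₀).unique
      (((dYu hx₀ hu₀).add (hβ.mul_const (x - x₀))).congr_of_eventuallyEq ?_)
    filter_upwards [hJ hu₀] with u hu using hYaff hx hu
  refine ⟨β * fderiv ℝ P (x₀, y₀) (0, 1), ?_⟩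
  filter_upwards [hI hx₀] with x hx
  have e0 := ePu hx₀ hu₀
  have e1 := ePu hx hu₀
  have e2 := ePx hx hu₀
  rw [hYx hx hu₀, hYx₀, hYc hx] at e2
  rw [hYc hx, hYu hx] at e1
  rw [hY0] at e0
  refine ⟨by simpa using e2, ?_⟩
  linear_combination fderiv ℝ P (x₀, y₀) (0, 1) * e1 - fderiv ℝ P (x, y₀) (0, 1) * e0

/-- The horizontal line through a point where `∂₁P = 0` and `∂₂P ≠ 0` consists of such points. -/
lemma nilpotent_global_line {P Q : ℝ × ℝ → ℝ} (hP : ContDiff ℝ 1 P) (hQ : ContDiff ℝ 1 Q)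
    (htr : ∀ z, fderiv ℝ P z (1, 0) + fderiv ℝ Q z (0, 1) = 0)
    (hdet : ∀ z, fderiv ℝ P z (1, 0) * fderiv ℝ Q z (0, 1) -
      fderiv ℝ P z (0, 1) * fderiv ℝ Q z (1, 0) = 0)
    (p : ℝ × ℝ) (h0 : fderiv ℝ P p (1, 0) = 0) (hk : fderiv ℝ P p (0, 1) ≠ 0) (x : ℝ) :
    fderiv ℝ P (x, p.2) (1, 0) = 0 ∧ fderiv ℝ P (x, p.2) (0, 1) ≠ 0 := by
  obtain ⟨β, hβ⟩ := nilpotent_local_line hP hQ htr hdet p h0 hk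
  set k := fderiv ℝ P p (0, 1)
  have hcont : Continuous fun x : ℝ => fderiv ℝ P (x, p.2) :=
    (hP.continuous_fderiv one_ne_zero).comp (by fun_prop)
  set K : Set ℝ := {x | fderiv ℝ P (x, p.2) (1, 0) = 0 ∧
    (1 + β * (x - p.1)) * fderiv ℝ P (x, p.2) (0, 1) = k}
  have hK : IsClosed K :=
    (isClosed_eq (by fun_prop) continuous_const).inter
      (isClosed_eq (by fun_prop) continuous_const)
  have hne : ∀ {y}, y ∈ K → fderiv ℝ P (y, p.2) (0, 1) ≠ 0 := fun hy h => by
    apply hk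
    rw [← hy.2, h, mul_zero]
  have hclopen : IsClopen (interior K) := by
    refine ⟨isClosed_of_closure_subset fun y hy => ?_, isOpen_interior⟩
    have hyK : y ∈ K := closure_minimal interior_subset hK hy
    obtain ⟨γ, hγ⟩ := nilpotent_local_line hP hQ htr hdet (y, p.2) hyK.1 (hne hyK)
    obtain ⟨V, hV, hVo, hyV⟩ := eventually_nhds_iff.1 hγ
    obtain ⟨s, hs, hsy⟩ := (dense_compl_singleton y).inter_open_nonempty _
      (hVo.inter isOpen_interior) (mem_closure_iff.1 hy V hVo hyV)
    have hsK : s ∈ K := interior_subset hs.2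
    have hsV := (hV s hs.1).2
    have hβγ : (1 + β * (y - p.1)) * γ = β := by
      apply mul_right_cancel₀ (mul_ne_zero (sub_ne_zero.2 hsy) (hne hsK))
      linear_combination (1 + β * (y - p.1)) * hsV + hyK.2 - hsK.2
    refine mem_interior_iff_mem_nhds.2 ?_
    filter_upwards [hγ] with t ht
    refine ⟨ht.1, ?_⟩
    linear_combination (1 + β * (y - p.1)) * ht.2 + hyK.2 -
      (t - y) * fderiv ℝ P (t, p.2) (0, 1) * hβγ
  have huniv := hclopen.eq_univ ⟨p.1, mem_interior_iff_mem_nhds.2 hβ⟩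
  have hx : x ∈ K := interior_subset (huniv ▸ Set.mem_univ x)
  exact ⟨hx.1, hne hx⟩

/-- The value of a linear map of the plane in terms of its columns. -/
lemma planar_map_apply (D : (ℝ × ℝ) →L[ℝ] ℝ × ℝ) (w : ℝ × ℝ) :
    D w = w.1 • D (1, 0) + w.2 • D (0, 1) := by
  rw [← map_smul, ← map_smul, ← map_add]
  simp

lemma planar_normSq_ne_zero {v : ℝ × ℝ} (hv : v ≠ 0) : v.1 ^ 2 + v.2 ^ 2 ≠ 0 := by
  intro h
  apply hv
  ext
  · exact pow_eq_zero_iff two_ne_zero |>.1 (by nlinarith [sq_nonneg v.1, sq_nonneg v.2])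
  · exact pow_eq_zero_iff two_ne_zero |>.1 (by nlinarith [sq_nonneg v.1, sq_nonneg v.2])

/-- For a `C¹` planar map with nilpotent Jacobian, the kernel of the derivative at a point where it
does not vanish remains the kernel along the whole line through that point in its direction. -/
lemma nilpotent_kernel_line {H : ℝ × ℝ → ℝ × ℝ} (hH : ContDiff ℝ 1 H)
    (htr : ∀ z, (fderiv ℝ H z (1, 0)).1 + (fderiv ℝ H z (0, 1)).2 = 0)
    (hdet : ∀ z, (fderiv ℝ H z (1, 0)).1 * (fderiv ℝ H z (0, 1)).2 -
      (fderiv ℝ H z (0, 1)).1 * (fderiv ℝ H z (1, 0)).2 = 0)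
    {p v : ℝ × ℝ} (hp : fderiv ℝ H p ≠ 0) (hv : v ≠ 0) (hpv : fderiv ℝ H p v = 0) (s : ℝ) :
    fderiv ℝ H (p + s • v) ≠ 0 ∧ fderiv ℝ H (p + s • v) v = 0 := by
  have hN := planar_normSq_ne_zero hv
  let n : ℝ × ℝ := (-v.2, v.1)
  let φ : ℝ × ℝ → ℝ × ℝ := fun z => p + (z.1 • v + z.2 • n)
  let A : (ℝ × ℝ) →L[ℝ] ℝ × ℝ :=
    (ContinuousLinearMap.fst ℝ ℝ ℝ).smulRight v + (ContinuousLinearMap.snd ℝ ℝ ℝ).smulRight n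
  have hφ : ∀ z, HasFDerivAt φ A z := fun z => A.hasFDerivAt.const_add p
  let L : ℝ × ℝ → (ℝ × ℝ) →L[ℝ] ℝ := fun m =>
    m.1 • ContinuousLinearMap.fst ℝ ℝ ℝ + m.2 • ContinuousLinearMap.snd ℝ ℝ ℝ
  have hφc : ContDiff ℝ 1 φ := by fun_prop
  have hc : ∀ m, ContDiff ℝ 1 (fun z => L m (H (φ z))) := fun m =>
    (L m).contDiff.comp (hH.comp hφc)
  have hd : ∀ m z e, fderiv ℝ (fun z => L m (H (φ z))) z e = L m (fderiv ℝ H (φ z) (A e)) := by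
    intro m z e
    have := (L m).hasFDerivAt.comp z
      ((hH.differentiable one_ne_zero (φ z)).hasFDerivAt.comp z (hφ z))
    exact congrArg (fun T => T e) this.fderiv
  have hA1 : A (1, 0) = v := by simp [A]
  have hA2 : A (0, 1) = n := by simp [A]
  have htr' : ∀ z, fderiv ℝ (fun z => L v (H (φ z))) z (1, 0) +
      fderiv ℝ (fun z => L n (H (φ z))) z (0, 1) = 0 := by
    intro z
    rw [hd, hd, hA1, hA2, planar_map_apply _ v, planar_map_apply _ n]
    simp [L, n]
    linear_combination (v.1 ^ 2 + v.2 ^ 2) * htr (φ z)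
  have hdet' : ∀ z, fderiv ℝ (fun z => L v (H (φ z))) z (1, 0) *
      fderiv ℝ (fun z => L n (H (φ z))) z (0, 1) -
      fderiv ℝ (fun z => L v (H (φ z))) z (0, 1) *
      fderiv ℝ (fun z => L n (H (φ z))) z (1, 0) = 0 := by
    intro z
    rw [hd, hd, hd, hd, hA1, hA2, planar_map_apply _ v, planar_map_apply _ n]
    simp [L, n]
    linear_combination (v.1 ^ 2 + v.2 ^ 2) ^ 2 * hdet (φ z)
  have hφ0 : φ (0, 0) = p := by simp [φ]
  have hx0 : fderiv ℝ (fun z => L v (H (φ z))) (0, 0) (1, 0) = 0 := by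
    rw [hd, hA1, hφ0, hpv, map_zero]
  have hy0 : fderiv ℝ (fun z => L v (H (φ z))) (0, 0) (0, 1) ≠ 0 := by
    intro h
    apply hp
    rw [hd, hA2, hφ0, planar_map_apply _ n] at h
    rw [planar_map_apply _ v] at hpv
    have h1 := congrArg Prod.fst hpv
    have h2 := congrArg Prod.snd hpv
    have h3 := htr p
    simp [L, n] at h h1 h2
    set a := (fderiv ℝ H p (1, 0)).1
    set b := (fderiv ℝ H p (0, 1)).1
    set c := (fderiv ℝ H p (1, 0)).2
    set d := (fderiv ℝ H p (0, 1)).2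
    have hα : -(v.2 * a) + v.1 * b = 0 := by
      apply (mul_eq_zero.1 (?_ : (v.1 ^ 2 + v.2 ^ 2) * _ = 0)).resolve_left hN
      linear_combination v.1 * h - v.2 * ((v.1 ^ 2 + v.2 ^ 2) * h3 - v.1 * h1 - v.2 * h2)
    have hδ : -(v.2 * c) + v.1 * d = 0 := by
      apply (mul_eq_zero.1 (?_ : (v.1 ^ 2 + v.2 ^ 2) * _ = 0)).resolve_left hN
      linear_combination v.2 * h + v.1 * ((v.1 ^ 2 + v.2 ^ 2) * h3 - v.1 * h1 - v.2 * h2)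
    have ha : a = 0 := by
      apply (mul_eq_zero.1 (?_ : (v.1 ^ 2 + v.2 ^ 2) * _ = 0)).resolve_left hN
      linear_combination v.1 * h1 - v.2 * hα
    have hb : b = 0 := by
      apply (mul_eq_zero.1 (?_ : (v.1 ^ 2 + v.2 ^ 2) * _ = 0)).resolve_left hN
      linear_combination v.2 * h1 + v.1 * hα
    have hc : c = 0 := by
      apply (mul_eq_zero.1 (?_ : (v.1 ^ 2 + v.2 ^ 2) * _ = 0)).resolve_left hN
      linear_combination v.1 * h2 - v.2 * hδ
    have hd : d = 0 := by linarith
    refine ContinuousLinearMap.ext fun w => ?_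
    rw [planar_map_apply _ w]
    ext
    · change w.1 * a + w.2 * b = 0
      rw [ha, hb]; ring
    · change w.1 * c + w.2 * d = 0
      rw [hc, hd]; ring
  obtain ⟨g1, g2⟩ := nilpotent_global_line (hc v) (hc n) htr' hdet' (0, 0) hx0 hy0 s
  have g3 := htr' (s, 0)
  have g4 := hdet' (s, 0)
  have hφs : φ (s, 0) = p + s • v := by simp [φ]
  simp only at g1 g2
  rw [g1, zero_add] at g3
  rw [g1, zero_mul, zero_sub, neg_eq_zero] at g4
  have g5 := (mul_eq_zero.1 g4).resolve_left g2
  rw [hd, hφs, hA1] at g1 g5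
  rw [hd, hφs, hA2] at g2
  refine ⟨fun h => g2 (by rw [h]; simp), ?_⟩
  generalize fderiv ℝ H (p + s • v) v = r at g1 g5
  simp [L, n] at g1 g5
  ext
  · apply (mul_eq_zero.1 (?_ : (v.1 ^ 2 + v.2 ^ 2) * _ = 0)).resolve_left hN
    linear_combination v.1 * g1 - v.2 * g5
  · apply (mul_eq_zero.1 (?_ : (v.1 ^ 2 + v.2 ^ 2) * _ = 0)).resolve_left hN
    linear_combination v.2 * g1 + v.1 * g5

/-- A nonzero planar linear map with vanishing trace and determinant has a nonzero kernel. -/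
lemma exists_kernel_of_nilpotent {D : (ℝ × ℝ) →L[ℝ] ℝ × ℝ} (htr : (D (1, 0)).1 + (D (0, 1)).2 = 0)
    (hdet : (D (1, 0)).1 * (D (0, 1)).2 - (D (0, 1)).1 * (D (1, 0)).2 = 0) (hD : D ≠ 0) :
    ∃ v, v ≠ 0 ∧ D v = 0 := by
  obtain ⟨w, hw⟩ := DFunLike.ne_iff.1 hD
  refine ⟨D w, hw, ?_⟩
  rw [planar_map_apply D (D w), planar_map_apply D w]
  ext
  · simp
    linear_combination (w.1 * (D (1, 0)).1 + w.2 * (D (0, 1)).1) * htr - w.1 * hdet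
  · simp
    linear_combination (w.1 * (D (1, 0)).2 + w.2 * (D (0, 1)).2) * htr - w.2 * hdet

/-- A `C¹` planar map with nilpotent Jacobian has a common kernel direction at all points. -/
lemma nilpotent_common_kernel {H : ℝ × ℝ → ℝ × ℝ} (hH : ContDiff ℝ 1 H)
    (htr : ∀ z, (fderiv ℝ H z (1, 0)).1 + (fderiv ℝ H z (0, 1)).2 = 0)
    (hdet : ∀ z, (fderiv ℝ H z (1, 0)).1 * (fderiv ℝ H z (0, 1)).2 -
      (fderiv ℝ H z (0, 1)).1 * (fderiv ℝ H z (1, 0)).2 = 0) :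
    ∃ v : ℝ × ℝ, v ≠ 0 ∧ ∀ q, fderiv ℝ H q v = 0 := by
  by_cases hall : ∀ p, fderiv ℝ H p = 0
  · exact ⟨(1, 0), by simp, fun q => by simp [hall q]⟩
  push Not at hall
  obtain ⟨p, hp⟩ := hall
  obtain ⟨v, hv, hpv⟩ := exists_kernel_of_nilpotent (htr p) (hdet p) hp
  refine ⟨v, hv, fun q => ?_⟩
  by_cases hq : fderiv ℝ H q = 0
  · simp [hq]
  obtain ⟨w, hw, hqw⟩ := exists_kernel_of_nilpotent (htr q) (hdet q) hq
  by_cases hΔ : v.1 * w.2 - v.2 * w.1 = 0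
  · have e : (w.1 ^ 2 + w.2 ^ 2) • v = (v.1 * w.1 + v.2 * w.2) • w := by
      ext
      · simp
        linear_combination w.2 * hΔ
      · simp
        linear_combination -w.1 * hΔ
    have := congrArg (fderiv ℝ H q) e
    rw [map_smul, map_smul, hqw, smul_zero] at this
    exact (smul_eq_zero.1 this).resolve_left (planar_normSq_ne_zero hw)
  -- two kernel lines in different directions would meet
  exfalso
  set Δ := v.1 * w.2 - v.2 * w.1
  have hmeet : p + (((q.1 - p.1) * w.2 - (q.2 - p.2) * w.1) / Δ) • v =
      q + (((q.1 - p.1) * v.2 - (q.2 - p.2) * v.1) / Δ) • w := by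
    ext
    · simp
      field_simp
      ring
    · simp
      field_simp
      ring
  obtain ⟨h1, h2⟩ := nilpotent_kernel_line hH htr hdet hp hv hpv
    (((q.1 - p.1) * w.2 - (q.2 - p.2) * w.1) / Δ)
  obtain ⟨-, h3⟩ := nilpotent_kernel_line hH htr hdet hq hw hqw
    (((q.1 - p.1) * v.2 - (q.2 - p.2) * v.1) / Δ)
  rw [← hmeet] at h3
  apply h1
  refine ContinuousLinearMap.ext fun e => ?_
  have he : Δ • e = (e.1 * w.2 - e.2 * w.1) • v + (v.1 * e.2 - v.2 * e.1) • w := by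
    ext
    · simp [Δ]
      ring
    · simp [Δ]
      ring
  have := congrArg
    (fderiv ℝ H (p + (((q.1 - p.1) * w.2 - (q.2 - p.2) * w.1) / Δ) • v)) he
  rw [map_smul, map_add, map_smul, map_smul, h2, h3, smul_zero, smul_zero, add_zero] at this
  exact (smul_eq_zero.1 this).resolve_left hΔ

/-- A `C¹` planar map with nilpotent Jacobian that vanishes at the origin is invariant under
translation by its own values. -/
lemma nilpotent_apply_add_smul {H : ℝ × ℝ → ℝ × ℝ} (hH : ContDiff ℝ 1 H)
    (htr : ∀ z, (fderiv ℝ H z (1, 0)).1 + (fderiv ℝ H z (0, 1)).2 = 0)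
    (hdet : ∀ z, (fderiv ℝ H z (1, 0)).1 * (fderiv ℝ H z (0, 1)).2 -
      (fderiv ℝ H z (0, 1)).1 * (fderiv ℝ H z (1, 0)).2 = 0)
    (h0 : H 0 = 0) (z : ℝ × ℝ) (s : ℝ) : H (z + s • H z) = H z := by
  obtain ⟨v, hv, hker⟩ := nilpotent_common_kernel hH htr hdet
  have hdiff := hH.differentiable one_ne_zero
  have hinv : ∀ t : ℝ, H (z + t • v) = H z := by
    have hd : ∀ t : ℝ, HasDerivAt (fun t : ℝ => H (z + t • v)) 0 t := by
      intro t
      have := (hdiff (z + t • v)).hasFDerivAt.comp_hasDerivAt t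
        (((hasDerivAt_id t).smul_const v).const_add z)
      simpa [Function.comp_def, hker] using this
    intro t
    simpa using is_const_of_deriv_eq_zero (fun t => (hd t).differentiableAt)
      (fun t => (hd t).deriv) t 0
  let L : (ℝ × ℝ) →L[ℝ] ℝ :=
    v.1 • ContinuousLinearMap.snd ℝ ℝ ℝ - v.2 • ContinuousLinearMap.fst ℝ ℝ ℝ
  have hL : ∀ y, HasFDerivAt (fun y => L (H y)) (0 : (ℝ × ℝ) →L[ℝ] ℝ) y := by
    intro y
    have := L.hasFDerivAt.comp y (hdiff y).hasFDerivAt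
    convert! this using 1
    refine ContinuousLinearMap.ext fun w => ?_
    have hk := hker y
    rw [planar_map_apply _ v] at hk
    have h1 := congrArg Prod.fst hk
    have h2 := congrArg Prod.snd hk
    have h3 := htr y
    rw [ContinuousLinearMap.comp_apply, planar_map_apply _ w]
    simp [L] at h1 h2 ⊢
    linear_combination -w.1 * h2 + w.1 * v.2 * h3 + w.2 * h1 - w.2 * v.1 * h3
  have hLz : L (H z) = 0 := by
    rw [is_const_of_fderiv_eq_zero (fun y => (hL y).differentiableAt) (fun y => (hL y).fderiv) z 0,
      h0, map_zero]
  have hN := planar_normSq_ne_zero hv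
  have hHz : H z = ((v.1 * (H z).1 + v.2 * (H z).2) / (v.1 ^ 2 + v.2 ^ 2)) • v := by
    simp [L] at hLz
    ext
    · simp
      field_simp
      linear_combination -v.2 * hLz
    · simp
      field_simp
      linear_combination v.1 * hLz
  have := hinv (s * ((v.1 * (H z).1 + v.2 * (H z).2) / (v.1 ^ 2 + v.2 ^ 2)))
  rwa [mul_smul, ← hHz] at this

/-- for a nonlinear `C¹` unipotent map fixing the origin, every point is
either fixed or has forward orbit diverging to infinity in norm. -/
theorem statement6 (G : ℝ × ℝ → ℝ × ℝ) (hG : ContDiff ℝ 1 G) (hU : Unipotent G)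
    (hNL : NonlinearMap G) (h0 : G (0, 0) = (0, 0)) :
    ∀ z : ℝ × ℝ, G z = z ∨ Tendsto (fun n : ℕ => ‖G^[n] z‖) atTop atTop := by
  have hdiff := hG.differentiable one_ne_zero
  have hd : ∀ z, fderiv ℝ (fun z => G z - z) z = fderiv ℝ G z - ContinuousLinearMap.id ℝ _ :=
    fun z => ((hdiff z).hasFDerivAt.sub (hasFDerivAt_id z)).fderiv
  have hinv := nilpotent_apply_add_smul (H := fun z => G z - z) (hG.sub contDiff_id)
    (fun z => by
      rw [hd]
      simp
      linear_combination (hU z).1)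
    (fun z => by
      rw [hd]
      simp
      linear_combination (hU z).2 - (hU z).1)
    (sub_eq_zero.2 h0)
  intro z
  by_cases hz : G z - z = 0
  · exact Or.inl (sub_eq_zero.1 hz)
  right
  have hiter : ∀ n : ℕ, G^[n] z = z + (n : ℝ) • (G z - z) := by
    intro n
    induction n with
    | zero => simp
    | succ n ih =>
      rw [Function.iterate_succ_apply', ih, sub_eq_iff_eq_add.1 (hinv z n)]
      push_cast
      module
  have hlim : Tendsto (fun n : ℕ => (n : ℝ) * ‖G z - z‖ - ‖z‖) atTop atTop :=
    tendsto_atTop_add_const_right _ _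
      (tendsto_natCast_atTop_atTop.atTop_mul_const (norm_pos_iff.2 hz))
  refine tendsto_atTop_mono (fun n => ?_) hlim
  rw [hiter n]
  have h1 := norm_sub_le (z + (n : ℝ) • (G z - z)) z
  rw [add_sub_cancel_left, norm_smul, Real.norm_natCast] at h1
  linarith
end

section
/- Let ψ : ℝ → ℝ be continuous and define G : ℝ² → ℝ² by G(x,y) = (x + ψ(y), y). Let I be a connected component of {y ∈ ℝ : ψ(y) ≠ 0}, and let z, w ∈ ℝ × I. Then the compact segment Λ = {t·z + (1−t)·w : 0 ≤ t ≤ 1} (which is contained in ℝ × I) escapes every compact set in both time directions: for every compact set K ⊆ ℝ² there exists a natural number N such that for all n ≥ N, G^n(Λ) ∩ K = ∅ and Λ ∩ G^n(K) = ∅. -/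
open Filter Topology

theorem iterate_shear {ψ : ℝ → ℝ} {G : ℝ × ℝ → ℝ × ℝ}
    (hG : ∀ x y : ℝ, G (x, y) = (x + ψ y, y)) (n : ℕ) (p : ℝ × ℝ) :
    G^[n] p = (p.1 + n * ψ p.2, p.2) := by
  induction n with
  | zero => simp
  | succ n ih =>
    rw [Function.iterate_succ_apply', ih, hG]
    push_cast
    ext <;> simp
    ring

/-- A compact set on which the displacement of the shear does not vanish is eventually
separated from any compact set by the displacement, in either direction. -/
theorem exists_forall_shear_displacement_lt {ψ : ℝ → ℝ} (hψ : Continuous ψ)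
    {S K : Set (ℝ × ℝ)} (hS : IsCompact S) (hK : IsCompact K)
    (hψS : ∀ p ∈ S, ψ p.2 ≠ 0) :
    ∃ N : ℕ, ∀ n : ℕ, N ≤ n → ∀ p ∈ S, ∀ q ∈ K, |q.1 - p.1| < n * |ψ p.2| := by
  obtain ⟨c, hc, hcS⟩ : ∃ c > 0, ∀ p ∈ S, c ≤ |ψ p.2| :=
    hS.exists_forall_le' (f := fun p : ℝ × ℝ => |ψ p.2|) (by fun_prop)
      fun p hp => abs_pos.mpr (hψS p hp)
  obtain ⟨A, hA⟩ := hS.exists_bound_of_continuousOn (f := Prod.fst) continuous_fst.continuousOn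
  obtain ⟨B, hB⟩ := hK.exists_bound_of_continuousOn (f := Prod.fst) continuous_fst.continuousOn
  obtain ⟨N, hN⟩ := exists_nat_gt ((A + B) / c)
  refine ⟨N, fun n hn p hp q hq => ?_⟩
  rw [div_lt_iff₀ hc] at hN
  have hp' : |p.1| ≤ A := hA p hp
  have hq' : |q.1| ≤ B := hB q hq
  calc |q.1 - p.1| ≤ |q.1| + |p.1| := abs_sub _ _
    _ ≤ A + B := by linarith
    _ < N * c := hN
    _ ≤ n * |ψ p.2| := by gcongr; exact hcS p hp

/-- for the shear `G (x,y) = (x + ψ y, y)` and a connected component `I`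
of `{ψ ≠ 0}`, every segment joining two points of `ℝ × I` lies in `ℝ × I` and
escapes every compact set in both time directions. -/
theorem statement7 (ψ : ℝ → ℝ) (hψ : Continuous ψ)
    (G : ℝ × ℝ → ℝ × ℝ) (hG : ∀ x y : ℝ, G (x, y) = (x + ψ y, y))
    (I : Set ℝ) (y₀ : ℝ) (hy₀ : ψ y₀ ≠ 0)
    (hI : I = connectedComponentIn {y : ℝ | ψ y ≠ 0} y₀)
    (z w : ℝ × ℝ) (hz : z.2 ∈ I) (hw : w.2 ∈ I) :
    segment ℝ z w ⊆ Set.univ ×ˢ I ∧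
    ∀ K : Set (ℝ × ℝ), IsCompact K → ∃ N : ℕ, ∀ n : ℕ, N ≤ n →
      (G^[n] '' segment ℝ z w) ∩ K = ∅ ∧ segment ℝ z w ∩ (G^[n] '' K) = ∅ := by
  have hIconv : Convex ℝ I := by
    rw [hI]
    exact isPreconnected_connectedComponentIn.ordConnected.convex
  have hsub : segment ℝ z w ⊆ Set.univ ×ˢ I :=
    (convex_univ.prod hIconv).segment_subset ⟨trivial, hz⟩ ⟨trivial, hw⟩
  have hne : ∀ p ∈ segment ℝ z w, ψ p.2 ≠ 0 := fun p hp =>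
    connectedComponentIn_subset _ _ (hI ▸ (hsub hp).2)
  have hcomp : IsCompact (segment ℝ z w) := by
    rw [segment_eq_image_lineMap]
    exact isCompact_Icc.image AffineMap.lineMap_continuous
  refine ⟨hsub, fun K hK => ?_⟩
  obtain ⟨N, hN⟩ := exists_forall_shear_displacement_lt hψ hcomp hK hne
  refine ⟨N, fun n hn => ⟨?_, ?_⟩⟩
  · rw [Set.eq_empty_iff_forall_notMem]
    rintro _ ⟨⟨p, hp, rfl⟩, hq⟩
    have h := hN n hn p hp _ hq
    simp [iterate_shear hG, abs_mul] at h
  · rw [Set.eq_empty_iff_forall_notMem]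
    rintro _ ⟨hp, ⟨q, hq, rfl⟩⟩
    have h := hN n hn _ hp q hq
    simp [iterate_shear hG, abs_mul] at h
end

section
/- Let G : ℝ² → ℝ² be a continuously differentiable unipotent map with G(0,0) = (0,0). Let D ⊆ ℝ² be a topological disk, i.e. a subset homeomorphic to the closed unit disk {z ∈ ℝ² : ‖z‖ ≤ 1}. If G(D) ∩ D = ∅, then for all natural numbers p ≠ q, G^p(D) ∩ G^q(D) = ∅. -/
open Filter Topology

lemma exists_continuous_exp_eq {X : Type*} [TopologicalSpace X] [SimplyConnectedSpace X]
    [LocallyPathConnectedSpace X] {f : X → ℂ} (hf : Continuous f) (hf0 : ∀ x, f x ≠ 0) (x₀ : X)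
    {e₀ : ℂ} (he₀ : Complex.exp e₀ = f x₀) :
    ∃ F : X → ℂ, Continuous F ∧ F x₀ = e₀ ∧ ∀ x, Complex.exp (F x) = f x := by
  obtain ⟨F, ⟨h₁, h₂⟩, -⟩ := Complex.isCoveringMapOn_exp.existsUnique_continuousMap_lifts
    ⟨f, hf⟩ he₀ hf0
  exact ⟨F, F.continuous, h₁, fun x => congrFun h₂ x⟩

lemma mem_Icc_zero_pi_of_sin_nonneg {X : Type*} [TopologicalSpace X] [PreconnectedSpace X]
    {h : X → ℝ} (hh : Continuous h) (hsin : ∀ x, 0 ≤ Real.sin (h x)) {x₀ : X}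
    (hx₀ : h x₀ ∈ Set.Icc 0 Real.pi) (x : X) : h x ∈ Set.Icc 0 Real.pi := by
  have hpi := Real.pi_pos
  have hivt : ∀ c, (h x₀ ≤ c ∧ c ≤ h x) ∨ (h x ≤ c ∧ c ≤ h x₀) → 0 ≤ Real.sin c := by
    rintro c (hc | hc)
    · obtain ⟨y, rfl⟩ := mem_range_of_exists_le_of_exists_ge hh ⟨x₀, hc.1⟩ ⟨x, hc.2⟩
      exact hsin y
    · obtain ⟨y, rfl⟩ := mem_range_of_exists_le_of_exists_ge hh ⟨x, hc.1⟩ ⟨x₀, hc.2⟩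
      exact hsin y
  constructor
  · by_contra! hx
    have h1 := hivt (max (h x) (-(Real.pi / 2)))
      (Or.inr ⟨le_max_left _ _, max_le (by linarith [hx₀.1]) (by linarith [hx₀.1])⟩)
    have h2 : Real.sin (max (h x) (-(Real.pi / 2))) < 0 :=
      Real.sin_neg_of_neg_of_neg_pi_lt (max_lt hx (by linarith))
        (lt_of_lt_of_le (by linarith) (le_max_right _ _))
    linarith
  · by_contra! hx
    have h1 := hivt (min (h x) (3 * Real.pi / 2))
      (Or.inl ⟨le_min (by linarith [hx₀.2]) (by linarith [hx₀.2]), min_le_left _ _⟩)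
    have h2 : 0 < Real.sin (min (h x) (3 * Real.pi / 2) - Real.pi) :=
      Real.sin_pos_of_pos_of_lt_pi (by rw [sub_pos]; exact lt_min hx (by linarith))
        (by linarith [min_le_right (h x) (3 * Real.pi / 2)])
    rw [Real.sin_sub_pi] at h2
    linarith

lemma sin_im_nonneg_of_exp {z w : ℂ} (h : Complex.exp z = w) (hw : 0 ≤ w.im) :
    0 ≤ Real.sin z.im := by
  rw [← h, Complex.exp_im] at hw
  exact nonneg_of_mul_nonneg_right hw (Real.exp_pos _)

lemma sin_im_nonpos_of_exp {z w : ℂ} (h : Complex.exp z = w) (hw : w.im ≤ 0) :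
    Real.sin z.im ≤ 0 := by
  rw [← h, Complex.exp_im] at hw
  exact nonpos_of_mul_nonpos_right hw (Real.exp_pos _)

/-- The set of real numbers that are not horizontal chords of a curve is closed under addition. -/
lemma sub_ne_add_of_sub_ne {E : Type*} [TopologicalSpace E] [SimplyConnectedSpace E]
    [LocallyPathConnectedSpace E] [SimplyConnectedSpace (E × E)]
    {γ : E → ℂ} (hγ : Continuous γ) {t₀ t₁ : E}
    (h₀ : ∀ t, (γ t₀).im ≤ (γ t).im) (h₁ : ∀ t, (γ t).im ≤ (γ t₁).im) {a b : ℝ}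
    (ha : 0 < a) (hb : 0 < b) (hac : ∀ s t, γ t - γ s ≠ a) (hbc : ∀ s t, γ t - γ s ≠ b)
    (s t : E) : γ t - γ s ≠ a + b := by
  intro hst
  have hpi := Real.pi_pos
  obtain ⟨F, hFc, hF0, hF⟩ := exists_continuous_exp_eq
    (f := fun q : E × E => γ q.1 + a - γ q.2) (by fun_prop)
    (fun q hq => hac q.1 q.2 (by linear_combination -hq)) (t₀, t₀) (e₀ := Real.log a)
    (by rw [← Complex.ofReal_exp, Real.exp_log ha]; ring)
  obtain ⟨H, hHc, hH0, hH⟩ := exists_continuous_exp_eq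
    (f := fun q : E × E => γ q.1 - b - γ q.2) (by fun_prop)
    (fun q hq => hbc q.2 q.1 (by linear_combination hq)) (t₀, t₀)
    (e₀ := Real.log b + Real.pi * Complex.I)
    (by rw [Complex.exp_add, ← Complex.ofReal_exp, Real.exp_log hb, Complex.exp_pi_mul_I]; ring)
  have hF0' : (F (t₀, t₀)).im = 0 := by simp [hF0]
  have hH0' : (H (t₀, t₀)).im = Real.pi := by simp [hH0]
  have hFd : (F (t₁, t₁)).im = 0 := by
    have e1 := mem_Icc_zero_pi_of_sin_nonneg (h := fun t => (F (t, t)).im) (by fun_prop)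
      (fun t => sin_im_nonneg_of_exp (hF _) (by simp)) (x₀ := t₀) (by simp [hF0', hpi.le]) t₁
    have e2 := mem_Icc_zero_pi_of_sin_nonneg (h := fun t => -(F (t, t)).im) (by fun_prop)
      (fun t => by
        rw [Real.sin_neg]
        exact neg_nonneg.2 (sin_im_nonpos_of_exp (hF _) (by simp)))
      (x₀ := t₀) (by simp [hF0', hpi.le]) t₁
    linarith [e1.1, e2.1]
  have hHd : (H (t₁, t₁)).im = Real.pi := by
    have e1 := mem_Icc_zero_pi_of_sin_nonneg (h := fun t => (H (t, t)).im) (by fun_prop)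
      (fun t => sin_im_nonneg_of_exp (hH _) (by simp)) (x₀ := t₀) (by simp [hH0', hpi.le]) t₁
    have e2 := mem_Icc_zero_pi_of_sin_nonneg (h := fun t => 2 * Real.pi - (H (t, t)).im)
      (by fun_prop)
      (fun t => by
        rw [Real.sin_two_pi_sub]
        exact neg_nonneg.2 (sin_im_nonpos_of_exp (hH _) (by simp)))
      (x₀ := t₀) (by simp only [hH0']; constructor <;> linarith) t₁
    linarith [e1.2, e2.2]
  have hFl : (F (s, t₀)).im ∈ Set.Icc 0 Real.pi :=
    mem_Icc_zero_pi_of_sin_nonneg (h := fun t => (F (t, t₀)).im) (by fun_prop)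
      (fun t => sin_im_nonneg_of_exp (hF _) (by simpa using h₀ t)) (x₀ := t₀)
      (by simp [hF0', hpi.le]) s
  have hFu : -(F (s, t₁)).im ∈ Set.Icc 0 Real.pi :=
    mem_Icc_zero_pi_of_sin_nonneg (h := fun t => -(F (t, t₁)).im) (by fun_prop)
      (fun t => by
        rw [Real.sin_neg]
        exact neg_nonneg.2 (sin_im_nonpos_of_exp (hF _) (by simpa using h₁ t)))
      (x₀ := t₁) (by simp [hFd, hpi.le]) s
  have hHl : (H (t, t₀)).im ∈ Set.Icc 0 Real.pi :=
    mem_Icc_zero_pi_of_sin_nonneg (h := fun t => (H (t, t₀)).im) (by fun_prop)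
      (fun t => sin_im_nonneg_of_exp (hH _) (by simpa using h₀ t)) (x₀ := t₀)
      (by simp [hH0', hpi.le]) t
  have hHu : 2 * Real.pi - (H (t, t₁)).im ∈ Set.Icc 0 Real.pi :=
    mem_Icc_zero_pi_of_sin_nonneg (h := fun t => 2 * Real.pi - (H (t, t₁)).im) (by fun_prop)
      (fun t => by
        rw [Real.sin_two_pi_sub]
        exact neg_nonneg.2 (sin_im_nonpos_of_exp (hH _) (by simpa using h₁ t)))
      (x₀ := t₁) (by simp only [hHd]; constructor <;> linarith) t
  have hexp : ∀ r, Complex.exp (F (s, r) - H (t, r)) = 1 := by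
    intro r
    have : Complex.exp (F (s, r)) = Complex.exp (H (t, r)) := by
      rw [hF, hH]
      linear_combination -hst
    rw [Complex.exp_sub, this, div_self (Complex.exp_ne_zero _)]
  have hdl : (F (s, t₀) - H (t, t₀)).im = 0 := by
    obtain ⟨n, hn⟩ := Complex.exp_eq_one_iff.1 (hexp t₀)
    have him : (F (s, t₀) - H (t, t₀)).im = n * (2 * Real.pi) := by rw [hn]; simp
    have him' := him
    rw [Complex.sub_im] at him'
    have hn0 : n = 0 := by
      have l1 : (n : ℝ) < 1 := by nlinarith [hFl.2, hHl.1]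
      have l2 : (-1 : ℝ) < n := by nlinarith [hFl.1, hHl.2]
      have l1' : n < 1 := by exact_mod_cast l1
      have l2' : -1 < n := by exact_mod_cast l2
      omega
    rw [him, hn0]; simp
  have hdu := mem_Icc_zero_pi_of_sin_nonneg (h := fun r => -(F (s, r) - H (t, r)).im)
    (by fun_prop) (fun r => by
      rw [Real.sin_neg]
      exact neg_nonneg.2 (sin_im_nonpos_of_exp (hexp r) (by simp)))
    (x₀ := t₀) (by simp only [hdl]; constructor <;> linarith) t₁
  have hdu' := mem_Icc_zero_pi_of_sin_nonneg (h := fun r => (F (s, r) - H (t, r)).im)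
    (by fun_prop) (fun r => sin_im_nonneg_of_exp (hexp r) (by simp))
    (x₀ := t₀) (by simp only [hdl]; constructor <;> linarith) t₁
  simp only [Complex.sub_im] at hdu hdu'
  linarith [hFu.1, hHu.1, hHu.2, hdu.1, hdu'.1]

lemma natCast_succ_ne_sub {E : Type*} [TopologicalSpace E] [SimplyConnectedSpace E]
    [LocallyPathConnectedSpace E] [SimplyConnectedSpace (E × E)]
    {γ : E → ℂ} (hγ : Continuous γ) {t₀ t₁ : E}
    (h₀ : ∀ t, (γ t₀).im ≤ (γ t).im) (h₁ : ∀ t, (γ t).im ≤ (γ t₁).im)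
    (hc : ∀ s t, γ t - γ s ≠ 1) (n : ℕ) (s t : E) : γ t - γ s ≠ n + 1 := by
  induction n generalizing s t with
  | zero => simpa using hc s t
  | succ n ih =>
    have := sub_ne_add_of_sub_ne hγ h₀ h₁ (a := n + 1) (b := 1) (by positivity) one_pos
      (by simpa using ih) (by simpa using hc) s t
    simpa using this

lemma partial_deriv_affine {Y V Yx Yw : ℝ → ℝ → ℝ} {x₀ w₀ δ : ℝ} (hδ : 0 < δ)
    (hYx : ∀ x w, |x - x₀| < δ → |w - w₀| < δ → HasDerivAt (fun x => Y x w) (Yx x w) x)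
    (hYw : ∀ x w, |x - x₀| < δ → |w - w₀| < δ → HasDerivAt (fun w => Y x w) (Yw x w) w)
    (hVx : ∀ x w, |x - x₀| < δ → |w - w₀| < δ → HasDerivAt (fun x => V x w) 0 x)
    (hVw : ∀ x w, |x - x₀| < δ → |w - w₀| < δ → HasDerivAt (fun w => V x w) (Yx x w) w) :
    ∃ α β : ℝ, ∀ x, |x - x₀| < δ → Yw x w₀ = α + β * (x - x₀) ∧
      Yx x w₀ = Yx x₀ w₀ ∧ Y x w₀ = Y x₀ w₀ + (x - x₀) * Yx x₀ w₀ := by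
  have hconst : ∀ f : ℝ → ℝ, (∀ x, |x - x₀| < δ → HasDerivAt f 0 x) →
      ∀ x, |x - x₀| < δ → f x = f x₀ := by
    intro f hf x hx
    have hball : ∀ y, y ∈ Metric.ball x₀ δ → HasDerivAt f 0 y := fun y hy =>
      hf y (by rwa [Metric.mem_ball, Real.dist_eq] at hy)
    exact Metric.isOpen_ball.is_const_of_deriv_eq_zero (convex_ball x₀ δ).isPreconnected
      (fun y hy => (hball y hy).differentiableAt.differentiableWithinAt)
      (fun y hy => (hball y hy).deriv) (by rwa [Metric.mem_ball, Real.dist_eq])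
      (Metric.mem_ball_self hδ)
  have h00 : |x₀ - x₀| < δ := by simpa using hδ
  have hnear : ∀ w, |w - w₀| < δ → ∀ᶠ w' in 𝓝 w, |w' - w₀| < δ := fun w hw =>
    (isOpen_lt (by fun_prop) continuous_const).mem_nhds hw
  have hV : ∀ x w, |x - x₀| < δ → |w - w₀| < δ → V x w = V x₀ w := fun x w hx hw =>
    hconst (fun x => V x w) (fun x hx => hVx x w hx hw) x hx
  have hYx' : ∀ x w, |x - x₀| < δ → |w - w₀| < δ → Yx x w = Yx x₀ w := by
    intro x w hx hw
    refine (hVw x w hx hw).unique ((hVw x₀ w h00 hw).congr_of_eventuallyEq ?_)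
    filter_upwards [hnear w hw] with w' hw' using hV x w' hx hw'
  have hY : ∀ x w, |x - x₀| < δ → |w - w₀| < δ → Y x w = Y x₀ w + (x - x₀) * Yx x₀ w := by
    intro x w hx hw
    have := hconst (fun x => Y x w - (x - x₀) * Yx x₀ w) (fun x hx => by
      have h1 := hYx x w hx hw
      rw [hYx' x w hx hw] at h1
      have h2 := h1.sub (((hasDerivAt_id x).sub_const x₀).mul_const (Yx x₀ w))
      rwa [one_mul, sub_self] at h2) x hx
    simp only [sub_self, zero_mul, sub_zero] at this
    linarith
  have hw0 : |w₀ - w₀| < δ := by simpa using hδ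
  have h1 : |x₀ + δ / 2 - x₀| < δ := by
    rw [add_sub_cancel_left, abs_of_pos (by positivity)]; linarith
  refine ⟨Yw x₀ w₀, (Yw (x₀ + δ / 2) w₀ - Yw x₀ w₀) / (δ / 2), fun x hx =>
    ⟨?_, hYx' x w₀ hx hw0, hY x w₀ hx hw0⟩⟩
  have hd := (hYw x₀ w₀ h00 hw0).add ((((hYw (x₀ + δ / 2) w₀ h1 hw0).sub
    (hYw x₀ w₀ h00 hw0)).div_const (δ / 2)).mul_const (x - x₀))
  refine (hYw x w₀ hx hw0).unique (hd.congr_of_eventuallyEq ?_)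
  filter_upwards [hnear w₀ hw0] with w hw
  simp only [Pi.add_apply, Pi.sub_apply]
  rw [hY x w hx hw, hY (x₀ + δ / 2) w h1 hw]
  field_simp
  ring

lemma clm_apply_prod (A : ℝ × ℝ →L[ℝ] ℝ) (z : ℝ × ℝ) :
    A z = z.1 * A (1, 0) + z.2 * A (0, 1) := by
  conv_lhs => rw [show z = z.1 • ((1 : ℝ), (0 : ℝ)) + z.2 • ((0 : ℝ), (1 : ℝ)) by ext <;> simp]
  rw [map_add, map_smul, map_smul, smul_eq_mul, smul_eq_mul]

lemma exists_local_affine {u v : ℝ × ℝ → ℝ} (hu : ContDiff ℝ 1 u) (hv : ContDiff ℝ 1 v)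
    (htr : ∀ z, fderiv ℝ u z (1, 0) + fderiv ℝ v z (0, 1) = 0)
    (hdet : ∀ z, fderiv ℝ u z (1, 0) * fderiv ℝ v z (0, 1) =
      fderiv ℝ u z (0, 1) * fderiv ℝ v z (1, 0))
    {p : ℝ × ℝ} (hp : fderiv ℝ u p (0, 1) ≠ 0) {s : ℝ}
    (hs : fderiv ℝ u p (1, 0) + s * fderiv ℝ u p (0, 1) = 0) :
    ∃ r > 0, ∃ α β : ℝ, ∀ t, |t| < r →
      fderiv ℝ u (p + t • (1, s)) (1, 0) + s * fderiv ℝ u (p + t • (1, s)) (0, 1) = 0 ∧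
      fderiv ℝ u (p + t • (1, s)) (0, 1) * (α + β * t) = 1 := by
  have hud : ∀ z, HasFDerivAt u (fderiv ℝ u z) z := fun z =>
    (hu.differentiable one_ne_zero z).hasFDerivAt
  have hvd : ∀ z, HasFDerivAt v (fderiv ℝ v z) z := fun z =>
    (hv.differentiable one_ne_zero z).hasFDerivAt
  set Φ : ℝ × ℝ → ℝ × ℝ := fun z => (z.1, u z) with hΦ
  have hΦc : ContDiff ℝ 1 Φ := contDiff_fst.prodMk hu
  have hΦd : ∀ z, HasFDerivAt Φ ((ContinuousLinearMap.fst ℝ ℝ ℝ).prod (fderiv ℝ u z)) z :=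
    fun z => hasFDerivAt_fst.prodMk (hud z)
  obtain ⟨A, hA⟩ : ∃ A : (ℝ × ℝ) ≃L[ℝ] ℝ × ℝ,
      (A : ℝ × ℝ →L[ℝ] ℝ × ℝ) = (ContinuousLinearMap.fst ℝ ℝ ℝ).prod (fderiv ℝ u p) := by
    refine ⟨(LinearEquiv.ofInjectiveEndo
      (((ContinuousLinearMap.fst ℝ ℝ ℝ).prod (fderiv ℝ u p) : ℝ × ℝ →L[ℝ] ℝ × ℝ) :
        ℝ × ℝ →ₗ[ℝ] ℝ × ℝ) ?_).toContinuousLinearEquiv, ?_⟩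
    · rw [← LinearMap.ker_eq_bot, LinearMap.ker_eq_bot']
      intro z hz
      have h1 : z.1 = 0 := congrArg Prod.fst hz
      have h2 : fderiv ℝ u p z = 0 := congrArg Prod.snd hz
      rw [clm_apply_prod, h1] at h2
      have h3 : z.2 = 0 := by simpa [hp] using h2
      exact Prod.ext h1 h3
    · ext <;> rfl
  have hΦp : HasFDerivAt Φ (A : ℝ × ℝ →L[ℝ] ℝ × ℝ) p := by rw [hA]; exact hΦd p
  set Ψ := hΦc.contDiffAt.localInverse hΦp one_ne_zero with hΨ
  have hΨp : Ψ (Φ p) = p := hΦc.contDiffAt.localInverse_apply_image hΦp one_ne_zero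
  have hΨc : ContDiffAt ℝ 1 Ψ (Φ p) := hΦc.contDiffAt.to_localInverse hΦp one_ne_zero
  have hinv : ∀ᶠ q in 𝓝 (Φ p), Φ (Ψ q) = q :=
    (hΦc.contDiffAt.hasStrictFDerivAt' hΦp one_ne_zero).eventually_right_inverse
  have hcu : Continuous fun z => fderiv ℝ u z (0, 1) :=
    (hu.continuous_fderiv one_ne_zero).clm_apply continuous_const
  have hne : ∀ᶠ q in 𝓝 (Φ p), fderiv ℝ u (Ψ q) (0, 1) ≠ 0 := by
    have h1 : ContinuousAt (fun q => fderiv ℝ u (Ψ q) (0, 1)) (Φ p) :=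
      hcu.continuousAt.comp hΨc.continuousAt
    exact h1.eventually_ne (by rwa [hΨp])
  obtain ⟨δ, hδ, hball⟩ := Metric.eventually_nhds_iff.1
    (hinv.eventually_nhds.and (hne.and (hΨc.eventually (by simp))))
  have hbox : ∀ x w, |x - p.1| < δ → |w - u p| < δ → dist (x, w) (Φ p) < δ := by
    intro x w hx hw
    rw [Prod.dist_eq]
    exact max_lt (by simpa [Real.dist_eq, hΦ] using hx) (by simpa [Real.dist_eq, hΦ] using hw)
  have hdΨ : ∀ q, dist q (Φ p) < δ → HasFDerivAt Ψ (fderiv ℝ Ψ q) q := fun q hq =>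
    ((hball hq).2.2.differentiableAt one_ne_zero).hasFDerivAt
  have hid : ∀ q, dist q (Φ p) < δ → ∀ e, (fderiv ℝ Ψ q e).1 = e.1 ∧
      fderiv ℝ u (Ψ q) (fderiv ℝ Ψ q e) = e.2 := by
    intro q hq e
    have h1 := (hΦd (Ψ q)).comp q (hdΨ q hq)
    have h2 := h1.unique ((hasFDerivAt_id q).congr_of_eventuallyEq (hball hq).1)
    have h3 : ((ContinuousLinearMap.fst ℝ ℝ ℝ).prod (fderiv ℝ u (Ψ q))) (fderiv ℝ Ψ q e) = e :=
      congrArg (fun L : ℝ × ℝ →L[ℝ] ℝ × ℝ => L e) h2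
    exact Prod.ext_iff.1 h3
  have hX : ∀ (x w : ℝ), HasDerivAt (fun x : ℝ => (x, w)) ((1 : ℝ), (0 : ℝ)) x := fun x w =>
    (hasDerivAt_id x).prodMk (hasDerivAt_const x w)
  have hW : ∀ (x w : ℝ), HasDerivAt (fun w : ℝ => (x, w)) ((0 : ℝ), (1 : ℝ)) w := fun x w =>
    (hasDerivAt_const w x).prodMk (hasDerivAt_id w)
  have hrel : ∀ q, dist q (Φ p) < δ →
      fderiv ℝ u (Ψ q) (1, 0) + (fderiv ℝ Ψ q (1, 0)).2 * fderiv ℝ u (Ψ q) (0, 1) = 0 ∧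
      (fderiv ℝ Ψ q (0, 1)).2 * fderiv ℝ u (Ψ q) (0, 1) = 1 := by
    intro q hq
    have h1 := hid q hq (1, 0)
    have h2 := hid q hq (0, 1)
    rw [clm_apply_prod (fderiv ℝ u (Ψ q)), h1.1] at h1
    rw [clm_apply_prod (fderiv ℝ u (Ψ q)), h2.1] at h2
    simp only [one_mul, zero_mul, zero_add] at h1 h2
    exact ⟨h1.2, h2.2⟩
  obtain ⟨α, β, haff⟩ := partial_deriv_affine (Y := fun x w => (Ψ (x, w)).2)
    (V := fun x w => v (Ψ (x, w))) (Yx := fun x w => (fderiv ℝ Ψ (x, w) (1, 0)).2)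
    (Yw := fun x w => (fderiv ℝ Ψ (x, w) (0, 1)).2) (x₀ := p.1) (w₀ := u p) hδ
    (fun x w hx hw =>
      HasFDerivAt.comp_hasDerivAt (f := fun x : ℝ => (x, w)) x (hdΨ _ (hbox x w hx hw)).snd
        (hX x w))
    (fun x w hx hw =>
      HasFDerivAt.comp_hasDerivAt (f := fun w : ℝ => (x, w)) w (hdΨ _ (hbox x w hx hw)).snd
        (hW x w))
    (fun x w hx hw => by
      have hq := hbox x w hx hw
      have h1 := ((hvd _).comp _ (hdΨ _ hq)).comp_hasDerivAt x (hX x w)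
      convert! h1 using 1
      rw [ContinuousLinearMap.comp_apply, clm_apply_prod (fderiv ℝ v _), (hid _ hq _).1]
      apply mul_left_cancel₀ (hball hq).2.1
      linear_combination fderiv ℝ v (Ψ (x, w)) (0, 1) * (-(hrel _ hq).1) + hdet (Ψ (x, w)))
    (fun x w hx hw => by
      have hq := hbox x w hx hw
      have h1 := ((hvd _).comp _ (hdΨ _ hq)).comp_hasDerivAt w (hW x w)
      convert! h1 using 1
      rw [ContinuousLinearMap.comp_apply, clm_apply_prod (fderiv ℝ v _), (hid _ hq _).1]
      linear_combination (-(fderiv ℝ Ψ (x, w) (1, 0)).2) * (hrel _ hq).2 +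
        (fderiv ℝ Ψ (x, w) (0, 1)).2 * (hrel _ hq).1 -
        (fderiv ℝ Ψ (x, w) (0, 1)).2 * htr (Ψ (x, w)))
  have hup : |u p - u p| < δ := by simpa using hδ
  have hse : (fderiv ℝ Ψ (p.1, u p) (1, 0)).2 = s := by
    have h1 := (hrel (p.1, u p) (hbox _ _ (by simpa using hδ) hup)).1
    change fderiv ℝ u (Ψ (Φ p)) _ + _ * fderiv ℝ u (Ψ (Φ p)) _ = 0 at h1
    rw [hΨp] at h1
    apply mul_right_cancel₀ hp
    linear_combination h1 - hs
  refine ⟨δ, hδ, α, β, fun t ht => ?_⟩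
  have hx : |p.1 + t - p.1| < δ := by simpa using ht
  have hq := hbox (p.1 + t) (u p) hx hup
  obtain ⟨h1, h2, h3⟩ := haff (p.1 + t) hx
  simp only [hse, add_sub_cancel_left] at h1 h2 h3
  have hpt : Ψ (p.1 + t, u p) = p + t • ((1 : ℝ), s) := by
    have h4 : (Ψ (p.1 + t, u p)).1 = p.1 + t := congrArg Prod.fst (hball hq).1.self_of_nhds
    have h5 : (Ψ (p.1, u p)).2 = p.2 := congrArg Prod.snd hΨp
    ext
    · simp [h4]
    · simp [h3, h5]
  have h6 := hrel _ hq
  rw [hpt, h1, h2] at h6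
  exact ⟨h6.1, by linear_combination h6.2⟩

lemma fderiv_const_along_line {u v : ℝ × ℝ → ℝ} (hu : ContDiff ℝ 1 u) (hv : ContDiff ℝ 1 v)
    (htr : ∀ z, fderiv ℝ u z (1, 0) + fderiv ℝ v z (0, 1) = 0)
    (hdet : ∀ z, fderiv ℝ u z (1, 0) * fderiv ℝ v z (0, 1) =
      fderiv ℝ u z (0, 1) * fderiv ℝ v z (1, 0))
    {p : ℝ × ℝ} (hp : fderiv ℝ u p (0, 1) ≠ 0) {s : ℝ}
    (hs : fderiv ℝ u p (1, 0) + s * fderiv ℝ u p (0, 1) = 0) (t : ℝ) :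
    fderiv ℝ u (p + t • (1, s)) (1, 0) + s * fderiv ℝ u (p + t • (1, s)) (0, 1) = 0 ∧
    fderiv ℝ u (p + t • (1, s)) (0, 1) ≠ 0 := by
  obtain ⟨r, hr, α, β, hαβ⟩ := exists_local_affine hu hv htr hdet hp hs
  have hcu : ∀ e, Continuous fun z => fderiv ℝ u z e := fun e =>
    (hu.continuous_fderiv one_ne_zero).clm_apply continuous_const
  set P : ℝ → Prop := fun t =>
    fderiv ℝ u (p + t • (1, s)) (1, 0) + s * fderiv ℝ u (p + t • (1, s)) (0, 1) = 0 ∧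
      fderiv ℝ u (p + t • (1, s)) (0, 1) * (α + β * t) = 1 with hP
  have hPc : IsClosed {t | P t} := by
    have h1 := hcu (1, 0)
    have h2 := hcu (0, 1)
    have h3 : Continuous fun t : ℝ => p + t • ((1 : ℝ), s) := by fun_prop
    have h4 := h1.comp h3
    have h5 := h2.comp h3
    exact (isClosed_eq (h4.add (h5.const_mul s)) continuous_const).inter
      (isClosed_eq (h5.mul (by fun_prop : Continuous fun t : ℝ => α + β * t)) continuous_const)
  have hclopen : IsClopen (interior {t | P t}) := by
    refine ⟨isClosed_of_closure_subset fun t ht => ?_, isOpen_interior⟩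
    have hPt : P t := hPc.closure_subset_iff.2 interior_subset ht
    have hne : fderiv ℝ u (p + t • (1, s)) (0, 1) ≠ 0 := left_ne_zero_of_mul_eq_one hPt.2
    obtain ⟨r', hr', α', β', hαβ'⟩ := exists_local_affine hu hv htr hdet hne hPt.1
    have hαβ'' : ∀ t', |t' - t| < r' →
        fderiv ℝ u (p + t' • (1, s)) (1, 0) + s * fderiv ℝ u (p + t' • (1, s)) (0, 1) = 0 ∧
        fderiv ℝ u (p + t' • (1, s)) (0, 1) * (α' + β' * (t' - t)) = 1 := by
      intro t' ht'
      have := hαβ' (t' - t) ht'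
      rwa [add_assoc, ← add_smul, add_sub_cancel] at this
    have hagree : ∀ t', |t' - t| < r' → P t' → α + β * t' = α' + β' * (t' - t) := by
      intro t' ht' hPt'
      have h1 := hαβ'' t' ht'
      exact mul_left_cancel₀ (left_ne_zero_of_mul_eq_one h1.2) (hPt'.2.trans h1.2.symm)
    obtain ⟨t₁, ht₁, ht₁i⟩ := mem_closure_iff.1 ht (Metric.ball t r') Metric.isOpen_ball
      (Metric.mem_ball_self hr')
    obtain ⟨ε, hε, hsub⟩ := Metric.mem_nhds_iff.1
      ((Metric.isOpen_ball.inter isOpen_interior).mem_nhds ⟨ht₁, ht₁i⟩)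
    have hm1 := hsub (Metric.mem_ball_self hε)
    have hm2 := hsub (show t₁ + ε / 2 ∈ Metric.ball t₁ ε by
      rw [Metric.mem_ball, Real.dist_eq, add_sub_cancel_left, abs_of_pos (by positivity)]
      linarith)
    have e1 := hagree _ hm1.1 (interior_subset (s := {t | P t}) hm1.2)
    have e2 := hagree _ hm2.1 (interior_subset (s := {t | P t}) hm2.2)
    have hβ : β = β' := by
      have : ε / 2 * (β - β') = 0 := by linear_combination e2 - e1
      rcases mul_eq_zero.1 this with h | h <;> linarith
    subst hβ
    refine mem_interior.2 ⟨Metric.ball t r', fun t' ht' => ?_, Metric.isOpen_ball,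
      Metric.mem_ball_self hr'⟩
    obtain ⟨h1, h2⟩ := hαβ'' t' ht'
    exact ⟨h1, by linear_combination h2 + fderiv ℝ u (p + t' • (1, s)) (0, 1) * e1⟩
  have h0 : (0 : ℝ) ∈ interior {t | P t} :=
    mem_interior.2 ⟨Metric.ball 0 r, fun t ht => hαβ t (by simpa using ht), Metric.isOpen_ball,
      Metric.mem_ball_self hr⟩
  have hall : P t := interior_subset (s := {t | P t}) (by
    rw [hclopen.eq_univ ⟨0, h0⟩]; exact Set.mem_univ t)
  exact ⟨hall.1, left_ne_zero_of_mul_eq_one hall.2⟩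

lemma fderiv_swap_apply {v : ℝ × ℝ → ℝ} (hv : ContDiff ℝ 1 v) (z : ℝ × ℝ) (a b : ℝ) :
    fderiv ℝ (fun z => v z.swap) z (a, b) = fderiv ℝ v z.swap (b, a) := by
  have h1 : HasFDerivAt (fun z : ℝ × ℝ => z.swap)
      ((ContinuousLinearMap.snd ℝ ℝ ℝ).prod (ContinuousLinearMap.fst ℝ ℝ ℝ)) z :=
    hasFDerivAt_snd.prodMk hasFDerivAt_fst
  have h2 := ((hv.differentiable one_ne_zero z.swap).hasFDerivAt).comp z h1
  change fderiv ℝ (v ∘ fun z : ℝ × ℝ => z.swap) z (a, b) = _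
  rw [h2.fderiv]
  rfl

/-- If `u_y` vanishes at a point where `v_x` does not, it vanishes on the vertical line through
that point. -/
lemma fderiv_eq_zero_on_vertical_line {u v : ℝ × ℝ → ℝ} (hu : ContDiff ℝ 1 u)
    (hv : ContDiff ℝ 1 v)
    (htr : ∀ z, fderiv ℝ u z (1, 0) + fderiv ℝ v z (0, 1) = 0)
    (hdet : ∀ z, fderiv ℝ u z (1, 0) * fderiv ℝ v z (0, 1) =
      fderiv ℝ u z (0, 1) * fderiv ℝ v z (1, 0))
    {q : ℝ × ℝ} (hq : fderiv ℝ v q (1, 0) ≠ 0) (hq0 : fderiv ℝ u q (0, 1) = 0) (t : ℝ) :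
    fderiv ℝ u (q.1, t) (0, 1) = 0 := by
  have hsw : ContDiff ℝ 1 fun z : ℝ × ℝ => z.swap := contDiff_snd.prodMk contDiff_fst
  have h := fderiv_const_along_line (u := fun z => v z.swap) (v := fun z => u z.swap)
    (hv.comp hsw) (hu.comp hsw)
    (fun z => by
      rw [fderiv_swap_apply hu, fderiv_swap_apply hv]
      linear_combination htr z.swap)
    (fun z => by
      simp only [fderiv_swap_apply hu, fderiv_swap_apply hv]
      linear_combination hdet z.swap)
    (p := q.swap) (by rwa [fderiv_swap_apply hv, Prod.swap_swap]) (s := 0)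
    (by
      rw [fderiv_swap_apply hv, Prod.swap_swap, zero_mul, add_zero]
      have h1 := hdet q
      rw [hq0, zero_mul] at h1
      rcases mul_eq_zero.1 h1 with h1 | h1
      · linear_combination htr q - h1
      · exact h1) (t - q.2)
  have hpt : (q.swap + (t - q.2) • ((1 : ℝ), (0 : ℝ))).swap = (q.1, t) := by ext <;> simp
  simp only [fderiv_swap_apply hv, hpt, zero_mul, add_zero] at h
  have h1 := hdet (q.1, t)
  rw [h.1, mul_zero] at h1
  exact (mul_eq_zero.1 h1.symm).resolve_right h.2

lemma apply_add_smul_of_fderiv_eq_zero_s8 {u : ℝ × ℝ → ℝ} (hu : ContDiff ℝ 1 u) {d : ℝ × ℝ}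
    (hd : ∀ z, fderiv ℝ u z d = 0) (z : ℝ × ℝ) (t : ℝ) : u (z + t • d) = u z := by
  have h1 : ∀ r, HasDerivAt (fun r : ℝ => u (z + r • d)) 0 r := by
    intro r
    have h2 : HasDerivAt (fun r : ℝ => z + r • d) d r := by
      simpa using ((hasDerivAt_id r).smul_const d).const_add z
    have h3 := (hu.differentiable one_ne_zero (z + r • d)).hasFDerivAt.comp_hasDerivAt r h2
    rwa [hd] at h3
  have h4 := is_const_of_deriv_eq_zero (fun r => (h1 r).differentiableAt) (fun r => (h1 r).deriv)
    t 0
  simpa using h4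

lemma eq_const_of_fderiv_eq_zero {u : ℝ × ℝ → ℝ} (hu : ContDiff ℝ 1 u)
    (hx : ∀ z, fderiv ℝ u z (1, 0) = 0) (hy : ∀ z, fderiv ℝ u z (0, 1) = 0) (z w : ℝ × ℝ) :
    u z = u w := by
  refine is_const_of_fderiv_eq_zero (𝕜 := ℝ) (hu.differentiable one_ne_zero) (fun z => ?_) z w
  ext
  · simpa using hx z
  · simpa using hy z

/-- A `C¹` planar map with nilpotent derivative which vanishes at the origin has a fixed direction,
and is invariant under translations in that direction. -/
lemma exists_direction_of_nilpotent_fderiv {u v : ℝ × ℝ → ℝ} (hu : ContDiff ℝ 1 u)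
    (hv : ContDiff ℝ 1 v)
    (htr : ∀ z, fderiv ℝ u z (1, 0) + fderiv ℝ v z (0, 1) = 0)
    (hdet : ∀ z, fderiv ℝ u z (1, 0) * fderiv ℝ v z (0, 1) =
      fderiv ℝ u z (0, 1) * fderiv ℝ v z (1, 0))
    (hu0 : u 0 = 0) (hv0 : v 0 = 0) :
    ∃ d : ℝ × ℝ, d ≠ 0 ∧ ∃ f : ℝ × ℝ → ℝ, Continuous f ∧ (∀ z (t : ℝ), f (z + t • d) = f z) ∧
      ∀ z, (u z, v z) = f z • d := by
  by_cases hall : ∀ z, fderiv ℝ u z (0, 1) = 0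
  · have hux : ∀ z, fderiv ℝ u z (1, 0) = 0 := fun z => by
      have h1 := hdet z
      rw [hall z, zero_mul] at h1
      rcases mul_eq_zero.1 h1 with h1 | h1
      · exact h1
      · linear_combination htr z - h1
    have hvy : ∀ z, fderiv ℝ v z (0, 1) = 0 := fun z => by linear_combination htr z - hux z
    refine ⟨(0, 1), by simp, v, hv.continuous, apply_add_smul_of_fderiv_eq_zero_s8 hv hvy,
      fun z => ?_⟩
    have h1 : u z = 0 := (eq_const_of_fderiv_eq_zero hu hux hall z 0).trans hu0
    ext <;> simp [h1]
  · push Not at hall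
    obtain ⟨p, hp⟩ := hall
    obtain ⟨s, hs⟩ : ∃ s, fderiv ℝ u p (1, 0) + s * fderiv ℝ u p (0, 1) = 0 :=
      ⟨-fderiv ℝ u p (1, 0) / fderiv ℝ u p (0, 1), by field_simp; ring⟩
    have hline := fderiv_const_along_line hu hv htr hdet hp hs
    have hux : ∀ q, fderiv ℝ u q (1, 0) = -s * fderiv ℝ u q (0, 1) := by
      intro q
      by_cases hq : fderiv ℝ u q (0, 1) = 0
      · have h1 := hdet q
        rw [hq, zero_mul] at h1
        rw [hq, mul_zero]
        rcases mul_eq_zero.1 h1 with h1 | h1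
        · exact h1
        · linear_combination htr q - h1
      · obtain ⟨s', hs'⟩ : ∃ s', fderiv ℝ u q (1, 0) + s' * fderiv ℝ u q (0, 1) = 0 :=
          ⟨-fderiv ℝ u q (1, 0) / fderiv ℝ u q (0, 1), by field_simp; ring⟩
        have hline' := fderiv_const_along_line hu hv htr hdet hq hs'
        by_cases hss : s = s'
        · rw [hss]; linear_combination hs'
        · exfalso
          have hne : s' - s ≠ 0 := sub_ne_zero.2 (Ne.symm hss)
          set x := (p.2 - q.2 - s * p.1 + s' * q.1) / (s' - s) with hx
          have hxe : x * (s' - s) = p.2 - q.2 - s * p.1 + s' * q.1 := div_mul_cancel₀ _ hne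
          have e : p + (x - p.1) • ((1 : ℝ), s) = q + (x - q.1) • ((1 : ℝ), s') := by
            ext
            · simp
            · simp only [Prod.snd_add, Prod.smul_snd, smul_eq_mul]
              linear_combination -hxe
          have l1 := hline (x - p.1)
          have l2 := hline' (x - q.1)
          rw [e] at l1
          have : (s' - s) * fderiv ℝ u (q + (x - q.1) • (1, s')) (0, 1) = 0 := by
            linear_combination l2.1 - l1.1
          exact (mul_ne_zero hne l1.2) this
    have hvx : ∀ q, fderiv ℝ v q (1, 0) = s * fderiv ℝ u q (1, 0) := by
      intro q
      by_cases hq : fderiv ℝ u q (0, 1) = 0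
      · rw [hux, hq, mul_zero, mul_zero]
        by_contra hq'
        have h1 := fderiv_eq_zero_on_vertical_line hu hv htr hdet hq' hq
          (p.2 + (q.1 - p.1) * s)
        refine (hline (q.1 - p.1)).2 ?_
        rw [← h1]
        congr 2
        ext <;> simp
      · apply mul_left_cancel₀ hq
        linear_combination -(hdet q) + fderiv ℝ u q (1, 0) * htr q - fderiv ℝ u q (1, 0) * hux q
    have hvy : ∀ q, fderiv ℝ v q (0, 1) = s * fderiv ℝ u q (0, 1) := fun q => by
      linear_combination htr q - hux q
    refine ⟨(1, s), by simp, u, hu.continuous, apply_add_smul_of_fderiv_eq_zero_s8 hu fun z => ?_,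
      fun z => ?_⟩
    · rw [clm_apply_prod, hux]
      ring
    · have hsub : ContDiff ℝ 1 fun z => v z - s * u z := hv.sub (contDiff_const.mul hu)
      have hfd : ∀ z e, fderiv ℝ (fun z => v z - s * u z) z e =
          fderiv ℝ v z e - s * fderiv ℝ u z e := fun z e => by
        have h1 := (hv.differentiable one_ne_zero z).hasFDerivAt.sub
          ((hu.differentiable one_ne_zero z).hasFDerivAt.const_mul s)
        have h2 : fderiv ℝ (fun z => v z - s * u z) z = fderiv ℝ v z - s • fderiv ℝ u z :=
          h1.fderiv
        rw [h2]
        rfl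
      have h3 := eq_const_of_fderiv_eq_zero hsub
        (fun z => by rw [hfd, hvx]; ring) (fun z => by rw [hfd, hvy]; ring) z 0
      simp only [hu0, hv0] at h3
      ext
      · simp
      · simp only [Prod.smul_snd, smul_eq_mul]
        linear_combination h3

lemma exists_shear_form {G : ℝ × ℝ → ℝ × ℝ} (hG : ContDiff ℝ 1 G) (hU : Unipotent G)
    (h0 : G (0, 0) = (0, 0)) :
    ∃ d : ℝ × ℝ, d ≠ 0 ∧ ∃ f : ℝ × ℝ → ℝ, Continuous f ∧ (∀ z (t : ℝ), f (z + t • d) = f z) ∧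
      ∀ z, G z = z + f z • d := by
  have hGd : ∀ z, HasFDerivAt G (fderiv ℝ G z) z := fun z =>
    (hG.differentiable one_ne_zero z).hasFDerivAt
  have hu : ∀ z e, fderiv ℝ (fun z => (G z).1 - z.1) z e = (fderiv ℝ G z e).1 - e.1 := fun z e => by
    have h1 : fderiv ℝ (fun z => (G z).1 - z.1) z = _ := ((hGd z).fst.sub hasFDerivAt_fst).fderiv
    rw [h1]
    rfl
  have hv : ∀ z e, fderiv ℝ (fun z => (G z).2 - z.2) z e = (fderiv ℝ G z e).2 - e.2 := fun z e => by
    have h1 : fderiv ℝ (fun z => (G z).2 - z.2) z = _ := ((hGd z).snd.sub hasFDerivAt_snd).fderiv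
    rw [h1]
    rfl
  have h0' : G 0 = 0 := h0
  obtain ⟨d, hd, f, hf, hinv, hform⟩ := exists_direction_of_nilpotent_fderiv
    (u := fun z => (G z).1 - z.1) (v := fun z => (G z).2 - z.2)
    (hG.fst.sub contDiff_fst) (hG.snd.sub contDiff_snd)
    (fun z => by rw [hu, hv]; linear_combination (hU z).1)
    (fun z => by
      simp only [hu, hv]
      linear_combination (hU z).2 - (hU z).1)
    (by simp [h0']) (by simp [h0'])
  refine ⟨d, hd, f, hf, hinv, fun z => ?_⟩
  rw [← hform]
  ext <;> simp

lemma iterate_shear_s8 {G : ℝ × ℝ → ℝ × ℝ} {d : ℝ × ℝ} {f : ℝ × ℝ → ℝ}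
    (hinv : ∀ z (t : ℝ), f (z + t • d) = f z) (hform : ∀ z, G z = z + f z • d) (n : ℕ)
    (z : ℝ × ℝ) : G^[n] z = z + (n * f z) • d := by
  induction n with
  | zero => simp
  | succ n ih =>
    rw [Function.iterate_succ_apply', ih, hform, hinv, add_assoc, ← add_smul]
    push_cast
    ring_nf

lemma exists_continuous_range_eq {D : Set (ℝ × ℝ)}
    (hD : Nonempty (D ≃ₜ (Metric.closedBall (0 : ℝ × ℝ) 1))) :
    ∃ e : ℝ × ℝ → ℝ × ℝ, Continuous e ∧ Set.range e = D := by
  obtain ⟨h⟩ := hD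
  have hmem : ∀ z : ℝ × ℝ, (max 1 ‖z‖)⁻¹ • z ∈ Metric.closedBall (0 : ℝ × ℝ) 1 := fun z => by
    have h1 : 0 < max 1 ‖z‖ := lt_of_lt_of_le one_pos (le_max_left _ _)
    rw [mem_closedBall_zero_iff, norm_smul, norm_inv, Real.norm_of_nonneg h1.le,
      inv_mul_le_iff₀ h1, mul_one]
    exact le_max_right _ _
  have hc : Continuous fun z : ℝ × ℝ => (max 1 ‖z‖)⁻¹ • z :=
    ((continuous_const.max continuous_norm).inv₀ fun z =>
      (lt_of_lt_of_le one_pos (le_max_left _ _)).ne').smul continuous_id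
  refine ⟨fun z => (h.symm ⟨_, hmem z⟩ : ℝ × ℝ),
    continuous_subtype_val.comp (h.symm.continuous.comp (hc.subtype_mk hmem)), ?_⟩
  ext z
  constructor
  · rintro ⟨y, rfl⟩
    exact Subtype.coe_prop _
  · intro hz
    refine ⟨(h ⟨z, hz⟩ : ℝ × ℝ), ?_⟩
    have h1 : ‖(h ⟨z, hz⟩ : ℝ × ℝ)‖ ≤ 1 := mem_closedBall_zero_iff.1 (h ⟨z, hz⟩).2
    simp [max_eq_left h1]

/-- a `C¹` unipotent map fixing the origin is free on topological disks:
if a topological disk is disjoint from its image, then all its iterates are pairwise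
disjoint. -/
theorem statement8 (G : ℝ × ℝ → ℝ × ℝ) (hG : ContDiff ℝ 1 G) (hU : Unipotent G)
    (h0 : G (0, 0) = (0, 0)) (D : Set (ℝ × ℝ))
    (hD : Nonempty (D ≃ₜ (Metric.closedBall (0 : ℝ × ℝ) 1)))
    (hdisj : (G '' D) ∩ D = ∅) :
    ∀ p q : ℕ, p ≠ q → (G^[p] '' D) ∩ (G^[q] '' D) = ∅ := by
  obtain ⟨d, hd, f, hf, hinv, hform⟩ := exists_shear_form hG hU h0
  have hiter := iterate_shear_s8 hinv hform
  obtain ⟨e, he, heD⟩ := exists_continuous_range_eq hD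
  have heD' : ∀ t, e t ∈ D := fun t => heD ▸ Set.mem_range_self t
  have hGD : ∀ z ∈ D, G z ∉ D := fun z hz hz' =>
    (Set.eq_empty_iff_forall_notMem.1 hdisj (G z)) ⟨Set.mem_image_of_mem G hz, hz'⟩
  have hfD : ∀ z ∈ D, f z ≠ 0 := fun z hz h => hGD z hz (by simpa [hform, h] using hz)
  set N := d.1 ^ 2 + d.2 ^ 2 with hN
  have hN0 : N ≠ 0 := by
    intro h
    have h1 : d.1 = 0 := by nlinarith [sq_nonneg d.1, sq_nonneg d.2]
    have h2 : d.2 = 0 := by nlinarith [sq_nonneg d.1, sq_nonneg d.2]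
    exact hd (Prod.ext h1 h2)
  set m : ℝ × ℝ → ℝ := fun z => (z.1 * d.1 + z.2 * d.2) / N with hm
  set l : ℝ × ℝ → ℝ := fun z => z.2 * d.1 - z.1 * d.2 with hl
  have hmc : Continuous m := by fun_prop
  have hlc : Continuous l := by fun_prop
  have hml : ∀ z w, l z = l w → z = w + (m z - m w) • d := by
    intro z w h
    simp only [hl] at h
    have h1 : (m z - m w) * N = (z.1 - w.1) * d.1 + (z.2 - w.2) * d.2 := by
      simp only [hm]; field_simp; ring
    ext
    · apply mul_right_cancel₀ hN0
      simp only [Prod.fst_add, Prod.smul_fst, smul_eq_mul]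
      linear_combination -d.1 * h1 - d.2 * h + (z.1 - w.1) * hN
    · apply mul_right_cancel₀ hN0
      simp only [Prod.snd_add, Prod.smul_snd, smul_eq_mul]
      linear_combination -d.2 * h1 + d.1 * h + (z.2 - w.2) * hN
  set γ : ℝ × ℝ → ℂ := fun t => ⟨m (e t) / f (e t), l (e t)⟩ with hγ
  have hγc : Continuous γ := by
    have h1 : Continuous fun t => m (e t) / f (e t) :=
      (hmc.comp he).div (hf.comp he) fun t => hfD _ (heD' t)
    exact Complex.equivRealProdCLM.symm.continuous.comp (h1.prodMk (hlc.comp he))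
  have hDc : IsCompact D := by
    obtain ⟨h⟩ := hD
    have : CompactSpace (Metric.closedBall (0 : ℝ × ℝ) 1) :=
      isCompact_iff_compactSpace.1 (isCompact_closedBall 0 1)
    exact isCompact_iff_compactSpace.2 h.symm.compactSpace
  obtain ⟨z₀, hz₀, hmin⟩ := hDc.exists_isMinOn ⟨_, heD' 0⟩ hlc.continuousOn
  obtain ⟨z₁, hz₁, hmax⟩ := hDc.exists_isMaxOn ⟨_, heD' 0⟩ hlc.continuousOn
  rw [← heD] at hz₀ hz₁
  obtain ⟨t₀, rfl⟩ := hz₀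
  obtain ⟨t₁, rfl⟩ := hz₁
  have hchord := natCast_succ_ne_sub hγc (t₀ := t₀) (t₁ := t₁) (fun t => hmin (heD' t))
    (fun t => hmax (heD' t)) (fun s t hst => by
      have h1 : l (e t) = l (e s) := by
        have := congrArg Complex.im hst
        simp only [hγ, Complex.sub_im, Complex.one_im] at this
        linarith
      have h2 := hml _ _ h1
      have h3 : f (e t) = f (e s) := by rw [h2, hinv]
      have h4 := congrArg Complex.re hst
      simp only [hγ, Complex.sub_re, Complex.one_re, h3] at h4
      rw [← sub_div, div_eq_one_iff_eq (hfD _ (heD' s))] at h4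
      rw [h4, ← hform] at h2
      exact hGD _ (heD' s) (h2 ▸ heD' t))
  have hlt : ∀ p n : ℕ, ∀ z ∈ D, ∀ w ∈ D, G^[p] z ≠ G^[p + (n + 1)] w := by
    intro p n z hz w hw h
    rw [← heD] at hz hw
    obtain ⟨t, rfl⟩ := hz
    obtain ⟨s, rfl⟩ := hw
    rw [hiter, hiter] at h
    have h1 : f (e t) = f (e s) := by
      have := congrArg f h
      rwa [hinv, hinv] at this
    rw [h1] at h
    have h2 : e t = e s + ((n + 1) * f (e s)) • d := by
      have h3 := eq_sub_of_add_eq h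
      rw [h3, add_sub_assoc, ← sub_smul]
      push_cast
      ring_nf
    refine hchord n s t (Complex.ext ?_ ?_)
    · have h3 : m (e t) = m (e s) + (n + 1) * f (e s) := by
        rw [h2]
        simp only [hm, Prod.fst_add, Prod.snd_add, Prod.smul_fst, Prod.smul_snd, smul_eq_mul]
        field_simp
        rw [hN]
        ring
      have h4 := hfD _ (heD' s)
      simp only [hγ, Complex.sub_re, h1, h3, Complex.add_re, Complex.natCast_re, Complex.one_re]
      field_simp
      ring
    · simp only [hγ, Complex.sub_im, Complex.add_im, Complex.natCast_im, Complex.one_im]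
      rw [h2]
      simp only [hl, Prod.fst_add, Prod.snd_add, Prod.smul_fst, Prod.smul_snd, smul_eq_mul]
      ring
  intro p q hpq
  refine Set.eq_empty_iff_forall_notMem.2 ?_
  rintro _ ⟨⟨z, hz, rfl⟩, ⟨w, hw, hwz⟩⟩
  rcases lt_or_gt_of_ne hpq with h | h
  · obtain ⟨n, rfl⟩ := Nat.exists_eq_add_of_lt h
    exact hlt p n z hz w hw hwz.symm
  · obtain ⟨n, rfl⟩ := Nat.exists_eq_add_of_lt h
    exact hlt q n w hw z hz hwz
end
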